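/- Let m ≥ 2 and let {Λ_t}_{t∈[0,1]} be a non-negative Legendrian isotopy in ℝ^m × S^{m-1} ≅ ST*ℝ^m such that Λ_0 ∩ Λ_1 = ∅, and assume that Λ_0 is Legendrian isotopic to a fibre {x} × S^{m-1} of ST*ℝ^m. Then the ordered two-component Legendrian links (Λ_0, Λ_1) and (Λ_1, Λ_0) are not Legendrian isotopic to each other. -/

import Mathlib

/-!
STATEMENT 10: If `{Λ_t}_{t∈[0,1]}` is a non-negative Legendrian isotopy in
`ST*ℝ^m ≅ ℝ^m × S^{m-1}` with `Λ_0 ∩ Λ_1 = ∅` and `Λ_0` Legendrian isotopic to a fibre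
`{x} × S^{m-1}`, then the ordered two-component Legendrian links `(Λ_0, Λ_1)` and
`(Λ_1, Λ_0)` are not Legendrian isotopic to each other.  This is the contact-geometric
core of Theorem C: Legendrian linking distinguishes past from future.

Conventions for representing Legendrian isotopies in `ST*ℝ^m`, parameterised by the
sphere via smooth ambient maps `F : ℝ^m × ℝ → ℝ^m × ℝ^m`, are as in Statement 8.
Two ordered two-component links are Legendrian isotopic if there are Legendrian
isotopies connecting the respective components that keep the two components disjoint
at every time.
-/

noncomputable section

open Set Metric
open scoped RealInnerProductSpace

/-- The unit sphere `S^{m-1} ⊂ ℝ^m`. -/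
def sph (m : ℕ) : Set (EuclideanSpace ℝ (Fin m)) := Metric.sphere (0 : EuclideanSpace ℝ (Fin m)) 1

/-- Ambient model `ℝ^m × ℝ^m` of `ST*ℝ^m ≅ ℝ^m × S^{m-1}`. -/
abbrev STSp (m : ℕ) := EuclideanSpace ℝ (Fin m) × EuclideanSpace ℝ (Fin m)

/-- `F : ℝ^m × ℝ → ℝ^m × ℝ^m` represents a Legendrian isotopy `{Λ_t}_{t∈[0,1]}` in
`ST*ℝ^m ≅ ℝ^m × S^{m-1}` parameterised by the sphere: it is smooth, maps
`S^{m-1} × [0,1]` into `ℝ^m × S^{m-1}`, each `F_t|_{S^{m-1}}` is an injective immersion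
(hence an embedding of the compact sphere) onto `Λ_t`, and each `Λ_t` is Legendrian:
every tangent vector `(v,w)` of `Λ_t` at `(x,q)` satisfies `⟨v,q⟩ = 0`. -/
structure IsLegIsotopyST (m : ℕ) (F : EuclideanSpace ℝ (Fin m) × ℝ → STSp m) : Prop where
  smooth : ContDiff ℝ (⊤ : ℕ∞) F
  mem_sphere : ∀ s ∈ sph m, ∀ t ∈ Icc (0:ℝ) 1, (F (s, t)).2 ∈ sph m
  inj : ∀ t ∈ Icc (0:ℝ) 1, InjOn (fun s => F (s, t)) (sph m)
  imm : ∀ t ∈ Icc (0:ℝ) 1, ∀ s ∈ sph m, ∀ v : EuclideanSpace ℝ (Fin m),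
    ⟪v, s⟫ = 0 → v ≠ 0 → fderiv ℝ (fun s' => F (s', t)) s v ≠ 0
  leg : ∀ t ∈ Icc (0:ℝ) 1, ∀ s ∈ sph m, ∀ v : EuclideanSpace ℝ (Fin m), ⟪v, s⟫ = 0 →
    ⟪(fderiv ℝ (fun s' => F (s', t)) s v).1, (F (s, t)).2⟫ = 0

/-- Non-negativity of the Legendrian isotopy: `⟨∂x/∂t, q⟩ ≥ 0`. -/
def NonnegST (m : ℕ) (F : EuclideanSpace ℝ (Fin m) × ℝ → STSp m) : Prop :=
  ∀ s ∈ sph m, ∀ t ∈ Icc (0:ℝ) 1,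
    0 ≤ ⟪deriv (fun t' => (F (s, t')).1) t, (F (s, t)).2⟫

/-- The slice `Λ_t = F_t(S^{m-1})` of the isotopy. -/
def stSlice (m : ℕ) (F : EuclideanSpace ℝ (Fin m) × ℝ → STSp m) (t : ℝ) : Set (STSp m) :=
  (fun s => F (s, t)) '' sph m

/-- The fibre `{x} × S^{m-1}` of `ST*ℝ^m` over `x`. -/
def fib (m : ℕ) (x : EuclideanSpace ℝ (Fin m)) : Set (STSp m) :=
  {x} ×ˢ sph m

/-- The ordered links `(A, B)` and `(A', B')` in `ST*ℝ^m` are Legendrian isotopic: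
there are Legendrian isotopies connecting `A` to `A'` and `B` to `B'` whose time
slices are disjoint at every time `t ∈ [0,1]`. -/
def LegLinkIsotopic (m : ℕ) (A B A' B' : Set (STSp m)) : Prop :=
  ∃ G G' : EuclideanSpace ℝ (Fin m) × ℝ → STSp m,
    IsLegIsotopyST m G ∧ IsLegIsotopyST m G' ∧
    stSlice m G 0 = A ∧ stSlice m G' 0 = B ∧
    stSlice m G 1 = A' ∧ stSlice m G' 1 = B' ∧
    ∀ t ∈ Icc (0:ℝ) 1, stSlice m G t ∩ stSlice m G' t = ∅

set_option linter.unusedSectionVars false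

open MeasureTheory in
theorem not_contDiff_retraction_sphere {Y : Type*} [NormedAddCommGroup Y] [InnerProductSpace ℝ Y]
    [FiniteDimensional ℝ Y] [MeasurableSpace Y] [BorelSpace Y]
    {r : Y → Y} (hr : ContDiff ℝ 1 r) {R : ℝ} (hR : 0 < R)
    (hid : ∀ w, ‖w‖ = R → r w = w) (hn : ∀ w, ‖r w‖ = R) : False := by
  set S : Set Y := closedBall 0 R with hS
  have hScomp : IsCompact S := isCompact_closedBall 0 R
  have hdr : Differentiable ℝ r := hr.differentiable (by norm_num)
  have hcdr : Continuous (fderiv ℝ r) := hr.continuous_fderiv (by norm_num)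
  obtain ⟨K, hK⟩ := hScomp.exists_bound_of_continuousOn
    (f := fun w => fderiv ℝ r w - ContinuousLinearMap.id ℝ Y)
    (hcdr.sub continuous_const).continuousOn
  have hK0 : 0 ≤ K := (norm_nonneg _).trans (hK 0 (by simp [hS, hR.le]))
  set φ : Y → Y := fun w => if ‖w‖ ≤ R then r w - w else 0 with hφ
  have hin : ∀ x y, ‖x‖ ≤ R → ‖y‖ ≤ R → ‖φ x - φ y‖ ≤ K * ‖x - y‖ := by
    intro x y hx hy
    simp only [hφ, hx, hy, if_true]
    have := (convex_closedBall (0:Y) R).norm_image_sub_le_of_norm_hasFDerivWithin_le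
      (f := fun w => r w - w) (f' := fun w => fderiv ℝ r w - ContinuousLinearMap.id ℝ Y)
      (fun w _ => ((hdr w).hasFDerivAt.sub (hasFDerivAt_id w)).hasFDerivWithinAt) hK
      (x := y) (y := x) (by simpa [hS] using hy) (by simpa [hS] using hx)
    simpa using this
  have hsphere : ∀ z, ‖z‖ = R → φ z = 0 := by
    intro z hz
    simp [hφ, hz, hid z hz]
  have hmix : ∀ x y, ‖x‖ ≤ R → R < ‖y‖ → ‖φ x - φ y‖ ≤ K * ‖x - y‖ := by
    intro x y hx hy
    have hφy : φ y = 0 := by simp [hφ, not_le.2 hy]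
    have hc : ContinuousOn (fun s : ℝ => ‖x + s • (y - x)‖) (Icc 0 1) := by fun_prop
    have : R ∈ Icc (‖x + (0:ℝ) • (y - x)‖) (‖x + (1:ℝ) • (y - x)‖) := by
      constructor <;> simp [hx, hy.le]
    obtain ⟨s, ⟨hs0, hs1⟩, hs⟩ := intermediate_value_Icc (zero_le_one) hc this
    simp only at hs
    have h1 := hin x (x + s • (y - x)) hx hs.le
    rw [hsphere _ hs] at h1
    rw [hφy]
    refine h1.trans (mul_le_mul_of_nonneg_left ?_ hK0)
    have : x - (x + s • (y - x)) = s • (x - y) := by module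
    rw [this, norm_smul, Real.norm_eq_abs, abs_of_nonneg hs0]
    nlinarith [norm_nonneg (x - y)]
  have hLip : LipschitzWith (Real.toNNReal K) φ := by
    refine LipschitzWith.of_dist_le_mul fun x y => ?_
    rw [dist_eq_norm, dist_eq_norm, Real.coe_toNNReal _ hK0]
    rcases le_or_gt ‖x‖ R with hx | hx <;> rcases le_or_gt ‖y‖ R with hy | hy
    · exact hin x y hx hy
    · exact hmix x y hx hy
    · rw [norm_sub_rev, norm_sub_rev x]; exact hmix y x hy hx
    · simp [hφ, not_le.2 hx, not_le.2 hy]; positivity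
  -- small times
  have himg : ∀ t : ℝ, 0 ≤ t → t * K < 1 →
      InjOn (fun w => w + t • (r w - w)) S ∧ (fun w => w + t • (r w - w)) '' S = S := by
    intro t ht htK
    have hLt : LipschitzWith (Real.toNNReal (t * K)) (fun w => t • φ w) := by
      refine LipschitzWith.of_dist_le_mul fun x y => ?_
      have := hLip.dist_le_mul x y
      rw [Real.coe_toNNReal _ hK0] at this
      rw [dist_smul₀, Real.coe_toNNReal _ (by positivity), Real.norm_of_nonneg ht, mul_assoc]
      exact mul_le_mul_of_nonneg_left this ht
    have hinj : ∀ x y, x + t • φ x = y + t • φ y → x = y := by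
      intro x y hxy
      have h1 := hLt.dist_le_mul x y
      rw [Real.coe_toNNReal _ (by positivity)] at h1
      have h2 : dist (t • φ x) (t • φ y) = dist x y := by
        rw [dist_eq_norm, dist_eq_norm, ← norm_neg]
        congr 1
        have : t • φ x = y + t • φ y - x := by rw [← hxy]; abel
        rw [this]; abel
      rw [h2] at h1
      have : dist x y ≤ 0 := by nlinarith [dist_nonneg (x := x) (y := y)]
      exact dist_le_zero.1 this
    have hsurj : ∀ y, ∃ x, x + t • φ x = y := by
      intro y
      have hc : ContractingWith (Real.toNNReal (t * K)) (fun w => y - t • φ w) := by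
        refine ⟨by rw [← Real.toNNReal_one]; exact (Real.toNNReal_lt_toNNReal_iff one_pos).2 htK, ?_⟩
        refine LipschitzWith.of_dist_le_mul fun a b => ?_
        rw [dist_sub_left]
        exact hLt.dist_le_mul a b
      refine ⟨ContractingWith.fixedPoint _ hc, ?_⟩
      have : y - t • φ (ContractingWith.fixedPoint _ hc) = _ := hc.fixedPoint_isFixedPt
      nth_rewrite 1 [← this]
      abel
    have hEq : ∀ w ∈ S, w + t • (r w - w) = w + t • φ w := by
      intro w hw
      have : ‖w‖ ≤ R := by simpa [hS] using hw
      simp [hφ, this]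
    have hout : ∀ w, w ∉ S → w + t • φ w = w := by
      intro w hw
      have : ¬ ‖w‖ ≤ R := by simpa [hS] using hw
      simp [hφ, this]
    refine ⟨fun x hx y hy hxy => ?_, ?_⟩
    · simp only at hxy
      rw [hEq x hx, hEq y hy] at hxy
      exact hinj x y hxy
    · rw [image_congr hEq]
      ext y
      constructor
      · rintro ⟨x, hx, rfl⟩
        by_contra h
        have := hinj _ _ (hout _ h)
        simp only at h
        rw [this] at h
        exact h hx
      · intro hy
        obtain ⟨x, hx⟩ := hsurj y
        refine ⟨x, ?_, hx⟩
        by_contra h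
        rw [hout x h] at hx
        rw [hx] at h
        exact h hy
  -- the determinant
  set A : Y → (Y →L[ℝ] Y) := fun w => fderiv ℝ r w - ContinuousLinearMap.id ℝ Y with hA
  set D : ℝ → Y → ℝ := fun t w => (ContinuousLinearMap.id ℝ Y + t • A w).det with hD
  have hdetc : Continuous fun B : Y →L[ℝ] Y => B.det := ContinuousLinearMap.continuous_det
  have hDc : ∀ t, Continuous (D t) := fun t =>
    hdetc.comp (by simp only [hA]; fun_prop)
  have hpos : ∀ t : ℝ, 0 ≤ t → t * K < 1 → ∀ w ∈ S, 0 < D t w := by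
    intro t ht htK w hw
    have hne : ∀ s ∈ Icc (0:ℝ) 1, D (s * t) w ≠ 0 := by
      intro s hs
      have hlt : ‖-((s * t) • A w)‖ < 1 := by
        rw [norm_neg, norm_smul, Real.norm_eq_abs, abs_of_nonneg (mul_nonneg hs.1 ht)]
        have h1 : ‖A w‖ ≤ K := hK w hw
        calc s * t * ‖A w‖ ≤ 1 * t * K := by
              have := hs.2; have := hs.1; gcongr
          _ < 1 := by linarith
      have hu := isUnit_one_sub_of_norm_lt_one hlt
      rw [sub_neg_eq_add] at hu
      have hu2 : IsUnit ((ContinuousLinearMap.id ℝ Y + (s * t) • A w : Y →L[ℝ] Y) : Y →ₗ[ℝ] Y) :=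
        hu.map (ContinuousLinearMap.toLinearMapRingHom (R₁ := ℝ) (M₁ := Y))
      exact ((LinearMap.isUnit_iff_isUnit_det _).1 hu2).ne_zero
    have hc : ContinuousOn (fun s : ℝ => D (s * t) w) (Icc 0 1) :=
      (hdetc.comp (by fun_prop : Continuous fun s : ℝ =>
        ContinuousLinearMap.id ℝ Y + (s * t) • A w)).continuousOn
    by_contra hneg
    have : (0:ℝ) ∈ Icc (D (1 * t) w) (D (0 * t) w) := by
      refine ⟨by simpa using hneg, ?_⟩
      simp [hD, ContinuousLinearMap.det]
    obtain ⟨s, hs, hs0⟩ := intermediate_value_Icc' zero_le_one hc this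
    exact hne s hs hs0
  have hvol : ∀ t : ℝ, 0 ≤ t → t * K < 1 → ∫ w in S, D t w = ∫ w in S, (1:ℝ) := by
    intro t ht htK
    obtain ⟨h1, h2⟩ := himg t ht htK
    have := integral_image_eq_integral_abs_det_fderiv_smul (volume : Measure Y)
      (s := S) (f := fun w => w + t • (r w - w))
      (f' := fun w => ContinuousLinearMap.id ℝ Y + t • A w) isClosed_closedBall.measurableSet
      (fun w _ => ((hasFDerivAt_id w).add
        (((hdr w).hasFDerivAt.sub (hasFDerivAt_id w)).const_smul t)).hasFDerivWithinAt) h1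
      (fun _ => (1:ℝ))
    rw [h2] at this
    rw [this]
    refine setIntegral_congr_fun isClosed_closedBall.measurableSet fun w hw => ?_
    simp only [smul_eq_mul, mul_one]
    exact (abs_of_pos (hpos t ht htK w hw)).symm
  -- polynomial dependence on time
  classical
  set b := Module.finBasis ℝ Y
  set n := Module.finrank ℝ Y with hn'
  have hpoly : ∀ w, ∃ p : Polynomial ℝ, p.degree < (n + 1 : ℕ) ∧ ∀ t, D t w = p.eval t := by
    intro w
    let M := LinearMap.toMatrix b b (A w : Y →ₗ[ℝ] Y)
    refine ⟨(Polynomial.X (R := ℝ) • M.map Polynomial.C +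
      (1 : Matrix (Fin n) (Fin n) ℝ).map Polynomial.C).det, ?_, ?_⟩
    · have := Polynomial.natDegree_det_X_add_C_le M 1
      rw [Fintype.card_fin] at this
      exact lt_of_le_of_lt Polynomial.degree_le_natDegree (by exact_mod_cast Nat.lt_succ_of_le this)
    · intro t
      rw [← Polynomial.coe_evalRingHom, RingHom.map_det]
      simp only [hD, ContinuousLinearMap.det]
      rw [← LinearMap.det_toMatrix b]
      congr 1
      ext i j
      simp [M, LinearMap.toMatrix_apply, Matrix.one_apply, apply_ite,
        Finsupp.single_apply, eq_comm]
      split_ifs <;> ring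
  set t0 : ℝ := 1 / (K + 1) with ht0
  have ht0p : 0 < t0 := by positivity
  set v : ℕ → ℝ := fun i => t0 * (i / (n + 1)) with hv
  have hvs : InjOn v (Finset.range (n+1) : Set ℕ) := by
    intro i _ j _ hij
    simp only [hv] at hij
    have := mul_left_cancel₀ ht0p.ne' hij
    field_simp at this
    exact_mod_cast this
  have hvi : ∀ i ∈ Finset.range (n+1), ∫ w in S, D (v i) w = ∫ w in S, (1:ℝ) := by
    intro i hi
    have hi' : (i:ℝ) < n + 1 := by exact_mod_cast Finset.mem_range.1 hi
    have hq : (i:ℝ)/(n+1) ≤ 1 := by rw [div_le_one (by positivity)]; exact hi'.le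
    apply hvol
    · positivity
    · calc v i * K ≤ t0 * 1 * K := by simp only [hv]; gcongr
        _ < 1 := by
          rw [ht0, mul_one, one_div, ← div_eq_inv_mul, div_lt_one (by positivity)]; linarith
  have hD1 : ∀ w, D 1 w = ∑ i ∈ Finset.range (n+1),
      (Lagrange.basis (Finset.range (n+1)) v i).eval 1 * D (v i) w := by
    intro w
    obtain ⟨p, hp, hpt⟩ := hpoly w
    have := Lagrange.eq_interpolate hvs (by simpa using hp)
    rw [hpt 1]
    conv_lhs => rw [this]
    rw [Lagrange.interpolate_apply, Polynomial.eval_finsetSum]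
    refine Finset.sum_congr rfl fun i _ => ?_
    rw [Polynomial.eval_mul, Polynomial.eval_C, hpt (v i), mul_comm]
  have hDint : ∀ t, IntegrableOn (D t) S := fun t => (hDc t).continuousOn.integrableOn_compact hScomp
  have hI1 : ∫ w in S, D 1 w = ∫ w in S, (1:ℝ) := by
    simp_rw [hD1]
    rw [integral_finsetSum _ (fun i _ => (hDint (v i)).const_mul _)]
    simp_rw [integral_const_mul]
    rw [Finset.sum_congr rfl fun i hi => by rw [hvi i hi], ← Finset.sum_mul]
    have := congrArg (Polynomial.eval (1:ℝ)) (Lagrange.sum_basis hvs ⟨0, by simp⟩)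
    rw [Polynomial.eval_finsetSum, Polynomial.eval_one] at this
    rw [this, one_mul]
  have hne : ∀ w, r w ≠ 0 := fun w h => by
    have := hn w; rw [h, norm_zero] at this; exact hR.ne this
  have hD0 : ∀ w, D 1 w = 0 := by
    intro w
    have h1 : ContinuousLinearMap.id ℝ Y + (1:ℝ) • A w = fderiv ℝ r w := by
      simp [hA]
    simp only [hD, h1]
    by_contra hdet
    have hsur : Function.Surjective (fderiv ℝ r w) := by
      have := (LinearMap.isUnit_iff_isUnit_det (fderiv ℝ r w : Y →ₗ[ℝ] Y)).2 (isUnit_iff_ne_zero.2 hdet)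
      exact ((Module.End.isUnit_iff _).1 this).2
    obtain ⟨z, hz⟩ := hsur (r w)
    have hconst : HasFDerivAt (fun y => ⟪r y, r y⟫) (0 : Y →L[ℝ] ℝ) w := by
      have : (fun y => ⟪r y, r y⟫) = fun _ => R ^ 2 := by
        funext y; rw [real_inner_self_eq_norm_sq, hn]
      rw [this]; exact hasFDerivAt_const _ _
    have h2 := ((hdr w).hasFDerivAt.inner ℝ (hdr w).hasFDerivAt).unique hconst
    have h3 := DFunLike.congr_fun h2 z
    simp [fderivInnerCLM_apply, hz] at h3
    exact hne w h3
  simp_rw [hD0] at hI1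
  simp only [integral_zero, integral_const, smul_eq_mul, mul_one, MeasurableSet.univ,
    measureReal_restrict_apply, univ_inter] at hI1
  have : 0 < volume.real S := by
    rw [measureReal_def, ENNReal.toReal_pos_iff]
    exact ⟨measure_closedBall_pos _ _ hR, hScomp.measure_lt_top⟩
  linarith

/-- A `C¹` self-map of a Euclidean space that is the identity near infinity has a zero. -/
theorem exists_zero_of_eq_id_outside {Y : Type*} [NormedAddCommGroup Y] [InnerProductSpace ℝ Y]
    [FiniteDimensional ℝ Y] {g : Y → Y} (hg : ContDiff ℝ 1 g) {R : ℝ}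
    (hR : ∀ w, R ≤ ‖w‖ → g w = w) : ∃ w, g w = 0 := by
  by_contra! hne
  have hR' : 0 < max R 1 := lt_max_of_lt_right one_pos
  borelize Y
  refine not_contDiff_retraction_sphere (r := fun w => max R 1 • (‖g w‖⁻¹ • g w)) ?_ hR' ?_ ?_
  · exact contDiff_const.smul (((hg.norm ℝ hne).inv fun w => norm_ne_zero_iff.2 (hne w)).smul hg)
  · intro w hw
    have : g w = w := hR w (by rw [hw]; exact le_max_left _ _)
    simp only [this, hw]
    rw [smul_smul, mul_inv_cancel₀ hR'.ne', one_smul]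
  · intro w
    rw [norm_smul, norm_smul, norm_inv, norm_norm, inv_mul_cancel₀ (norm_ne_zero_iff.2 (hne w)),
      mul_one, Real.norm_of_nonneg hR'.le]

/-- A bounded `C²` perturbation with bounded and Lipschitz derivative. -/
structure IsTamePert {V : Type*} [NormedAddCommGroup V] [NormedSpace ℝ V] (B : V → ℝ) : Prop where
  smooth : ContDiff ℝ 2 B
  bound : ∃ C, 0 ≤ C ∧ (∀ z, |B z| ≤ C) ∧ (∀ z, ‖fderiv ℝ B z‖ ≤ C) ∧
    ∀ z z', ‖fderiv ℝ B z - fderiv ℝ B z'‖ ≤ C * ‖z - z'‖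

section MinMax

variable {E X : Type*} [NormedAddCommGroup E] [InnerProductSpace ℝ E] [FiniteDimensional ℝ E]
  [NormedAddCommGroup X] [InnerProductSpace ℝ X] [FiniteDimensional ℝ X]

/-- The quadratic function `‖u‖² - ‖w‖²` perturbed by `B`. -/
def hypFun (B : E × X × X → ℝ) (z : E × X × X) : ℝ := ‖z.2.1‖ ^ 2 - ‖z.2.2‖ ^ 2 + B z

/-- Maps of the negative space, standard near infinity, with unit first component. -/
structure IsMinMaxMap (σ : X → E × X × X) : Prop where
  smooth : ContDiff ℝ 1 σ
  unit : ∀ w, ‖(σ w).1‖ = 1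
  std : ∃ p R, ∀ w, R ≤ ‖w‖ → σ w = (p, 0, w)

/-- The set of levels dominating `f` on some admissible map. -/
def minMaxSet (f : E × X × X → ℝ) : Set ℝ := {h | ∃ σ : X → E × X × X, IsMinMaxMap σ ∧ ∀ w, f (σ w) ≤ h}

/-- The min-max value of `f`. -/
def minMax (f : E × X × X → ℝ) : ℝ := sInf (minMaxSet f)

theorem minMaxSet_nonempty [Nontrivial E] {B : E × X × X → ℝ} (hB : IsTamePert B) :
    (minMaxSet (hypFun B)).Nonempty := by
  obtain ⟨C, hC, hb, -, -⟩ := hB.bound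
  obtain ⟨p, hp⟩ := exists_norm_eq E (zero_le_one' ℝ)
  refine ⟨C, fun w => (p, 0, w), ⟨by fun_prop, fun w => hp, p, 0, fun w _ => rfl⟩, fun w => ?_⟩
  have := (abs_le.1 (hb (p, 0, w))).2
  simp only [hypFun, norm_zero]
  nlinarith [sq_nonneg ‖w‖]

theorem minMaxSet_bddBelow {B : E × X × X → ℝ} (hB : IsTamePert B) :
    BddBelow (minMaxSet (hypFun B)) := by
  obtain ⟨C, hC, hb, -, -⟩ := hB.bound
  refine ⟨-C, ?_⟩
  rintro h ⟨σ, hσ, hle⟩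
  obtain ⟨p, R, hR⟩ := hσ.std
  obtain ⟨w, hw⟩ := exists_zero_of_eq_id_outside (g := fun w => (σ w).2.2)
    (hσ.smooth.snd.snd) (R := R) (fun w hw => by rw [hR w hw])
  refine le_trans ?_ (hle w)
  have := (abs_le.1 (hb (σ w))).1
  simp only [hypFun]
  rw [hw, norm_zero]
  nlinarith [sq_nonneg ‖(σ w).2.1‖]

theorem minMax_le_add [Nontrivial E] {B B' : E × X × X → ℝ} (hB : IsTamePert B)
    (hB' : IsTamePert B') {ε : ℝ}
    (h : ∀ z : E × X × X, ‖z.1‖ = 1 → hypFun B' z ≤ hypFun B z + ε) :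
    minMax (hypFun B') ≤ minMax (hypFun B) + ε := by
  rw [← sub_le_iff_le_add]
  refine le_csInf (minMaxSet_nonempty hB) ?_
  rintro l ⟨σ, hσ, hle⟩
  rw [sub_le_iff_le_add]
  exact csInf_le (minMaxSet_bddBelow hB') ⟨σ, hσ, fun w => (h _ (hσ.unit w)).trans (by gcongr; exact hle w)⟩

theorem tame_taylor {V : Type*} [NormedAddCommGroup V] [NormedSpace ℝ V] {B : V → ℝ} {C : ℝ}
    (hC : 0 ≤ C) (hs : ContDiff ℝ 2 B)
    (hl : ∀ z z', ‖fderiv ℝ B z - fderiv ℝ B z'‖ ≤ C * ‖z - z'‖) (z h : V) :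
    B (z + h) ≤ B z + fderiv ℝ B z h + C * ‖h‖ ^ 2 := by
  have hd : Differentiable ℝ B := hs.differentiable (by norm_num)
  have := (convex_segment z (z + h)).norm_image_sub_le_of_norm_hasFDerivWithin_le'
    (f := B) (f' := fderiv ℝ B) (φ := fderiv ℝ B z) (C := C * ‖h‖)
    (fun x _ => (hd x).hasFDerivAt.hasFDerivWithinAt) (fun x hx => by
      refine (hl x z).trans (mul_le_mul_of_nonneg_left ?_ hC)
      obtain ⟨a, ha, rfl⟩ := (segment_eq_image' ℝ z (z + h)) ▸ hx
      simp only [add_sub_cancel_left, norm_smul, Real.norm_eq_abs, abs_of_nonneg ha.1]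
      nlinarith [ha.2, norm_nonneg h])
    (left_mem_segment ℝ _ _) (right_mem_segment ℝ _ _)
  simp only [add_sub_cancel_left, Real.norm_eq_abs] at this
  have := (abs_le.1 this).2
  nlinarith

set_option maxHeartbeats 1000000 in
theorem minMax_critical [Nontrivial E] {B : E × X × X → ℝ} (hB : IsTamePert B) :
    ∃ z : E × X × X, ‖z.1‖ = 1 ∧ hypFun B z = minMax (hypFun B) ∧
      (∀ a, ⟪a, z.1⟫ = 0 → fderiv ℝ B z (a, 0, 0) = 0) ∧
      (∀ b, 2 * ⟪z.2.1, b⟫ + fderiv ℝ B z (0, b, 0) = 0) ∧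
      (∀ d, -2 * ⟪z.2.2, d⟫ + fderiv ℝ B z (0, 0, d) = 0) := by
  by_contra! hno
  obtain ⟨C, hC, hb, hdb, hl⟩ := hB.bound
  have hs := hB.smooth
  have hBd : Differentiable ℝ B := hs.differentiable (by norm_num)
  set f := hypFun B with hf
  set c := minMax f with hc
  let iE : E →L[ℝ] E × X × X := .inl ℝ E (X × X)
  let iU : X →L[ℝ] E × X × X := (ContinuousLinearMap.inr ℝ E (X × X)).comp (.inl ℝ X X)
  let iW : X →L[ℝ] E × X × X := (ContinuousLinearMap.inr ℝ E (X × X)).comp (.inr ℝ X X)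
  have hiE : ∀ a, ‖iE a‖ = ‖a‖ := fun a => by simp [iE, Prod.norm_def]
  have hiU : ∀ a, ‖iU a‖ = ‖a‖ := fun a => by simp [iU, Prod.norm_def]
  have hiW : ∀ a, ‖iW a‖ = ‖a‖ := fun a => by simp [iW, Prod.norm_def]
  let gP : E × X × X → E := fun z => (InnerProductSpace.toDual ℝ E).symm ((fderiv ℝ B z).comp iE)
  let gu : E × X × X → X := fun z => (InnerProductSpace.toDual ℝ X).symm ((fderiv ℝ B z).comp iU)
  let gw : E × X × X → X := fun z => (InnerProductSpace.toDual ℝ X).symm ((fderiv ℝ B z).comp iW)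
  have hfd : ContDiff ℝ 1 (fderiv ℝ B) := hs.fderiv_right (by norm_num)
  have hgPs : ContDiff ℝ 1 gP :=
    (InnerProductSpace.toDual ℝ E).symm.contDiff.comp (hfd.clm_comp contDiff_const)
  have hgus : ContDiff ℝ 1 gu :=
    (InnerProductSpace.toDual ℝ X).symm.contDiff.comp (hfd.clm_comp contDiff_const)
  have hgws : ContDiff ℝ 1 gw :=
    (InnerProductSpace.toDual ℝ X).symm.contDiff.comp (hfd.clm_comp contDiff_const)
  have hgP : ∀ z a, ⟪gP z, a⟫ = fderiv ℝ B z (a, 0, 0) := fun z a => by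
    simp only [gP, InnerProductSpace.toDual_symm_apply]; rfl
  have hgu : ∀ z a, ⟪gu z, a⟫ = fderiv ℝ B z (0, a, 0) := fun z a => by
    simp only [gu, InnerProductSpace.toDual_symm_apply]; rfl
  have hgw : ∀ z a, ⟪gw z, a⟫ = fderiv ℝ B z (0, 0, a) := fun z a => by
    simp only [gw, InnerProductSpace.toDual_symm_apply]; rfl
  have hgun : ∀ z, ‖gu z‖ ≤ C := fun z => by
    simp only [gu, LinearIsometryEquiv.norm_map]
    refine ContinuousLinearMap.opNorm_le_bound _ hC fun a => ?_
    rw [← hiU a]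
    exact (fderiv ℝ B z).le_of_opNorm_le (hdb z) _
  have hgwn : ∀ z, ‖gw z‖ ≤ C := fun z => by
    simp only [gw, LinearIsometryEquiv.norm_map]
    refine ContinuousLinearMap.opNorm_le_bound _ hC fun a => ?_
    rw [← hiW a]
    exact (fderiv ℝ B z).le_of_opNorm_le (hdb z) _
  let T : E × X × X → E := fun z => gP z - ⟪gP z, z.1⟫ • z.1
  let U : E × X × X → X := fun z => (2:ℝ) • z.2.1 + gu z
  let W : E × X × X → X := fun z => (-2:ℝ) • z.2.2 + gw z
  have hTs : ContDiff ℝ 1 T := hgPs.sub ((hgPs.inner ℝ contDiff_fst).smul contDiff_fst)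
  have hUs : ContDiff ℝ 1 U := (contDiff_const.smul contDiff_snd.fst).add hgus
  have hWs : ContDiff ℝ 1 W := (contDiff_const.smul contDiff_snd.snd).add hgws
  have hfs : ContDiff ℝ 1 f :=
    ((contDiff_snd.fst.norm_sq ℝ).sub (contDiff_snd.snd.norm_sq ℝ)).add (hs.of_le (by norm_num))
  let G : E × X × X → ℝ := fun z => ‖T z‖ ^ 2 + ‖U z‖ ^ 2 + ‖W z‖ ^ 2
  have hTorth : ∀ z : E × X × X, ‖z.1‖ = 1 → ⟪T z, z.1⟫ = 0 := fun z hz => by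
    simp [T, inner_sub_left, inner_smul_left, hz]
  have hTP : ∀ z : E × X × X, ‖z.1‖ = 1 → ⟪gP z, T z⟫ = ‖T z‖ ^ 2 := fun z hz => by
    have h1 : gP z = T z + ⟪gP z, z.1⟫ • z.1 := by simp [T]
    have h2 := hTorth z hz
    rw [real_inner_comm] at h2
    calc ⟪gP z, T z⟫ = ⟪T z + ⟪gP z, z.1⟫ • z.1, T z⟫ := by rw [← h1]
      _ = _ := by rw [inner_add_left, inner_smul_left, h2, mul_zero, add_zero,
                    real_inner_self_eq_norm_sq]
  have hGpos : ∀ z : E × X × X, ‖z.1‖ = 1 → f z = c → 0 < G z := by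
    intro z hz hfz
    by_contra hG
    have h0 : ‖T z‖ ^ 2 = 0 ∧ ‖U z‖ ^ 2 = 0 ∧ ‖W z‖ ^ 2 = 0 := by
      have hG' : ‖T z‖ ^ 2 + ‖U z‖ ^ 2 + ‖W z‖ ^ 2 ≤ 0 := not_lt.1 hG
      refine ⟨?_, ?_, ?_⟩ <;>
        nlinarith [sq_nonneg ‖T z‖, sq_nonneg ‖U z‖, sq_nonneg ‖W z‖]
    simp only [ne_eq, OfNat.ofNat_ne_zero, not_false_eq_true, pow_eq_zero_iff, norm_eq_zero] at h0
    obtain ⟨hT0, hU0, hW0⟩ := h0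
    obtain ⟨d, hd⟩ := hno z hz hfz (fun a ha => by
      have ha' : ⟪z.1, a⟫ = 0 := by rw [real_inner_comm]; exact ha
      rw [← hgP, show gP z = ⟪gP z, z.1⟫ • z.1 from sub_eq_zero.1 hT0, inner_smul_left, ha',
        mul_zero]) (fun b => by
      rw [← hgu, show gu z = -((2:ℝ) • z.2.1) from eq_neg_of_add_eq_zero_right hU0, inner_neg_left,
        inner_smul_left]; simp)
    apply hd
    rw [← hgw, show gw z = -((-2:ℝ) • z.2.2) from eq_neg_of_add_eq_zero_right hW0, inner_neg_left,
        inner_smul_left]; simp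
  obtain ⟨p0, hp0⟩ := exists_norm_eq E (zero_le_one' ℝ)
  obtain ⟨κ, hκ, hκ2, hκG⟩ : ∃ κ : ℝ, 0 < κ ∧ κ ≤ 1 / 2 ∧
      ∀ z : E × X × X, ‖z.1‖ = 1 → |f z - c| ≤ κ → κ ≤ G z := by
    let K : Set (E × X × X) := sphere 0 1 ×ˢ (closedBall 0 (C + 1) ×ˢ closedBall 0 (C + 1))
    have hK : IsCompact K := (isCompact_sphere 0 1).prod
      ((isCompact_closedBall 0 _).prod (isCompact_closedBall 0 _))
    have hcont : Continuous fun z => |f z - c| + G z :=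
      ((hfs.continuous.sub continuous_const).abs).add
        (((hTs.continuous.norm.pow 2).add (hUs.continuous.norm.pow 2)).add
          (hWs.continuous.norm.pow 2))
    have hKne : K.Nonempty := ⟨(p0, 0, 0), mem_sphere_zero_iff_norm.2 hp0,
      mem_closedBall_self (by linarith), mem_closedBall_self (by linarith)⟩
    obtain ⟨z0, hz0, hmin⟩ := hK.exists_isMinOn hKne hcont.continuousOn
    have hGnn : ∀ z, 0 ≤ G z := fun z => by positivity
    have hm : 0 < |f z0 - c| + G z0 := by
      rcases eq_or_ne (f z0) c with h | h
      · have := hGpos z0 (by simpa using hz0.1) h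
        positivity
      · have := hGnn z0
        have := abs_pos.2 (sub_ne_zero.2 h)
        linarith
    refine ⟨min (1 / 2) ((|f z0 - c| + G z0) / 2), by positivity, min_le_left _ _, ?_⟩
    intro z hz hfz
    have hκ1 := min_le_left (1 / 2 : ℝ) ((|f z0 - c| + G z0) / 2)
    have hκ2 := min_le_right (1 / 2 : ℝ) ((|f z0 - c| + G z0) / 2)
    by_cases hu : ‖z.2.1‖ ≤ C + 1
    · by_cases hw : ‖z.2.2‖ ≤ C + 1
      · have : |f z0 - c| + G z0 ≤ |f z - c| + G z :=
          hmin (show z ∈ K by simp [K, mem_prod, hz, hu, hw])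
        linarith
      · have h1 : 1 ≤ ‖W z‖ := by
          have h2 := norm_sub_norm_le ((-2:ℝ) • z.2.2) (-gw z)
          rw [norm_smul, norm_neg, sub_neg_eq_add] at h2
          have := hgwn z
          simp only [norm_neg, Real.norm_ofNat] at h2
          have h3 : 2 * ‖z.2.2‖ - ‖gw z‖ ≤ ‖W z‖ := h2
          linarith
        have : G z = ‖T z‖ ^ 2 + ‖U z‖ ^ 2 + ‖W z‖ ^ 2 := rfl
        nlinarith [sq_nonneg ‖T z‖, sq_nonneg ‖U z‖]
    · have h1 : 1 ≤ ‖U z‖ := by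
        have h2 := norm_sub_norm_le ((2:ℝ) • z.2.1) (-gu z)
        rw [norm_smul, norm_neg, sub_neg_eq_add] at h2
        have := hgun z
        simp only [Real.norm_ofNat] at h2
        have h3 : 2 * ‖z.2.1‖ - ‖gu z‖ ≤ ‖U z‖ := h2
        linarith
      have : G z = ‖T z‖ ^ 2 + ‖U z‖ ^ 2 + ‖W z‖ ^ 2 := rfl
      nlinarith [sq_nonneg ‖T z‖, sq_nonneg ‖W z‖]
  -- the descent step
  set η : ℝ := 1 / (2 * (2 * C + 1)) with hη
  have hηp : 0 < η := by positivity
  have hη1 : η * (2 * C + 1) = 1 / 2 := by rw [hη]; field_simp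
  let s : E × X × X → ℝ := fun z => η * Real.smoothTransition (2 * (f z - c) + 2)
  have hss : ContDiff ℝ 1 s := contDiff_const.mul (Real.smoothTransition.contDiff.comp
    ((contDiff_const.mul (hfs.sub contDiff_const)).add contDiff_const))
  have hs0 : ∀ z, 0 ≤ s z := fun z => mul_nonneg hηp.le (Real.smoothTransition.nonneg _)
  have hs1 : ∀ z, s z ≤ η := fun z =>
    mul_le_of_le_one_right hηp.le (Real.smoothTransition.le_one _)
  let p1 : E × X × X → E := fun z => z.1 - s z • T z
  have hp1s : ContDiff ℝ 1 p1 := contDiff_fst.sub (hss.smul hTs)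
  have hp1n : ∀ z : E × X × X, ‖z.1‖ = 1 → ‖p1 z‖ ^ 2 = 1 + s z ^ 2 * ‖T z‖ ^ 2 := by
    intro z hz
    have h1 := hTorth z hz
    rw [real_inner_comm] at h1
    simp only [p1]
    rw [norm_sub_sq_real, hz, inner_smul_right, h1, norm_smul, mul_pow, Real.norm_eq_abs, sq_abs]
    ring
  have hp1ge : ∀ z : E × X × X, ‖z.1‖ = 1 → 1 ≤ ‖p1 z‖ := by
    intro z hz
    have := hp1n z hz
    by_contra! hlt
    nlinarith [norm_nonneg (p1 z), sq_nonneg (s z * ‖T z‖)]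
  let D : E × X × X → E × X × X := fun z =>
    (‖p1 z‖⁻¹ • p1 z, z.2.1 - s z • U z, z.2.2 - s z • W z)
  have hDesc : ∀ z : E × X × X, ‖z.1‖ = 1 → f (D z) ≤ f z - s z * G z / 2 := by
    intro z hz
    have hh : ‖(-(s z • T z), -(s z • U z), -(s z • W z))‖ ^ 2 ≤ s z ^ 2 * G z := by
      have e : s z ^ 2 * G z = (s z * ‖T z‖) ^ 2 + (s z * ‖U z‖) ^ 2 + (s z * ‖W z‖) ^ 2 := by
        simp only [G]; ring
      rw [e]
      simp only [Prod.norm_def, norm_neg, norm_smul, Real.norm_eq_abs, abs_of_nonneg (hs0 z)]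
      rcases max_choice (s z * ‖T z‖) (max (s z * ‖U z‖) (s z * ‖W z‖)) with h | h <;> rw [h]
      · nlinarith [sq_nonneg (s z * ‖U z‖), sq_nonneg (s z * ‖W z‖)]
      · rcases max_choice (s z * ‖U z‖) (s z * ‖W z‖) with h | h <;> rw [h] <;>
        nlinarith [sq_nonneg (s z * ‖U z‖), sq_nonneg (s z * ‖W z‖), sq_nonneg (s z * ‖T z‖)]
    have h1 := tame_taylor hC hs hl z (-(s z • T z), -(s z • U z), -(s z • W z))
    have hz1 : z + (-(s z • T z), -(s z • U z), -(s z • W z)) =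
        (p1 z, z.2.1 - s z • U z, z.2.2 - s z • W z) := by
      ext1 <;> simp [p1, sub_eq_add_neg]
      ext1 <;> simp
    have hder : fderiv ℝ B z (-(s z • T z), -(s z • U z), -(s z • W z)) =
        -s z * (⟪gP z, T z⟫ + ⟪gu z, U z⟫ + ⟪gw z, W z⟫) := by
      rw [hgP, hgu, hgw, ← map_add, ← map_add, ← smul_eq_mul, ← map_smul]
      congr 1
      simp
    rw [hz1, hder, hTP z hz] at h1
    have h2 : B (D z) ≤ B (p1 z, z.2.1 - s z • U z, z.2.2 - s z • W z) +
        C * (s z ^ 2 * ‖T z‖ ^ 2) := by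
      have h3 := (convex_univ (𝕜 := ℝ) (E := E × X × X)).norm_image_sub_le_of_norm_hasFDerivWithin_le
        (f := B) (f' := fderiv ℝ B) (C := C)
        (fun x _ => (hBd x).hasFDerivAt.hasFDerivWithinAt) (fun x _ => hdb x)
        (mem_univ (p1 z, z.2.1 - s z • U z, z.2.2 - s z • W z)) (mem_univ (D z))
      have h4 : ‖D z - (p1 z, z.2.1 - s z • U z, z.2.2 - s z • W z)‖ ≤ s z ^ 2 * ‖T z‖ ^ 2 := by
        have h5 : D z - (p1 z, z.2.1 - s z • U z, z.2.2 - s z • W z) =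
            iE ((‖p1 z‖⁻¹ - 1) • p1 z) := by
          simp [D, iE, sub_smul]
        have h6 := hp1ge z hz
        have h7 : 0 < ‖p1 z‖ := by linarith
        rw [h5, hiE, norm_smul, Real.norm_eq_abs, abs_of_nonpos (by
          rw [sub_nonpos]; exact inv_le_one_of_one_le₀ h6)]
        have h8 := hp1n z hz
        have : -(‖p1 z‖⁻¹ - 1) * ‖p1 z‖ = ‖p1 z‖ - 1 := by field_simp; ring
        rw [this]
        nlinarith
      have h5 := (abs_le.1 h3).2
      have := h3.trans (mul_le_mul_of_nonneg_left h4 hC)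
      have := (abs_le.1 this).2
      linarith
    have hQ : ‖z.2.1 - s z • U z‖ ^ 2 - ‖z.2.2 - s z • W z‖ ^ 2 ≤ ‖z.2.1‖ ^ 2 - ‖z.2.2‖ ^ 2
        - s z * (⟪(2:ℝ) • z.2.1, U z⟫ + ⟪(-2:ℝ) • z.2.2, W z⟫) + s z ^ 2 * ‖U z‖ ^ 2 := by
      rw [norm_sub_sq_real, norm_sub_sq_real, inner_smul_right, inner_smul_right, norm_smul,
        norm_smul, inner_smul_left, inner_smul_left]
      simp only [mul_pow, Real.norm_eq_abs, sq_abs, conj_trivial]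
      nlinarith [sq_nonneg (s z * ‖W z‖)]
    have hUW : ⟪(2:ℝ) • z.2.1, U z⟫ + ⟪gu z, U z⟫ = ‖U z‖ ^ 2 ∧
        ⟪(-2:ℝ) • z.2.2, W z⟫ + ⟪gw z, W z⟫ = ‖W z‖ ^ 2 := by
      rw [← inner_add_left, ← inner_add_left]
      exact ⟨real_inner_self_eq_norm_sq _, real_inner_self_eq_norm_sq _⟩
    have e1 : f (D z) = ‖z.2.1 - s z • U z‖ ^ 2 - ‖z.2.2 - s z • W z‖ ^ 2 + B (D z) := rfl
    have e2 : f z = ‖z.2.1‖ ^ 2 - ‖z.2.2‖ ^ 2 + B z := rfl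
    have e3 : G z = ‖T z‖ ^ 2 + ‖U z‖ ^ 2 + ‖W z‖ ^ 2 := rfl
    have hGn : 0 ≤ G z := by positivity
    have h9 : f (D z) ≤ f z - s z * G z + (2 * C + 1) * s z ^ 2 * G z := by
      have t1 : C * ‖(-(s z • T z), -(s z • U z), -(s z • W z))‖ ^ 2 ≤ C * (s z ^ 2 * G z) :=
        mul_le_mul_of_nonneg_left hh hC
      have t2 : C * (s z ^ 2 * ‖T z‖ ^ 2) ≤ C * (s z ^ 2 * G z) := by
        refine mul_le_mul_of_nonneg_left (mul_le_mul_of_nonneg_left ?_ (sq_nonneg _)) hC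
        rw [e3]; nlinarith [sq_nonneg ‖U z‖, sq_nonneg ‖W z‖]
      have t3 : s z ^ 2 * ‖U z‖ ^ 2 ≤ s z ^ 2 * G z := by
        refine mul_le_mul_of_nonneg_left ?_ (sq_nonneg _)
        rw [e3]; nlinarith [sq_nonneg ‖T z‖, sq_nonneg ‖W z‖]
      have t4 : s z * G z = s z * ‖T z‖ ^ 2 + s z * (⟪(2:ℝ) • z.2.1, U z⟫ + ⟪gu z, U z⟫) +
          s z * (⟪(-2:ℝ) • z.2.2, W z⟫ + ⟪gw z, W z⟫) := by
        rw [hUW.1, hUW.2, e3]; ring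
      rw [e1]
      linarith
    have h10 : (2 * C + 1) * s z ^ 2 * G z ≤ s z * G z / 2 := by
      have : s z * (2 * C + 1) ≤ 1 / 2 := by
        rw [← hη1]; exact mul_le_mul_of_nonneg_right (hs1 z) (by linarith)
      have := mul_le_mul_of_nonneg_right this (mul_nonneg (hs0 z) hGn)
      linarith
    linarith
  -- conclusion
  have hbdd := minMaxSet_bddBelow hB
  obtain ⟨h, ⟨σ, hσ, hσh⟩, hh⟩ := exists_lt_of_csInf_lt (minMaxSet_nonempty hB)
    (show sInf (minMaxSet f) < c + min κ (η * κ / 4) by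
      rw [← show c = sInf (minMaxSet f) from rfl]
      have : 0 < min κ (η * κ / 4) := by positivity
      linarith)
  have hmem : c - min κ (η * κ / 4) ∈ minMaxSet f := by
    refine ⟨D ∘ σ, ⟨?_, ?_, ?_⟩, ?_⟩
    · have hσs := hσ.smooth
      have hp : ContDiff ℝ 1 fun w => p1 (σ w) := hp1s.comp hσs
      have hne : ∀ w, p1 (σ w) ≠ 0 := fun w h => by
        have := hp1ge _ (hσ.unit w); rw [h, norm_zero] at this; linarith
      exact (((hp.norm ℝ hne).inv fun w => norm_ne_zero_iff.2 (hne w)).smul hp).prodMk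
        ((hσs.snd.fst.sub ((hss.comp hσs).smul (hUs.comp hσs))).prodMk
          (hσs.snd.snd.sub ((hss.comp hσs).smul (hWs.comp hσs))))
    · intro w
      have := hp1ge _ (hσ.unit w)
      simp only [Function.comp, D, norm_smul, norm_inv, norm_norm]
      exact inv_mul_cancel₀ (by linarith)
    · obtain ⟨p, R, hR⟩ := hσ.std
      refine ⟨p, max R (max 1 (C - c + 1)), fun w hw => ?_⟩
      have hw1 := hR w ((le_max_left _ _).trans hw)
      have hw2 : 1 ≤ ‖w‖ := (le_max_left _ _).trans ((le_max_right _ _).trans hw)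
      have hw3 : C - c + 1 ≤ ‖w‖ := (le_max_right _ _).trans ((le_max_right _ _).trans hw)
      have hfle : f (σ w) ≤ c - 1 := by
        have := (abs_le.1 (hb (σ w))).2
        have e : f (σ w) = ‖(σ w).2.1‖ ^ 2 - ‖(σ w).2.2‖ ^ 2 + B (σ w) := rfl
        rw [e]
        have e1 : ‖(σ w).2.1‖ = 0 := by rw [hw1]; simp
        have e2 : (σ w).2.2 = w := by rw [hw1]
        rw [e1, e2]
        nlinarith
      have hs00 : s (σ w) = 0 := by
        simp only [s]
        rw [Real.smoothTransition.zero_of_nonpos (by linarith), mul_zero]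
      have : D (σ w) = σ w := by
        have hu := hσ.unit w
        simp only [D, p1, hs00, zero_smul, sub_zero, hu, inv_one, one_smul]
      rw [Function.comp, this, hw1]
    · intro w
      have hd := hDesc (σ w) (hσ.unit w)
      have hGn : 0 ≤ G (σ w) := by positivity
      have hm1 := min_le_left κ (η * κ / 4)
      have hm2 := min_le_right κ (η * κ / 4)
      have hfw := hσh w
      rcases le_or_gt (f (σ w)) (c - κ) with hcase | hcase
      · have := mul_nonneg (hs0 (σ w)) hGn
        simp only [Function.comp]
        linarith
      · have habs : |f (σ w) - c| ≤ κ := by rw [abs_le]; constructor <;> linarith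
        have hG := hκG _ (hσ.unit w) habs
        have hs1' : s (σ w) = η := by
          simp only [s]
          rw [Real.smoothTransition.one_of_one_le (by linarith), mul_one]
        rw [hs1'] at hd
        simp only [Function.comp]
        nlinarith
  have := csInf_le hbdd hmem
  have hpos : 0 < min κ (η * κ / 4) := by positivity
  have : c ≤ c - min κ (η * κ / 4) := this
  linarith

end MinMax

section Tame
variable {V V' : Type*} [NormedAddCommGroup V] [NormedSpace ℝ V]
  [NormedAddCommGroup V'] [NormedSpace ℝ V']

theorem IsTamePert.of_hasCompactSupport {W : V → ℝ} (hW : ContDiff ℝ 2 W)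
    (hc : HasCompactSupport W) : IsTamePert W := by
  have hd1 : ContDiff ℝ 1 (fderiv ℝ W) := hW.fderiv_right (by norm_cast)
  obtain ⟨K, hK⟩ := hd1.lipschitzWith_of_hasCompactSupport (hc.fderiv ℝ) (by norm_num)
  obtain ⟨C1, h1⟩ := hc.exists_bound_of_continuous hW.continuous
  obtain ⟨C2, h2⟩ := (hc.fderiv ℝ).exists_bound_of_continuous hd1.continuous
  have h10 : 0 ≤ C1 := (norm_nonneg _).trans (h1 0)
  have h20 : 0 ≤ C2 := (norm_nonneg _).trans (h2 0)
  refine ⟨hW.of_le (by norm_cast), C1 + C2 + K, by positivity, fun z => ?_, fun z => ?_, fun z z' => ?_⟩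
  · have := h1 z
    rw [Real.norm_eq_abs] at this
    linarith [K.2]
  · linarith [h2 z, K.2]
  · have := hK.dist_le_mul z z'
    rw [dist_eq_norm, dist_eq_norm] at this
    nlinarith [norm_nonneg (z - z')]

theorem IsTamePert.const_mul {B : V → ℝ} (hB : IsTamePert B) (a : ℝ) :
    IsTamePert fun z => a * B z := by
  obtain ⟨C, hC, h1, h2, h3⟩ := hB.bound
  have hd : Differentiable ℝ B := hB.smooth.differentiable (by norm_num)
  have hf : ∀ z, fderiv ℝ (fun z => a * B z) z = a • fderiv ℝ B z := fun z =>
    fderiv_const_mul (hd z) a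
  refine ⟨contDiff_const.mul hB.smooth, |a| * C, by positivity, fun z => ?_, fun z => ?_, fun z z' => ?_⟩
  · rw [abs_mul]; exact mul_le_mul_of_nonneg_left (h1 z) (abs_nonneg _)
  · rw [hf, norm_smul]; exact mul_le_mul_of_nonneg_left (h2 z) (abs_nonneg _)
  · rw [hf, hf, ← smul_sub, norm_smul, mul_assoc]
    exact mul_le_mul_of_nonneg_left (h3 z z') (abs_nonneg _)

theorem IsTamePert.add {B B' : V → ℝ} (hB : IsTamePert B) (hB' : IsTamePert B') :
    IsTamePert fun z => B z + B' z := by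
  obtain ⟨C, hC, h1, h2, h3⟩ := hB.bound
  obtain ⟨C', hC', h1', h2', h3'⟩ := hB'.bound
  have hd : Differentiable ℝ B := hB.smooth.differentiable (by norm_num)
  have hd' : Differentiable ℝ B' := hB'.smooth.differentiable (by norm_num)
  have hf : ∀ z, fderiv ℝ (fun z => B z + B' z) z = fderiv ℝ B z + fderiv ℝ B' z := fun z =>
    fderiv_fun_add (hd z) (hd' z)
  refine ⟨hB.smooth.add hB'.smooth, C + C', by positivity, fun z => ?_, fun z => ?_, fun z z' => ?_⟩
  · exact (abs_add_le _ _).trans (add_le_add (h1 z) (h1' z))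
  · rw [hf]; exact (norm_add_le _ _).trans (add_le_add (h2 z) (h2' z))
  · rw [hf, hf, add_sub_add_comm, add_mul]
    exact (norm_add_le _ _).trans (add_le_add (h3 z z') (h3' z z'))

theorem IsTamePert.zero : IsTamePert fun _ : V => (0:ℝ) :=
  ⟨contDiff_const, 0, le_rfl, by simp, by simp, by simp⟩

theorem IsTamePert.sum {ι : Type*} {B : ι → V → ℝ} (s : Finset ι) (hB : ∀ i, IsTamePert (B i)) :
    IsTamePert fun z => ∑ i ∈ s, B i z := by
  classical
  induction s using Finset.induction_on with
  | empty => simpa using IsTamePert.zero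
  | insert a s ha ih => simpa [Finset.sum_insert ha] using (hB a).add ih

theorem hasFDerivAt_const_add_clm (A : V' →L[ℝ] V) (v : V) (z : V') :
    HasFDerivAt (fun z => v + A z) A z := A.hasFDerivAt.const_add v

theorem IsTamePert.comp_affine {B : V → ℝ} (hB : IsTamePert B) (A : V' →L[ℝ] V) (v : V) :
    IsTamePert fun z => B (v + A z) := by
  obtain ⟨C, hC, h1, h2, h3⟩ := hB.bound
  have hd : Differentiable ℝ B := hB.smooth.differentiable (by norm_num)
  have hf : ∀ z, fderiv ℝ (fun z => B (v + A z)) z = (fderiv ℝ B (v + A z)).comp A := fun z =>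
    ((hd _).hasFDerivAt.comp z (hasFDerivAt_const_add_clm A v z)).fderiv
  refine ⟨hB.smooth.comp (contDiff_const.add A.contDiff), C * (1 + ‖A‖ + ‖A‖ * ‖A‖), by positivity,
    fun z => ?_, fun z => ?_, fun z z' => ?_⟩
  · refine (h1 _).trans (le_mul_of_one_le_right hC ?_)
    nlinarith [norm_nonneg A]
  · rw [hf]
    refine (ContinuousLinearMap.opNorm_comp_le _ _).trans ?_
    have := mul_le_mul_of_nonneg_right (h2 (v + A z)) (norm_nonneg A)
    nlinarith [norm_nonneg A, mul_nonneg hC (mul_nonneg (norm_nonneg A) (norm_nonneg A))]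
  · rw [hf, hf, ← ContinuousLinearMap.sub_comp]
    refine (ContinuousLinearMap.opNorm_comp_le _ _).trans ?_
    have h4 := h3 (v + A z) (v + A z')
    have h5 : ‖v + A z - (v + A z')‖ ≤ ‖A‖ * ‖z - z'‖ := by
      rw [add_sub_add_left_eq_sub, ← map_sub]; exact A.le_opNorm _
    calc _ ≤ C * (‖A‖ * ‖z - z'‖) * ‖A‖ := by
          refine mul_le_mul_of_nonneg_right (h4.trans ?_) (norm_nonneg _)
          exact mul_le_mul_of_nonneg_left h5 hC
      _ ≤ _ := by
          have a1 : 0 ≤ C * ‖z - z'‖ := by positivity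
          have a2 : 0 ≤ C * ‖z - z'‖ * ‖A‖ := by positivity
          linarith

end Tame

section GenFamily

variable {E : Type*} [NormedAddCommGroup E] [InnerProductSpace ℝ E] [FiniteDimensional ℝ E]

/-- The partial gradient in the base variable. -/
def gradX (W : E × E → ℝ) (z : E × E) : E :=
  (InnerProductSpace.toDual ℝ E).symm ((fderiv ℝ W z).comp (.inl ℝ E E))

/-- The partial gradient in the momentum variable. -/
def gradP (W : E × E → ℝ) (z : E × E) : E :=
  (InnerProductSpace.toDual ℝ E).symm ((fderiv ℝ W z).comp (.inr ℝ E E))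

theorem inner_gradX (W : E × E → ℝ) (z : E × E) (v : E) : ⟪gradX W z, v⟫ = fderiv ℝ W z (v, 0) := by
  simp [gradX]

theorem inner_gradP (W : E × E → ℝ) (z : E × E) (v : E) : ⟪gradP W z, v⟫ = fderiv ℝ W z (0, v) := by
  simp [gradP]

theorem fderiv_eq_inner_grad (W : E × E → ℝ) (z v : E × E) :
    fderiv ℝ W z v = ⟪gradX W z, v.1⟫ + ⟪gradP W z, v.2⟫ := by
  rw [inner_gradX, inner_gradP, ← map_add]; simp

theorem gradX_zero (z : E × E) : gradX (0 : E × E → ℝ) z = 0 := by simp [gradX]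

theorem gradP_zero (z : E × E) : gradP (0 : E × E → ℝ) z = 0 := by simp [gradP]

/-- The sign attached to a side of the generating family. -/
def sideSign (b : Bool) : ℝ := if b then 1 else -1

theorem sideSign_mul_self (b : Bool) : sideSign b * sideSign b = 1 := by
  cases b <;> simp [sideSign]

/-- The fibre variables of the generating family. -/
abbrev FamFibre (E : Type*) (N : ℕ) := PiLp 2 (fun _ : Bool × Fin N => E)

/-- The linear part of the arguments fed to the step with index `j`. -/
def stepArg (N : ℕ) (j : Bool × Fin N) :
    (E × FamFibre E N × FamFibre E N) →L[ℝ] E × E :=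
  LinearMap.toContinuousLinearMap
    { toFun := fun z => (z.2.1 j + z.2.2 j,
        z.1 - ∑ k : Fin N, if j.2 < k then sideSign j.1 • (z.2.1 (j.1, k) - z.2.2 (j.1, k)) else 0)
      map_add' := fun y z => by
        ext1
        · simp; abel
        · simp only [Prod.fst_add, Prod.snd_add, PiLp.add_apply, Prod.mk_add_mk]
          rw [sub_add_sub_comm, ← Finset.sum_add_distrib]
          congr 2; ext1 k
          split_ifs
          · module
          · simp
      map_smul' := fun a z => by
        ext1
        · simp
        · simp only [Prod.smul_fst, Prod.smul_snd, PiLp.smul_apply, RingHom.id_apply]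
          rw [smul_sub, Finset.smul_sum]
          congr 2; ext1 k
          split_ifs
          · module
          · simp }

theorem stepArg_apply (N : ℕ) (j : Bool × Fin N) (z : E × FamFibre E N × FamFibre E N) :
    stepArg N j z = (z.2.1 j + z.2.2 j, z.1 - ∑ k : Fin N,
      if j.2 < k then sideSign j.1 • (z.2.1 (j.1, k) - z.2.2 (j.1, k)) else 0) := rfl

/-- The perturbation term of the generating family. -/
def famPert (x0 : E) (N : ℕ) (W : Bool → ℕ → E × E → ℝ) (z : E × FamFibre E N × FamFibre E N) : ℝ :=
  ∑ j : Bool × Fin N, sideSign j.1 * W j.1 j.2 ((x0, 0) + stepArg N j z)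

/-- The min-max value of the generating family. -/
def famValue (x0 : E) (N : ℕ) (W : Bool → ℕ → E × E → ℝ) : ℝ :=
  minMax (hypFun (famPert x0 N W))

/-- Admissible step functions. -/
structure IsAdmStep (W : E × E → ℝ) : Prop where
  smooth : ContDiff ℝ 2 W
  supp : HasCompactSupport W
  small : ∀ z, ‖gradX W z‖ ≤ 1 / 4 * ‖z.2‖

theorem IsAdmStep.zero : IsAdmStep (0 : E × E → ℝ) :=
  ⟨contDiff_const, HasCompactSupport.zero, fun z => by rw [gradX_zero, norm_zero]; positivity⟩

theorem famPert_tame (x0 : E) (N : ℕ) {W : Bool → ℕ → E × E → ℝ} (hW : ∀ b i, IsAdmStep (W b i)) :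
    IsTamePert (famPert x0 N W) :=
  IsTamePert.sum _ fun j => ((IsTamePert.of_hasCompactSupport (hW j.1 j.2).smooth
    (hW j.1 j.2).supp).comp_affine (stepArg N j) (x0, 0)).const_mul _

theorem famPert_fderiv (x0 : E) (N : ℕ) {W : Bool → ℕ → E × E → ℝ} (hW : ∀ b i, IsAdmStep (W b i))
    (z v : E × FamFibre E N × FamFibre E N) :
    fderiv ℝ (famPert x0 N W) z v = ∑ j : Bool × Fin N, sideSign j.1 *
      (⟪gradX (W j.1 j.2) ((x0, 0) + stepArg N j z), (stepArg N j v).1⟫ +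
        ⟪gradP (W j.1 j.2) ((x0, 0) + stepArg N j z), (stepArg N j v).2⟫) := by
  have : HasFDerivAt (famPert x0 N W) (∑ j : Bool × Fin N, sideSign j.1 •
      (fderiv ℝ (W j.1 j.2) ((x0, 0) + stepArg N j z)).comp (stepArg N j)) z := by
    refine HasFDerivAt.fun_sum fun j _ => ?_
    refine HasFDerivAt.const_mul ?_ _
    have h1 : HasFDerivAt (fun z => (x0, (0:E)) + stepArg N j z) (stepArg N j) z :=
      hasFDerivAt_const_add_clm (stepArg N j) _ z
    have h2 : HasFDerivAt (W j.1 j.2) (fderiv ℝ (W j.1 j.2) ((x0, 0) + stepArg N j z))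
        ((x0, 0) + stepArg N j z) :=
      ((hW j.1 j.2).smooth.differentiable (by simp) _).hasFDerivAt
    exact HasFDerivAt.comp z h2 h1
  rw [this.fderiv]
  simp [fderiv_eq_inner_grad]

theorem famValue_le_add [Nontrivial E] (x0 : E) (N : ℕ) {W W' : Bool → ℕ → E × E → ℝ}
    (hW : ∀ b i, IsAdmStep (W b i)) (hW' : ∀ b i, IsAdmStep (W' b i)) {δ : ℝ}
    (h : ∀ b i z, sideSign b * W' b i z ≤ sideSign b * W b i z + δ) :
    famValue x0 N W' ≤ famValue x0 N W + 2 * N * δ := by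
  refine minMax_le_add (famPert_tame x0 N hW) (famPert_tame x0 N hW') fun z _ => ?_
  have : famPert x0 N W' z ≤ famPert x0 N W z + 2 * N * δ := by
    calc famPert x0 N W' z ≤ ∑ j : Bool × Fin N,
          (sideSign j.1 * W j.1 j.2 ((x0, 0) + stepArg N j z) + δ) :=
          Finset.sum_le_sum fun j _ => h _ _ _
      _ = _ := by
        rw [Finset.sum_add_distrib]
        simp [famPert]
  simp only [hypFun]
  linarith

/-- Discrete trajectories of the steps `W 0, …, W (k - 1)` starting over `x0`. -/
structure IsStepChain (x0 : E) (k : ℕ) (W : ℕ → E × E → ℝ) (x p : ℕ → E) : Prop where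
  start : x 0 = x0
  stepX : ∀ i < k, x (i + 1) = x i + gradP (W i) (x i, p (i + 1))
  stepP : ∀ i < k, p i = p (i + 1) + gradX (W i) (x i, p (i + 1))

/-- The steps `W 0, …, W (k - 1)` generate the set `A` on the momentum range `[M⁻¹, M]`. -/
def Generates (x0 : E) (M : ℝ) (k : ℕ) (W : ℕ → E × E → ℝ) (A : Set (E × E)) : Prop :=
  ∀ x p, IsStepChain x0 k W x p → (∀ i ≤ k, M⁻¹ ≤ ‖p i‖ ∧ ‖p i‖ ≤ M) →
    (x k, ‖p k‖⁻¹ • p k) ∈ A ∧ ∀ i < k, W i (x i, p (i + 1)) = ⟪x (i + 1) - x i, p (i + 1)⟫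

/-- One step carries the set `A` into `A'` on the momentum range `[M⁻¹, M]`. -/
def StepTracks (M : ℝ) (V : E × E → ℝ) (A A' : Set (E × E)) : Prop :=
  ∀ x Q P, Q ≠ 0 → (x, ‖Q‖⁻¹ • Q) ∈ A → Q = P + gradX V (x, P) → M⁻¹ ≤ ‖P‖ → ‖P‖ ≤ M →
    (x + gradP V (x, P), ‖P‖⁻¹ • P) ∈ A' ∧ V (x, P) = ⟪gradP V (x, P), P⟫

theorem StepTracks.zero (M : ℝ) (A : Set (E × E)) : StepTracks M 0 A A := by
  intro x Q P _ hA hQ _ _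
  rw [gradX_zero, add_zero] at hQ
  subst hQ
  rw [gradP_zero]
  simpa using hA

theorem Generates.zero (x0 : E) {M : ℝ} (hM : 0 < M) (W : ℕ → E × E → ℝ) :
    Generates x0 M 0 W ({x0} ×ˢ sphere 0 1) := by
  intro x p hc hp
  have h0 : 0 < ‖p 0‖ := (inv_pos.2 hM).trans_le (hp 0 le_rfl).1
  refine ⟨⟨hc.start, ?_⟩, by simp⟩
  rw [mem_sphere_zero_iff_norm, norm_smul, norm_inv, norm_norm, inv_mul_cancel₀ h0.ne']

theorem Generates.succ {x0 : E} {M : ℝ} (hM : 0 < M) {k : ℕ} {W W' : ℕ → E × E → ℝ}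
    {A A' : Set (E × E)} (hW : Generates x0 M k W A) (hWW : ∀ i < k, W' i = W i)
    (hT : StepTracks M (W' k) A A') : Generates x0 M (k + 1) W' A' := by
  intro x p hc hp
  have hc' : IsStepChain x0 k W x p := ⟨hc.start, fun i hi => by
    rw [← hWW i hi]; exact hc.stepX i (by omega), fun i hi => by
    rw [← hWW i hi]; exact hc.stepP i (by omega)⟩
  obtain ⟨h1, h2⟩ := hW x p hc' fun i hi => hp i (by omega)
  have hk := hp (k + 1) le_rfl
  have h0 : p k ≠ 0 := norm_pos_iff.1 ((inv_pos.2 hM).trans_le (hp k (by omega)).1)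
  obtain ⟨h3, h4⟩ := hT (x k) (p k) (p (k + 1)) h0 h1 (hc.stepP k (by omega)) hk.1 hk.2
  have hx := hc.stepX k (by omega)
  refine ⟨by rw [hx]; exact h3, fun i hi => ?_⟩
  rcases Nat.lt_succ_iff_lt_or_eq.1 hi with hi | rfl
  · rw [hWW i hi]; exact h2 i hi
  · rw [h4, hx, add_sub_cancel_left]

theorem Generates.extend {x0 : E} {M : ℝ} (hM : 0 < M) {k N : ℕ} (hkN : k ≤ N)
    {W : ℕ → E × E → ℝ} {A : Set (E × E)} (hW : Generates x0 M k W A)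
    (h0 : ∀ i, k ≤ i → W i = 0) : Generates x0 M N W A := by
  induction N, hkN using Nat.le_induction with
  | base => exact hW
  | succ n hn ih => exact ih.succ hM (fun _ _ => rfl) (by rw [h0 n hn]; exact StepTracks.zero M A)

theorem IsStepChain.norm_bounds {x0 : E} {N : ℕ} {W : ℕ → E × E → ℝ} {x p : ℕ → E}
    (hc : IsStepChain x0 N W x p) (hW : ∀ i, IsAdmStep (W i)) (hp : ‖p N‖ = 1) :
    ∀ i ≤ N, ((2:ℝ) ^ N)⁻¹ ≤ ‖p i‖ ∧ ‖p i‖ ≤ 2 ^ N := by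
  have key : ∀ j ≤ N, ((2:ℝ) ^ j)⁻¹ ≤ ‖p (N - j)‖ ∧ ‖p (N - j)‖ ≤ 2 ^ j := by
    intro j hj
    induction j with
    | zero => simp [hp]
    | succ j ih =>
      obtain ⟨h1, h2⟩ := ih (by omega)
      have hs := hc.stepP (N - (j + 1)) (by omega)
      rw [show N - (j + 1) + 1 = N - j by omega] at hs
      have hb := (hW (N - (j + 1))).small (x (N - (j + 1)), p (N - j))
      simp only at hb
      rw [hs]
      have t1 := norm_add_le (p (N - j)) (gradX (W (N - (j + 1))) (x (N - (j + 1)), p (N - j)))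
      have t2 := norm_sub_norm_le (p (N - j)) (-gradX (W (N - (j + 1))) (x (N - (j + 1)), p (N - j)))
      rw [norm_neg, sub_neg_eq_add] at t2
      have := norm_nonneg (p (N - j))
      rw [pow_succ, mul_inv]
      constructor <;> linarith
  intro i hi
  obtain ⟨h1, h2⟩ := key (N - i) (by omega)
  rw [show N - (N - i) = i by omega] at h1 h2
  have : (2:ℝ) ^ (N - i) ≤ 2 ^ N := pow_le_pow_right₀ (by norm_num) (by omega)
  exact ⟨(inv_anti₀ (by positivity) this).trans h1, h2.trans this⟩

end GenFamily

section Spec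
variable {E : Type*} [NormedAddCommGroup E] [InnerProductSpace ℝ E] [FiniteDimensional ℝ E]

theorem stepArg_single_left (N : ℕ) (j : Bool × Fin N) (b : Bool) (i : Fin N) (v : E) :
    stepArg N j (0, WithLp.toLp 2 (Pi.single (b, i) v), 0) =
      (if j = (b, i) then v else 0, if j.1 = b ∧ j.2 < i then -(sideSign b • v) else 0) := by
  rw [stepArg_apply]
  ext1
  · simp [Pi.single_apply]
  · simp only [PiLp.zero_apply, sub_zero, Pi.single_apply, Prod.mk.injEq, zero_sub]
    by_cases hb : j.1 = b
    · rw [Finset.sum_eq_single i]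
      · subst hb
        split_ifs <;> simp_all
      · intro k _ hk
        simp [hk]
      · simp
    · simp [hb]

theorem stepArg_single_right (N : ℕ) (j : Bool × Fin N) (b : Bool) (i : Fin N) (v : E) :
    stepArg N j (0, 0, WithLp.toLp 2 (Pi.single (b, i) v)) =
      (if j = (b, i) then v else 0, if j.1 = b ∧ j.2 < i then sideSign b • v else 0) := by
  rw [stepArg_apply]
  ext1
  · simp [Pi.single_apply]
  · simp only [PiLp.zero_apply, zero_sub, Pi.single_apply, Prod.mk.injEq]
    by_cases hb : j.1 = b
    · rw [Finset.sum_eq_single i]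
      · subst hb
        split_ifs <;> simp_all
      · intro k _ hk
        simp [hk]
      · simp
    · simp [hb]

theorem inner_toLp_single {N : ℕ} (u : FamFibre E N) (j : Bool × Fin N) (v : E) :
    ⟪u, WithLp.toLp 2 (Pi.single j v)⟫ = ⟪u j, v⟫ := by
  rw [PiLp.inner_apply, Finset.sum_eq_single j]
  · simp
  · intro k _ hk
    simp [Pi.single_eq_of_ne hk]
  · simp

theorem sum_side {N : ℕ} (f : Bool × Fin N → ℝ) (b : Bool) (i : Fin N) :
    ∑ j : Bool × Fin N, (if j.1 = b ∧ j.2 < i then f j else 0) =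
      ∑ k : Fin N, if k < i then f (b, k) else 0 := by
  rw [Fintype.sum_prod_type]
  cases b <;> simp

theorem sum_range_ite_lt (N i : ℕ) (hi : i ≤ N) (f : ℕ → E) :
    ∑ k ∈ Finset.range N, (if k < i then f k else 0) = ∑ k ∈ Finset.range i, f k := by
  rw [← Finset.sum_filter]
  congr 1
  ext k; simp; omega

set_option maxHeartbeats 1000000 in
theorem famValue_spec [Nontrivial E] (x0 : E) (N : ℕ) {W : Bool → ℕ → E × E → ℝ}
    (hW : ∀ b i, IsAdmStep (W b i)) {A : Bool → Set (E × E)}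
    (hA : ∀ b, Generates x0 (2 ^ N) N (W b) (A b)) :
    ∃ p XL XR, (XL, p) ∈ A true ∧ (XR, p) ∈ A false ∧ XL = XR + famValue x0 N W • p := by
  obtain ⟨z, hz1, hzc, hza, hzb, hzd⟩ := minMax_critical (famPert_tame x0 N hW)
  have hder := famPert_fderiv x0 N hW z
  set GX : Bool × Fin N → E := fun j => gradX (W j.1 j.2) ((x0, 0) + stepArg N j z) with hGX
  set GP : Bool × Fin N → E := fun j => gradP (W j.1 j.2) ((x0, 0) + stepArg N j z) with hGP
  have hdl : ∀ b i v, fderiv ℝ (famPert x0 N W) z (0, WithLp.toLp 2 (Pi.single (b, i) v), 0) =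
      sideSign b * ⟪GX (b, i), v⟫ - ∑ k : Fin N, if k < i then ⟪GP (b, k), v⟫ else 0 := by
    intro b i v
    rw [hder]
    have : ∀ j : Bool × Fin N, sideSign j.1 * (⟪GX j, (stepArg N j (0, WithLp.toLp 2 (Pi.single (b, i) v), 0)).1⟫ +
        ⟪GP j, (stepArg N j (0, WithLp.toLp 2 (Pi.single (b, i) v), 0)).2⟫) =
        (if j = (b, i) then sideSign b * ⟪GX (b, i), v⟫ else 0) -
          (if j.1 = b ∧ j.2 < i then ⟪GP j, v⟫ else 0) := by
      intro j
      rw [stepArg_single_left]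
      have hs := sideSign_mul_self b
      split_ifs with h1 h2 h2
      · rw [h1] at h2; simp at h2
      · simp [h1]
      · simp only [inner_zero_right, inner_neg_right, inner_smul_right, h2.1]
        linear_combination (-⟪GP j, v⟫) * hs
      · simp
    rw [Finset.sum_congr rfl fun j _ => this j, Finset.sum_sub_distrib, sum_side]
    simp
  have hdr : ∀ b i v, fderiv ℝ (famPert x0 N W) z (0, 0, WithLp.toLp 2 (Pi.single (b, i) v)) =
      sideSign b * ⟪GX (b, i), v⟫ + ∑ k : Fin N, if k < i then ⟪GP (b, k), v⟫ else 0 := by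
    intro b i v
    rw [hder]
    have : ∀ j : Bool × Fin N, sideSign j.1 * (⟪GX j, (stepArg N j (0, 0, WithLp.toLp 2 (Pi.single (b, i) v))).1⟫ +
        ⟪GP j, (stepArg N j (0, 0, WithLp.toLp 2 (Pi.single (b, i) v))).2⟫) =
        (if j = (b, i) then sideSign b * ⟪GX (b, i), v⟫ else 0) +
          (if j.1 = b ∧ j.2 < i then ⟪GP j, v⟫ else 0) := by
      intro j
      rw [stepArg_single_right]
      have hs := sideSign_mul_self b
      split_ifs with h1 h2 h2
      · rw [h1] at h2; simp at h2
      · simp [h1]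
      · simp only [inner_zero_right, inner_smul_right, h2.1]
        linear_combination (⟪GP j, v⟫) * hs
      · simp
    rw [Finset.sum_congr rfl fun j _ => this j, Finset.sum_add_distrib, sum_side]
    simp
  have hd : ∀ b i, sideSign b • (z.2.1 (b, i) - z.2.2 (b, i)) = -GX (b, i) := by
    intro b i
    refine ext_inner_right ℝ fun v => ?_
    have h1 := hzb (WithLp.toLp 2 (Pi.single (b, i) v))
    have h2 := hzd (WithLp.toLp 2 (Pi.single (b, i) v))
    rw [hdl, inner_toLp_single] at h1
    rw [hdr, inner_toLp_single] at h2
    rw [inner_smul_left, inner_sub_left, inner_neg_left]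
    simp only [conj_trivial]
    have hs := sideSign_mul_self b
    linear_combination (sideSign b / 2) * (h1 + h2) - ⟪GX (b, i), v⟫ * hs
  have hy : ∀ b i, z.2.1 (b, i) + z.2.2 (b, i) = ∑ k : Fin N, if k < i then GP (b, k) else 0 := by
    intro b i
    refine ext_inner_right ℝ fun v => ?_
    have h1 := hzb (WithLp.toLp 2 (Pi.single (b, i) v))
    have h2 := hzd (WithLp.toLp 2 (Pi.single (b, i) v))
    rw [hdl, inner_toLp_single] at h1
    rw [hdr, inner_toLp_single] at h2
    rw [inner_add_left, sum_inner]
    have : ∀ k : Fin N, ⟪if k < i then GP (b, k) else 0, v⟫ = if k < i then ⟪GP (b, k), v⟫ else 0 := by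
      intro k; split_ifs <;> simp
    simp only [this]
    linarith
  set gX : Bool → ℕ → E := fun b k => if h : k < N then GX (b, ⟨k, h⟩) else 0 with hgX
  set gP : Bool → ℕ → E := fun b k => if h : k < N then GP (b, ⟨k, h⟩) else 0 with hgP
  have hgXf : ∀ b (i : Fin N), GX (b, i) = gX b i := fun b i => by simp [hgX]
  have hgPf : ∀ b (i : Fin N), GP (b, i) = gP b i := fun b i => by simp [hgP]
  set xs : Bool → ℕ → E := fun b i => x0 + ∑ k ∈ Finset.range i, gP b k with hxs
  set ps : Bool → ℕ → E := fun b i => z.1 + ∑ k ∈ Finset.range N, if i ≤ k then gX b k else 0 with hps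
  have harg : ∀ b (i : Fin N), (x0, 0) + stepArg N (b, i) z = (xs b i, ps b (i + 1)) := by
    intro b i
    rw [stepArg_apply]
    ext1
    · simp only [Prod.fst_add, hxs, hy, hgPf]
      rw [← sum_range_ite_lt N i i.2.le, ← Fin.sum_univ_eq_sum_range]
      rfl
    · simp only [Prod.snd_add, zero_add, hps, sub_eq_add_neg]
      rw [← Finset.sum_neg_distrib, ← Fin.sum_univ_eq_sum_range (fun k => if (i:ℕ) + 1 ≤ k then gX b k else 0)]
      congr 1
      refine Finset.sum_congr rfl fun k _ => ?_
      simp only [Nat.succ_le_iff, Fin.lt_def]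
      split_ifs
      · rw [← sub_eq_add_neg, hd, hgXf, neg_neg]
      · exact neg_zero
  have hxsucc : ∀ b i, xs b (i + 1) = xs b i + gP b i := fun b i => by
    simp only [hxs, Finset.sum_range_succ, add_assoc]
  have hpsucc : ∀ b i, i < N → ps b i = ps b (i + 1) + gX b i := by
    intro b i hi
    simp only [hps]
    have : gX b i = ∑ k ∈ Finset.range N, if k = i then gX b k else 0 := by
      rw [Finset.sum_ite_eq']; simp [hi]
    rw [add_assoc, this, ← Finset.sum_add_distrib]
    congr 1
    refine Finset.sum_congr rfl fun k _ => ?_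
    rcases lt_trichotomy k i with h | h | h
    · rw [if_neg (by omega), if_neg (by omega), if_neg (by omega), add_zero]
    · rw [if_pos (by omega), if_neg (by omega), if_pos h, zero_add]
    · rw [if_pos (by omega), if_pos (by omega), if_neg (by omega), add_zero]
  have hpN : ∀ b, ps b N = z.1 := by
    intro b
    simp only [hps]
    rw [Finset.sum_eq_zero, add_zero]
    intro k hk
    rw [if_neg]; simpa using hk
  have hchain : ∀ b, IsStepChain x0 N (W b) (xs b) (ps b) := by
    intro b
    refine ⟨by simp [hxs], fun i hi => ?_, fun i hi => ?_⟩
    · rw [hxsucc, ← harg b ⟨i, hi⟩]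
      simp [hgP, hi, hGP]
    · rw [hpsucc b i hi, ← harg b ⟨i, hi⟩]
      simp [hgX, hi, hGX]
  have hgen : ∀ b, (xs b N, z.1) ∈ A b ∧
      ∀ i < N, W b i (xs b i, ps b (i + 1)) = ⟪gP b i, ps b (i + 1)⟫ := by
    intro b
    obtain ⟨h1, h2⟩ := hA b _ _ (hchain b)
      ((hchain b).norm_bounds (hW b) (by rw [hpN, hz1]))
    rw [hpN, hz1, inv_one, one_smul] at h1
    refine ⟨h1, fun i hi => ?_⟩
    rw [h2 i hi, hxsucc, add_sub_cancel_left]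
  set D := xs true N - xs false N with hD
  have hDp : ∀ a, ⟪a, z.1⟫ = 0 → ⟪D, a⟫ = 0 := by
    intro a ha
    have h1 := hza a ha
    rw [hder] at h1
    change ∑ j : Bool × Fin N, sideSign j.1 * (⟪GX j, (stepArg N j (a, 0, 0)).1⟫ +
      ⟪GP j, (stepArg N j (a, 0, 0)).2⟫) = 0 at h1
    have h2 : ∀ j, stepArg N j ((a, 0, 0) : E × FamFibre E N × FamFibre E N) = (0, a) := by
      intro j; rw [stepArg_apply]; simp
    simp only [h2, inner_zero_right, zero_add] at h1
    rw [Fintype.sum_prod_type] at h1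
    simp only [Fintype.sum_bool, sideSign, if_true, Bool.false_eq_true, if_false, hgPf] at h1
    rw [Fin.sum_univ_eq_sum_range (fun i => 1 * ⟪gP true i, a⟫),
      Fin.sum_univ_eq_sum_range (fun i => -1 * ⟪gP false i, a⟫), ← Finset.mul_sum,
      ← Finset.mul_sum, ← sum_inner, ← sum_inner] at h1
    simp only [hD, hxs, add_sub_add_left_eq_sub, inner_sub_left]
    linarith
  have hDz : D = ⟪D, z.1⟫ • z.1 := by
    have h0 : ⟪D - ⟪D, z.1⟫ • z.1, z.1⟫ = 0 := by
      rw [inner_sub_left, inner_smul_left, real_inner_self_eq_norm_sq, hz1]; simp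
    have h1 := hDp _ h0
    have : ⟪D - ⟪D, z.1⟫ • z.1, D - ⟪D, z.1⟫ • z.1⟫ = 0 := by
      nth_rewrite 1 [inner_sub_left]
      rw [h1, inner_smul_left, real_inner_comm (D - ⟪D, z.1⟫ • z.1) z.1, h0]; simp
    exact sub_eq_zero.1 (inner_self_eq_zero.1 this)
  have hval : famValue x0 N W = ⟪D, z.1⟫ := by
    rw [famValue, ← hzc, hypFun, PiLp.norm_sq_eq_of_L2, PiLp.norm_sq_eq_of_L2, famPert,
      ← Finset.sum_sub_distrib, ← Finset.sum_add_distrib]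
    have hterm : ∀ j : Bool × Fin N, ‖z.2.1 j‖ ^ 2 - ‖z.2.2 j‖ ^ 2 +
        sideSign j.1 * W j.1 j.2 ((x0, 0) + stepArg N j z) =
        sideSign j.1 * (⟪xs j.1 (j.2 + 1) - x0, ps j.1 (j.2 + 1)⟫ - ⟪xs j.1 j.2 - x0, ps j.1 j.2⟫) := by
      rintro ⟨b, i⟩
      have h1 : ‖z.2.1 (b, i)‖ ^ 2 - ‖z.2.2 (b, i)‖ ^ 2 =
          sideSign b * ⟪z.2.1 (b, i) + z.2.2 (b, i), sideSign b • (z.2.1 (b, i) - z.2.2 (b, i))⟫ := by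
        rw [inner_smul_right, ← mul_assoc, sideSign_mul_self, one_mul, inner_add_left,
          inner_sub_right, inner_sub_right, real_inner_self_eq_norm_sq, real_inner_self_eq_norm_sq,
          real_inner_comm]
        ring
      have h2 : z.2.1 (b, i) + z.2.2 (b, i) = xs b i - x0 := by
        have := congrArg Prod.fst (harg b i)
        rw [stepArg_apply] at this
        simp only [Prod.fst_add] at this
        rw [← this, add_sub_cancel_left]
      have h3 := hpsucc b i i.2
      simp only
      rw [harg, (hgen b).2 i i.2, h1, h2, hd, hgXf, hxsucc, h3]
      simp only [inner_neg_right, inner_add_right, inner_sub_left, inner_add_left]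
      ring
    rw [Finset.sum_congr rfl fun j _ => hterm j, Fintype.sum_prod_type]
    have hside : ∀ b, ∑ i : Fin N, sideSign b * (⟪xs b (i + 1) - x0, ps b (i + 1)⟫ -
        ⟪xs b i - x0, ps b i⟫) = sideSign b * ⟪xs b N - x0, z.1⟫ := by
      intro b
      rw [← Finset.mul_sum, Fin.sum_univ_eq_sum_range (fun i => ⟪xs b (i + 1) - x0, ps b (i + 1)⟫ -
        ⟪xs b i - x0, ps b i⟫), Finset.sum_range_sub (fun i => ⟪xs b i - x0, ps b i⟫), hpN]
      simp [hxs]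
    refine (Finset.sum_congr rfl fun b _ => hside b).trans ?_
    simp only [Fintype.sum_bool, sideSign, if_true, Bool.false_eq_true, if_false]
    rw [hD, show xs true N - xs false N = (xs true N - x0) - (xs false N - x0) by abel,
      inner_sub_left (xs true N - x0)]
    ring
  refine ⟨z.1, xs true N, xs false N, (hgen true).1, (hgen false).1, ?_⟩
  rw [hval, ← hDz, hD]
  abel

end Spec

section LeftInverse
open Filter Topology
variable {E T Z : Type*} [NormedAddCommGroup E] [NormedSpace ℝ E] [FiniteDimensional ℝ E]
  [NormedAddCommGroup T] [NormedSpace ℝ T] [FiniteDimensional ℝ T]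
  [NormedAddCommGroup Z] [NormedSpace ℝ Z] [FiniteDimensional ℝ Z]

/-- Near `y` there is a `C²` function recovering the parameter `s ∈ S` from `k (s, τ)` and `τ`. -/
def HasLocalSection (k : E × T → Z) (S : Set E) (y : Z × T) : Prop :=
  ∃ U ∈ 𝓝 y, ∃ g : Z × T → E, ContDiffOn ℝ 2 g U ∧ ∀ w ∈ U, ∀ s ∈ S, w.1 = k (s, w.2) → g w = s

theorem isOpen_hasLocalSection (k : E × T → Z) (S : Set E) :
    IsOpen {y | HasLocalSection k S y} := by
  rw [isOpen_iff_mem_nhds]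
  rintro y ⟨U, hU, g, hg, hs⟩
  filter_upwards [eventually_mem_nhds_iff.2 hU] with y' hy'
  exact ⟨U, hy', g, hg, hs⟩

theorem HasLocalSection.of_not_mem {k : E × T → Z} {S : Set E} (hS : IsCompact S)
    (hk : Continuous k) {y : Z × T} (hy : ∀ s ∈ S, y.1 ≠ k (s, y.2)) : HasLocalSection k S y := by
  have h : ∀ᶠ w in 𝓝 y, ∀ s ∈ S, w.1 ≠ k (s, w.2) := by
    refine hS.eventually_forall_of_forall_eventually fun s hs => ?_
    have : Continuous fun p : (Z × T) × E => k (p.2, p.1.2) := by fun_prop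
    have h1 : Continuous fun p : (Z × T) × E => p.1.1 := by fun_prop
    exact (isOpen_ne_fun h1 this).mem_nhds (hy s hs)
  exact ⟨_, h, fun _ => 0, contDiffOn_const, fun w hw s hs he => (hw s hs he).elim⟩

theorem hasLocalSection_image {k : E × T → Z} {S : Set E} (hS : IsCompact S)
    (hk : ContDiff ℝ 2 k) {h : E → ℝ} (hh : ContDiff ℝ 2 h) (hh1 : ∀ s ∈ S, h s = 1) {τ0 : T}
    (hinj : InjOn (fun s => k (s, τ0)) S)
    (himm : ∀ s ∈ S, ∀ w, fderiv ℝ k (s, τ0) (w, 0) = 0 → fderiv ℝ h s w = 0 → w = 0)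
    {s1 : E} (hs1 : s1 ∈ S) : HasLocalSection k S (k (s1, τ0), τ0) := by
  set Φ : T × E → Z × ℝ := fun p => (k (p.2, p.1), h p.2) with hΦ
  have hΦc : ContDiff ℝ 2 Φ := by
    refine ContDiff.prodMk (hk.comp (contDiff_snd.prodMk contDiff_fst)) (hh.comp contDiff_snd)
  set L : T × E →L[ℝ] Z × ℝ := fderiv ℝ Φ (τ0, s1) with hL
  have hLd : HasFDerivAt Φ L (τ0, s1) := (hΦc.differentiable (by norm_num) _).hasFDerivAt
  have hLval : ∀ w, L (0, w) = (fderiv ℝ k (s1, τ0) (w, 0), fderiv ℝ h s1 w) := by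
    intro w
    have h1 : HasFDerivAt (fun p : T × E => k (p.2, p.1)) ((fderiv ℝ k (s1, τ0)).comp
        ((ContinuousLinearMap.snd ℝ T E).prod (ContinuousLinearMap.fst ℝ T E))) (τ0, s1) :=
      HasFDerivAt.comp (τ0, s1) (f := fun p : T × E => (p.2, p.1)) (g := k)
        (hk.differentiable (by norm_num) (s1, τ0)).hasFDerivAt
        (hasFDerivAt_snd.prodMk hasFDerivAt_fst)
    have h2 : HasFDerivAt (fun p : T × E => h p.2) ((fderiv ℝ h s1).comp
        (ContinuousLinearMap.snd ℝ T E)) (τ0, s1) :=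
      HasFDerivAt.comp (τ0, s1) (f := fun p : T × E => p.2) (g := h)
        (hh.differentiable (by norm_num) s1).hasFDerivAt hasFDerivAt_snd
    rw [hLd.unique (h1.prodMk h2)]
    simp
  have hker : LinearMap.ker ((L.comp (.inr ℝ T E) : E →L[ℝ] Z × ℝ) : E →ₗ[ℝ] Z × ℝ) = ⊥ := by
    rw [LinearMap.ker_eq_bot']
    intro w hw
    have : L (0, w) = 0 := hw
    rw [hLval, Prod.mk_eq_zero] at this
    exact himm s1 hs1 w this.1 this.2
  obtain ⟨A0, hA0⟩ := LinearMap.exists_leftInverse_of_injective _ hker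
  set A : Z × ℝ →L[ℝ] E := LinearMap.toContinuousLinearMap A0 with hA
  have hAL : ∀ w, A (L (0, w)) = w := fun w => LinearMap.congr_fun hA0 w
  set e : (T × E) ≃L[ℝ] (T × E) := (ContinuousLinearEquiv.refl ℝ T).skewProd
    (ContinuousLinearEquiv.refl ℝ E) ((A.comp L).comp (.inl ℝ T E)) with he
  set Θ : T × E → T × E := fun p => (p.1, A (Φ p)) with hΘ
  have hΘc : ContDiff ℝ 2 Θ := contDiff_fst.prodMk (A.contDiff.comp hΦc)
  have hΘd : HasFDerivAt Θ (e : T × E →L[ℝ] T × E) (τ0, s1) := by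
    have h1 : HasFDerivAt Θ ((ContinuousLinearMap.fst ℝ T E).prod (A.comp L)) (τ0, s1) :=
      hasFDerivAt_fst.prodMk (A.hasFDerivAt.comp (τ0, s1) hLd)
    refine h1.congr_fderiv ?_
    refine ContinuousLinearMap.ext fun p => Prod.ext rfl ?_
    change A (L p) = p.2 + A (L (p.1, 0))
    have h2 : A (L p) = A (L (0, p.2)) + A (L (p.1, 0)) := by
      rw [← map_add, ← map_add]; simp
    rw [h2, hAL]
  have hst : HasStrictFDerivAt Θ (e : T × E →L[ℝ] T × E) (τ0, s1) :=
    hΘc.contDiffAt.hasStrictFDerivAt' hΘd (by norm_num)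
  have hleft := hst.eventually_left_inverse
  have hsm := hΘc.contDiffAt.to_localInverse hΘd (by norm_num)
  set G := hΘc.contDiffAt.localInverse hΘd (by norm_num) with hG
  set π : Z × T → E := fun y => (G (y.2, A (y.1, 1))).2 with hπ
  have hπc : ContDiffAt ℝ 2 π (k (s1, τ0), τ0) := by
    have h0 : (fun y : Z × T => (y.2, A (y.1, 1))) (k (s1, τ0), τ0) = Θ (τ0, s1) := by
      simp [hΘ, hΦ, hh1 s1 hs1]
    have h1 : ContDiffAt ℝ 2 (fun y : Z × T => (y.2, A (y.1, 1))) (k (s1, τ0), τ0) :=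
      (contDiff_snd.prodMk (A.contDiff.comp (contDiff_fst.prodMk contDiff_const))).contDiffAt
    rw [← h0] at hsm
    exact contDiffAt_snd.comp _ (ContDiffAt.comp (k (s1, τ0), τ0) hsm h1)
  obtain ⟨U, hU, hUc⟩ := hπc.contDiffOn (m := 2) le_rfl (by norm_num)
  have hev : ∀ᶠ y in 𝓝 (k (s1, τ0), τ0), ∀ s ∈ S, s ∈ S → y.1 = k (s, y.2) → π y = s := by
    refine hS.eventually_forall_of_forall_eventually fun s hs => ?_
    by_cases hss : s = s1
    · subst hss
      have ht : Tendsto (fun p : (Z × T) × E => (p.1.2, p.2)) (𝓝 ((k (s, τ0), τ0), s)) (𝓝 (τ0, s)) :=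
        Continuous.tendsto (by fun_prop : Continuous fun p : (Z × T) × E => (p.1.2, p.2)) _
      filter_upwards [ht.eventually hleft] with p hp hpS hpe
      have h1 : G (p.1.2, A (k (p.2, p.1.2), h p.2)) = (p.1.2, p.2) := hp
      rw [hh1 _ hpS, ← hpe] at h1
      simp only [hπ]
      rw [h1]
    · have : Continuous fun p : (Z × T) × E => k (p.2, p.1.2) := by
        have := hk.continuous
        fun_prop
      have h1 : (k (s1, τ0), τ0).1 ≠ k (s, τ0) := fun h => hss (hinj hs hs1 h.symm)
      have h2 : Continuous fun p : (Z × T) × E => p.1.1 := by fun_prop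
      filter_upwards [(isOpen_ne_fun h2 this).mem_nhds h1] with p hp _ hpe
      exact (hp hpe).elim
  exact ⟨_, Filter.inter_mem hU hev, π, hUc.mono inter_subset_left, fun w hw s hs => hw.2 s hs hs⟩

/-- A compact family of embedded parametrised sets admits a `C²` left inverse. -/
theorem exists_param_left_inverse {k : E × T → Z} {S : Set E} (hS : IsCompact S)
    (hk : ContDiff ℝ 2 k) {h : E → ℝ} (hh : ContDiff ℝ 2 h) (hh1 : ∀ s ∈ S, h s = 1) {τ0 : T}
    (hinj : InjOn (fun s => k (s, τ0)) S)
    (himm : ∀ s ∈ S, ∀ w, fderiv ℝ k (s, τ0) (w, 0) = 0 → fderiv ℝ h s w = 0 → w = 0) :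
    ∃ π : Z × T → E, ContDiff ℝ 2 π ∧ ∀ᶠ τ in 𝓝 τ0, ∀ s ∈ S, π (k (s, τ), τ) = s := by
  have h0 : ∀ z, HasLocalSection k S (z, τ0) := by
    intro z
    by_cases hz : ∃ s ∈ S, z = k (s, τ0)
    · obtain ⟨s, hs, rfl⟩ := hz
      exact hasLocalSection_image hS hk hh hh1 hinj himm hs
    · push Not at hz
      exact HasLocalSection.of_not_mem hS hk.continuous hz
  set D1 : Set T := closedBall τ0 1
  set K1 : Set Z := k '' (S ×ˢ D1) with hK1
  have hK1c : IsCompact K1 := (hS.prod (isCompact_closedBall _ _)).image hk.continuous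
  have hV : ∀ᶠ τ in 𝓝 τ0, ∀ z ∈ K1, HasLocalSection k S (z, τ) := by
    refine hK1c.eventually_forall_of_forall_eventually fun z _ => ?_
    exact (continuous_swap.tendsto (τ0, z)).eventually
      ((isOpen_hasLocalSection k S).mem_nhds (h0 z))
  obtain ⟨ρ, hρ, hρV⟩ := Metric.eventually_nhds_iff.1 hV
  set D : Set T := closedBall τ0 (min (ρ / 2) 1)
  have hDV : ∀ τ ∈ D, ∀ z ∈ K1, HasLocalSection k S (z, τ) := fun τ hτ =>
    hρV (((mem_closedBall.1 hτ).trans (min_le_left _ _)).trans_lt (by linarith))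
  have hD1 : D ⊆ D1 := closedBall_subset_closedBall (min_le_right _ _)
  set t : Z × T → Set E := fun y => {v | y.2 ∈ D → ∀ s ∈ S, y.1 = k (s, y.2) → v = s} with ht
  have htc : ∀ y, Convex ℝ (t y) := by
    intro y v hv v' hv' a b _ _ hab hy s hs he
    rw [hv hy s hs he, hv' hy s hs he, ← add_smul, hab, one_smul]
  obtain ⟨g, hg⟩ := exists_contMDiffMap_forall_mem_convex_of_local (n := 2)
    (modelWithCornersSelf ℝ (Z × T)) htc (fun y => by
      have key : HasLocalSection k S y → ∃ U ∈ 𝓝 y, ∃ g : Z × T → E, ContMDiffOn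
          (modelWithCornersSelf ℝ (Z × T)) (modelWithCornersSelf ℝ E) 2 g U ∧ ∀ w ∈ U, g w ∈ t w := by
        rintro ⟨U, hU, g, hg, hgs⟩
        exact ⟨U, hU, g, hg.contMDiffOn, fun w hw _ s hs he => hgs w hw s hs he⟩
      by_cases hyD : y.2 ∈ D
      · by_cases hyK : y.1 ∈ K1
        · exact key (hDV y.2 hyD y.1 hyK)
        · refine key (HasLocalSection.of_not_mem hS hk.continuous fun s hs he => hyK ?_)
          exact ⟨(s, y.2), ⟨hs, hD1 hyD⟩, he.symm⟩
      · refine ⟨{w | w.2 ∉ D}, ?_, fun _ => 0, contMDiffOn_const, fun w hw h => (hw h).elim⟩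
        exact (isClosed_closedBall.isOpen_compl.preimage continuous_snd).mem_nhds hyD)
  refine ⟨g, g.contMDiff.contDiff, ?_⟩
  filter_upwards [closedBall_mem_nhds τ0 (show 0 < min (ρ / 2) 1 by positivity)] with τ hτ s hs
  exact hg (k (s, τ), τ) hτ s hs rfl

end LeftInverse

section Cone
open Filter Topology
variable {E : Type*} [NormedAddCommGroup E] [InnerProductSpace ℝ E] [FiniteDimensional ℝ E]

/-- A smooth map agreeing with the radial projection to the unit sphere away from the origin. -/
def radProj (v : E) : E :=
  (1 - (⟨1 / 4, 1 / 2, by norm_num, by norm_num⟩ : ContDiffBump (0 : E)) v) • ‖v‖⁻¹ • v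

theorem radProj_eq {v : E} (hv : 1 / 2 ≤ ‖v‖) : radProj v = ‖v‖⁻¹ • v := by
  rw [radProj, ContDiffBump.zero_of_le_dist _ (by simpa using hv), sub_zero, one_smul]

theorem radProj_contDiff : ContDiff ℝ (⊤ : ℕ∞) (radProj : E → E) := by
  rw [contDiff_iff_contDiffAt]
  intro v
  by_cases hv : v = 0
  · subst hv
    have : (radProj : E → E) =ᶠ[𝓝 0] fun _ => 0 := by
      filter_upwards [ball_mem_nhds (0:E) (show (0:ℝ) < 1 / 4 by norm_num)] with v hv
      rw [radProj, ContDiffBump.one_of_mem_closedBall _ (ball_subset_closedBall hv), sub_self,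
        zero_smul]
    exact contDiffAt_const.congr_of_eventuallyEq this
  · refine ContDiffAt.smul (contDiffAt_const.sub (ContDiffBump.contDiff _).contDiffAt) ?_
    exact ((contDiffAt_norm ℝ hv).inv (norm_ne_zero_iff.2 hv)).smul contDiffAt_id

theorem norm_radProj {v : E} (hv : 1 / 2 ≤ ‖v‖) : ‖radProj v‖ = 1 := by
  have : ‖v‖ ≠ 0 := by linarith
  rw [radProj_eq hv, norm_smul, norm_inv, norm_norm, inv_mul_cancel₀ this]

theorem radProj_of_mem {s : E} (hs : ‖s‖ = 1) : radProj s = s := by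
  rw [radProj_eq (by rw [hs]; norm_num), hs, inv_one, one_smul]

/-- Derivatives of the radial projection are tangent to the sphere. -/
theorem inner_fderiv_radProj {s : E} (hs : ‖s‖ = 1) (w : E) :
    ⟪fderiv ℝ radProj s w, s⟫ = 0 := by
  have hd : HasFDerivAt (radProj : E → E) (fderiv ℝ radProj s) s :=
    (radProj_contDiff.differentiable (by simp) s).hasFDerivAt
  have h1 := hd.inner ℝ hd
  have h2 : (fun v : E => ⟪radProj v, radProj v⟫) =ᶠ[𝓝 s] fun _ => (1:ℝ) := by
    have : ∀ᶠ v : E in 𝓝 s, 1 / 2 < ‖v‖ :=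
      continuous_norm.continuousAt.eventually_const_lt (by simp only [hs]; norm_num)
    filter_upwards [this] with v hv
    rw [real_inner_self_eq_norm_sq, norm_radProj hv.le, one_pow]
  have h3 := (h1.congr_of_eventuallyEq h2.symm).unique (hasFDerivAt_const (1:ℝ) s)
  have h4 := congrArg (fun L : E →L[ℝ] ℝ => L w) h3
  simp only [ContinuousLinearMap.comp_apply, ContinuousLinearMap.prod_apply,
    fderivInnerCLM_apply, zero_apply, radProj_of_mem hs] at h4
  rw [real_inner_comm] at h4
  linarith

/-- The radial cutoff used in the homogeneous lift. -/
def coneCut (N : ℕ) (P : E) : ℝ :=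
  (⟨2 ^ (N + 1), 2 ^ (N + 2), by positivity, by gcongr <;> norm_num⟩ : ContDiffBump (0 : E)) P *
    (1 - (⟨((2:ℝ) ^ (N + 2))⁻¹, ((2:ℝ) ^ (N + 1))⁻¹, by positivity, by gcongr <;> norm_num⟩ :
      ContDiffBump (0 : E)) P)

theorem coneCut_contDiff (N : ℕ) : ContDiff ℝ (⊤ : ℕ∞) (coneCut N : E → ℝ) :=
  (ContDiffBump.contDiff _).mul (contDiff_const.sub (ContDiffBump.contDiff _))

theorem coneCut_mem (N : ℕ) (P : E) : coneCut N P ∈ Icc (0:ℝ) 1 := by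
  refine ⟨mul_nonneg (ContDiffBump.nonneg _) (sub_nonneg.2 (ContDiffBump.le_one _)),
    mul_le_one₀ (ContDiffBump.le_one _) (sub_nonneg.2 (ContDiffBump.le_one _)) ?_⟩
  linarith [ContDiffBump.nonneg (⟨((2:ℝ) ^ (N + 2))⁻¹, ((2:ℝ) ^ (N + 1))⁻¹, by positivity,
    by gcongr <;> norm_num⟩ : ContDiffBump (0 : E)) (x := P)]

theorem coneCut_eq_one {N : ℕ} {P : E} (h1 : ((2:ℝ) ^ (N + 1))⁻¹ ≤ ‖P‖) (h2 : ‖P‖ ≤ 2 ^ (N + 1)) :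
    coneCut N P = 1 := by
  rw [coneCut, ContDiffBump.one_of_mem_closedBall _ (by simpa using h2),
    ContDiffBump.zero_of_le_dist _ (by simpa using h1)]
  norm_num

theorem coneCut_eq_zero_of_le {N : ℕ} {P : E} (h : ‖P‖ ≤ ((2:ℝ) ^ (N + 2))⁻¹) :
    coneCut N P = 0 := by
  rw [coneCut, mul_eq_zero]
  right
  rw [ContDiffBump.one_of_mem_closedBall _ (by simpa using h), sub_self]

theorem coneCut_eq_zero_of_ge {N : ℕ} {P : E} (h : 2 ^ (N + 2) ≤ ‖P‖) :
    coneCut N P = 0 := by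
  rw [coneCut, ContDiffBump.zero_of_le_dist _ (by simpa using h), zero_mul]

/-- The direction of `P`, smoothly modified near the origin. -/
def coneDir (N : ℕ) (P : E) : E := radProj ((2:ℝ) ^ (N + 2) • P)

theorem coneDir_contDiff (N : ℕ) : ContDiff ℝ (⊤ : ℕ∞) (coneDir N : E → E) :=
  radProj_contDiff.comp (contDiff_const.smul contDiff_id)

theorem coneDir_eq {N : ℕ} {P : E} (h : ((2:ℝ) ^ (N + 2))⁻¹ ≤ ‖P‖) : coneDir N P = ‖P‖⁻¹ • P := by
  have hc : (0:ℝ) < 2 ^ (N + 2) := by positivity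
  have hn : ‖(2:ℝ) ^ (N + 2) • P‖ = 2 ^ (N + 2) * ‖P‖ := by
    rw [norm_smul, Real.norm_of_nonneg hc.le]
  have h1 : 1 ≤ (2:ℝ) ^ (N + 2) * ‖P‖ := by
    have := mul_le_mul_of_nonneg_left h hc.le
    rwa [mul_inv_cancel₀ hc.ne'] at this
  rw [coneDir, radProj_eq (by rw [hn]; linarith), hn, smul_smul, mul_inv]
  congr 1
  field_simp

/-- The radial factor of the homogeneous lift. -/
def coneRad (N : ℕ) (P : E) : ℝ := coneCut N P * ⟪coneDir N P, P⟫

theorem coneRad_eq (N : ℕ) (P : E) : coneRad N P = coneCut N P * ‖P‖ := by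
  rcases le_or_gt ‖P‖ ((2:ℝ) ^ (N + 2))⁻¹ with h | h
  · rw [coneRad, coneCut_eq_zero_of_le h, zero_mul, zero_mul]
  · have : 0 < ‖P‖ := lt_trans (by positivity) h
    rw [coneRad, coneDir_eq h.le, inner_smul_left, real_inner_self_eq_norm_sq]
    simp only [conj_trivial]
    field_simp

theorem coneRad_nonneg (N : ℕ) (P : E) : 0 ≤ coneRad N P := by
  rw [coneRad_eq]; exact mul_nonneg (coneCut_mem N P).1 (norm_nonneg _)

theorem coneRad_le (N : ℕ) (P : E) : coneRad N P ≤ ‖P‖ := by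
  rw [coneRad_eq]; exact mul_le_of_le_one_left (norm_nonneg _) (coneCut_mem N P).2

theorem coneRad_le_pow (N : ℕ) (P : E) : coneRad N P ≤ 2 ^ (N + 2) := by
  rcases le_or_gt (2 ^ (N + 2)) ‖P‖ with h | h
  · rw [coneRad_eq, coneCut_eq_zero_of_ge h, zero_mul]; positivity
  · exact (coneRad_le N P).trans h.le

theorem coneRad_contDiff (N : ℕ) : ContDiff ℝ (⊤ : ℕ∞) (coneRad N : E → ℝ) :=
  (coneCut_contDiff N).mul ((coneDir_contDiff N).inner ℝ contDiff_id)

/-- The cut-off homogeneous lift of a function `U` near the sphere bundle. -/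
def coneLift (N : ℕ) (U : E × E → ℝ) (z : E × E) : ℝ :=
  coneRad N z.2 * U (z.1, coneDir N z.2)

theorem coneLift_contDiff (N : ℕ) {U : E × E → ℝ} (hU : ContDiff ℝ 2 U) :
    ContDiff ℝ 2 (coneLift N U) :=
  (((coneRad_contDiff N).of_le (by norm_cast)).comp contDiff_snd).mul
    (hU.comp (contDiff_fst.prodMk
      (((coneDir_contDiff N).of_le (by norm_cast)).comp contDiff_snd)))

theorem coneLift_hasCompactSupport (N : ℕ) {U : E × E → ℝ} {R : ℝ}
    (hU : ∀ z, R < ‖z‖ → U z = 0) : HasCompactSupport (coneLift N U) := by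
  refine HasCompactSupport.intro
    ((isCompact_closedBall (0:E) R).prod (isCompact_closedBall (0:E) (2 ^ (N + 2)))) fun z hz => ?_
  rw [mem_prod, not_and_or, mem_closedBall_zero_iff, mem_closedBall_zero_iff, not_le, not_le] at hz
  rcases hz with hz | hz
  · rw [coneLift, hU (z.1, coneDir N z.2) (hz.trans_le (le_max_left _ _)), mul_zero]
  · rw [coneLift, coneRad_eq, coneCut_eq_zero_of_ge hz.le, zero_mul, zero_mul]

theorem gradX_coneLift (N : ℕ) {U : E × E → ℝ} (hU : ContDiff ℝ 2 U) (z : E × E) :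
    gradX (coneLift N U) z = coneRad N z.2 • gradX U (z.1, coneDir N z.2) := by
  refine ext_inner_right ℝ fun v => ?_
  rw [inner_smul_left, inner_gradX, inner_gradX]
  simp only [conj_trivial]
  have h1 : HasFDerivAt (coneLift N U) (fderiv ℝ (coneLift N U) z) z :=
    ((coneLift_contDiff N hU).differentiable (by norm_num) z).hasFDerivAt
  have h2 : HasFDerivAt (fun x : E => (x, z.2)) (ContinuousLinearMap.inl ℝ E E) z.1 :=
    hasFDerivAt_prodMk_left z.1 z.2
  have h3 := HasFDerivAt.comp z.1 (g := coneLift N U) (f := fun x : E => (x, z.2)) h1 h2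
  have h4 : HasFDerivAt U (fderiv ℝ U (z.1, coneDir N z.2)) (z.1, coneDir N z.2) :=
    (hU.differentiable (by norm_num) _).hasFDerivAt
  have h5 := (HasFDerivAt.comp z.1 (g := U) (f := fun x : E => (x, coneDir N z.2)) h4
    (hasFDerivAt_prodMk_left z.1 _)).const_mul (coneRad N z.2)
  have := congrArg (fun L : E →L[ℝ] ℝ => L v) (h3.unique h5)
  simpa using this

theorem hasFDerivAt_norm_of_ne {P : E} (hP : P ≠ 0) :
    HasFDerivAt (fun v : E => ‖v‖) (‖P‖⁻¹ • innerSL ℝ P) P := by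
  have h1 := (hasStrictFDerivAt_norm_sq P).hasFDerivAt.sqrt (by simpa using hP)
  simp only [Real.sqrt_sq (norm_nonneg _)] at h1
  refine h1.congr_fderiv ?_
  ext v
  simp
  field_simp

theorem gradP_coneLift {N : ℕ} {U : E × E → ℝ} (hU : ContDiff ℝ 2 U) {x P : E}
    (h1 : ((2:ℝ) ^ (N + 1))⁻¹ < ‖P‖) (h2 : ‖P‖ < 2 ^ (N + 1)) :
    gradP (coneLift N U) (x, P) = U (x, ‖P‖⁻¹ • P) • ‖P‖⁻¹ • P + gradP U (x, ‖P‖⁻¹ • P) -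
      ⟪gradP U (x, ‖P‖⁻¹ • P), ‖P‖⁻¹ • P⟫ • ‖P‖⁻¹ • P := by
  have hP0 : 0 < ‖P‖ := lt_trans (by positivity) h1
  have hP : P ≠ 0 := norm_pos_iff.1 hP0
  refine ext_inner_right ℝ fun v => ?_
  rw [inner_gradP]
  have e1 : HasFDerivAt (coneLift N U) (fderiv ℝ (coneLift N U) (x, P)) (x, P) :=
    ((coneLift_contDiff N hU).differentiable (by norm_num) _).hasFDerivAt
  have e3 := HasFDerivAt.comp P (g := coneLift N U) (f := fun p : E => (x, p)) e1
    (hasFDerivAt_prodMk_right x P)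
  have e4 : HasFDerivAt U (fderiv ℝ U (x, ‖P‖⁻¹ • P)) (x, ‖P‖⁻¹ • P) :=
    (hU.differentiable (by norm_num) _).hasFDerivAt
  have n1 := hasFDerivAt_norm_of_ne hP
  have n2 : HasFDerivAt (fun v : E => ‖v‖⁻¹) (-(‖P‖ ^ 2)⁻¹ • (‖P‖⁻¹ • innerSL ℝ P)) P :=
    (hasDerivAt_inv hP0.ne').comp_hasFDerivAt P n1
  have n3 := n2.smul (hasFDerivAt_id P)
  have e5 := n1.mul (HasFDerivAt.comp P (g := U) (f := fun p : E => (x, ‖p‖⁻¹ • p)) e4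
    ((hasFDerivAt_const x P).prodMk n3))
  have heq : (coneLift N U) ∘ (fun p : E => (x, p)) =ᶠ[𝓝 P] fun p => ‖p‖ * U (x, ‖p‖⁻¹ • p) := by
    filter_upwards [continuous_norm.continuousAt.eventually_const_lt h1,
      continuous_norm.continuousAt.eventually_lt_const h2] with p hp1 hp2
    have : ((2:ℝ) ^ (N + 2))⁻¹ ≤ ((2:ℝ) ^ (N + 1))⁻¹ := by gcongr <;> norm_num
    simp only [Function.comp, coneLift]
    rw [coneRad_eq, coneCut_eq_one hp1.le hp2.le, one_mul, coneDir_eq (this.trans hp1.le)]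
  have := congrArg (fun L : E →L[ℝ] ℝ => L v) (e3.unique (e5.congr_of_eventuallyEq heq))
  simp at this
  rw [this]
  rw [← inner_gradP]
  set g := gradP U (x, ‖P‖⁻¹ • P)
  simp only [inner_add_left, inner_sub_left, inner_smul_left, inner_add_right, inner_neg_right,
    inner_smul_right, conj_trivial]
  field_simp
  ring

end Cone

section Track
open Filter Topology
variable {E : Type*} [NormedAddCommGroup E] [InnerProductSpace ℝ E] [FiniteDimensional ℝ E]

theorem norm_gradX_le (W : E × E → ℝ) (z : E × E) : ‖gradX W z‖ ≤ ‖fderiv ℝ W z‖ := by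
  rw [gradX, LinearIsometryEquiv.norm_map]
  refine ContinuousLinearMap.opNorm_le_bound _ (by positivity) fun v => ?_
  simpa using (fderiv ℝ W z).le_opNorm (v, 0)

theorem norm_gradX_sub_le (W : E × E → ℝ) (z z' : E × E) :
    ‖gradX W z - gradX W z'‖ ≤ ‖fderiv ℝ W z - fderiv ℝ W z'‖ := by
  rw [gradX, gradX, ← map_sub, LinearIsometryEquiv.norm_map]
  refine ContinuousLinearMap.opNorm_le_bound _ (by positivity) fun v => ?_
  simpa using (fderiv ℝ W z - fderiv ℝ W z').le_opNorm (v, 0)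

/-- The homogeneous lift of a `C²`-small function carries `A` to `A'` once its derivatives have
the right values at the mixed points. -/
theorem coneLift_stepTracks (N : ℕ) {U : E × E → ℝ} (hU : ContDiff ℝ 2 U)
    (hb : ∀ z, ‖gradX U z‖ ≤ 1 / 8)
    (hl : ∀ x θ θ', ‖gradX U (x, θ) - gradX U (x, θ')‖ ≤ 1 / 8 * ‖θ - θ'‖) {A A' : Set (E × E)}
    (hA : ∀ x q, (x, q) ∈ A → ∃ x' q', (x', q') ∈ A' ∧ ‖q'‖ = 1 ∧
      U (x, q') = ⟪x' - x, q'⟫ ∧ gradX U (x, q') = q - q' ∧ gradP U (x, q') = x' - x) :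
    StepTracks (2 ^ N) (coneLift N U) A A' := by
  intro x Q P hQ hxA hQP hP1 hP2
  obtain ⟨x', q', hA', hq', hUv, hUx, hUp⟩ := hA _ _ hxA
  have hM : (0:ℝ) < 2 ^ N := by positivity
  have hMi : (0:ℝ) < (2 ^ N)⁻¹ := by positivity
  have e1 : (2:ℝ) ^ (N + 1) = 2 * 2 ^ N := by ring
  have e2 : ((2:ℝ) ^ (N + 1))⁻¹ = (2 ^ N)⁻¹ / 2 := by rw [e1, mul_inv]; ring
  have e3 : ((2:ℝ) ^ (N + 2))⁻¹ = (2 ^ N)⁻¹ / 4 := by rw [pow_add, mul_inv]; norm_num; ring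
  have hg : ∀ p : E, ((2:ℝ) ^ (N + 1))⁻¹ ≤ ‖p‖ → ‖p‖ ≤ 2 ^ (N + 1) →
      gradX (coneLift N U) (x, p) = ‖p‖ • gradX U (x, ‖p‖⁻¹ • p) := by
    intro p h1 h2
    rw [gradX_coneLift N hU, coneRad_eq, coneCut_eq_one h1 h2, one_mul, coneDir_eq (by linarith)]
  have hgP := hg P (by linarith) (by linarith)
  have hP0 : 0 < ‖P‖ := hMi.trans_le hP1
  have hQ0 : 0 < ‖Q‖ := norm_pos_iff.2 hQ
  set μ := ‖Q‖ with hμ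
  set p := ‖P‖⁻¹ • P with hp
  have hPp : P = ‖P‖ • p := by rw [hp, smul_smul, mul_inv_cancel₀ hP0.ne', one_smul]
  have hQP' : Q = μ • q' + μ • gradX U (x, q') := by
    rw [hUx, ← smul_add, add_sub_cancel, smul_smul, mul_inv_cancel₀ hQ0.ne', one_smul]
  rw [hgP] at hQP
  have hdiff : P - μ • q' = (μ - ‖P‖) • gradX U (x, p) +
      μ • (gradX U (x, q') - gradX U (x, p)) := by
    have : P + ‖P‖ • gradX U (x, p) = μ • q' + μ • gradX U (x, q') := hQP.symm.trans hQP'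
    refine (congrArg (· - μ • q') (eq_sub_of_add_eq this)).trans ?_
    generalize ‖P‖ = r
    module
  have hnμ : ‖μ • q'‖ = μ := by rw [norm_smul, hq', mul_one, Real.norm_of_nonneg hQ0.le]
  have habs : |μ - ‖P‖| ≤ ‖P - μ • q'‖ := by
    have := abs_norm_sub_norm_le P (μ • q')
    rwa [hnμ, abs_sub_comm] at this
  have hpn : ‖p‖ = 1 := by rw [hp, norm_smul, norm_inv, norm_norm, inv_mul_cancel₀ hP0.ne']
  have hdir : μ * ‖q' - p‖ ≤ 2 * ‖P - μ • q'‖ := by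
    have h1 : μ • (q' - p) = -(P - μ • q') + (‖P‖ - μ) • p := by
      nth_rewrite 1 [hPp]
      module
    have h2 : ‖μ • (q' - p)‖ ≤ ‖P - μ • q'‖ + |μ - ‖P‖| := by
      rw [h1]
      refine (norm_add_le _ _).trans ?_
      rw [norm_neg, norm_smul, hpn, mul_one, Real.norm_eq_abs, abs_sub_comm]
    rw [norm_smul, Real.norm_of_nonneg hQ0.le] at h2
    linarith
  have hzero : P = μ • q' := by
    have h1 : ‖P - μ • q'‖ ≤ |μ - ‖P‖| * (1 / 8) + μ * (1 / 8 * ‖q' - p‖) := by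
      nth_rewrite 1 [hdiff]
      refine (norm_add_le _ _).trans ?_
      rw [norm_smul, norm_smul, Real.norm_eq_abs, Real.norm_of_nonneg hQ0.le]
      gcongr
      · exact hb _
      · exact hl _ _ _
    have h2 := norm_nonneg (P - μ • q')
    have h3 : ‖P - μ • q'‖ = 0 := by linarith
    exact sub_eq_zero.1 (norm_eq_zero.1 h3)
  have hPμ : ‖P‖ = μ := by rw [hzero, hnμ]
  have hpq : p = q' := by
    rw [hp, hPμ, hzero, smul_smul, inv_mul_cancel₀ hQ0.ne', one_smul]
  have hgp : gradP (coneLift N U) (x, P) = x' - x := by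
    rw [gradP_coneLift hU (by linarith) (by linarith), ← hp, hpq, hUv, hUp]
    abel
  refine ⟨by rw [hgp, hpq, add_sub_cancel]; exact hA', ?_⟩
  rw [hgp, coneLift]
  simp only
  rw [coneRad_eq, coneCut_eq_one (by linarith) (by linarith), one_mul, coneDir_eq (by linarith),
    ← hp, hpq, hUv, hzero, inner_smul_right, hnμ]

theorem coneLift_isAdmStep (N : ℕ) {U : E × E → ℝ} (hU : ContDiff ℝ 2 U)
    (hb : ∀ z, ‖gradX U z‖ ≤ 1 / 8) {R : ℝ} (hR : ∀ z, R < ‖z‖ → U z = 0) :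
    IsAdmStep (coneLift N U) := by
  refine ⟨coneLift_contDiff N hU, coneLift_hasCompactSupport N hR, fun z => ?_⟩
  rw [gradX_coneLift N hU, norm_smul, Real.norm_of_nonneg (coneRad_nonneg N _)]
  have h1 := coneRad_le N z.2
  have h2 := hb (z.1, coneDir N z.2)
  have h3 := coneRad_nonneg N z.2
  have h4 := norm_nonneg (gradX U (z.1, coneDir N z.2))
  nlinarith

end Track

section Small
open Filter Topology
variable {Z T : Type*} [NormedAddCommGroup Z] [NormedSpace ℝ Z]
  [NormedAddCommGroup T] [NormedSpace ℝ T]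

/-- A `C²` family of functions supported in a fixed compact set is `C²`-small near a parameter
at which it vanishes. -/
theorem eventually_fderiv_small {U : Z × T → ℝ} (hU : ContDiff ℝ 2 U) {K : Set Z}
    (hK : IsCompact K) (hUK : ∀ z τ, z ∉ K → U (z, τ) = 0) {τ0 : T} (h0 : ∀ z, U (z, τ0) = 0)
    {ε : ℝ} (hε : 0 < ε) : ∀ᶠ τ in 𝓝 τ0, (∀ z, ‖fderiv ℝ (fun z => U (z, τ)) z‖ ≤ ε) ∧
      ∀ z z', ‖fderiv ℝ (fun z => U (z, τ)) z - fderiv ℝ (fun z => U (z, τ)) z'‖ ≤ ε * ‖z - z'‖ := by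
  set G : Z × T → (Z →L[ℝ] ℝ) := fun y => (fderiv ℝ U y).comp (.inl ℝ Z T) with hG
  have hGc : ContDiff ℝ 1 G :=
    (hU.fderiv_right (m := 1) (by norm_num)).clm_comp contDiff_const
  have hGd : ∀ z τ, HasFDerivAt (fun z => U (z, τ)) (G (z, τ)) z := fun z τ =>
    HasFDerivAt.comp z (g := U) (f := fun z => (z, τ))
      (hU.differentiable (by norm_num) _).hasFDerivAt (hasFDerivAt_prodMk_left z τ)
  set H : Z × T → (Z →L[ℝ] Z →L[ℝ] ℝ) := fun y => (fderiv ℝ G y).comp (.inl ℝ Z T) with hH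
  have hHc : Continuous H :=
    (hGc.continuous_fderiv (by norm_num)).clm_comp continuous_const
  have hHd : ∀ z τ, HasFDerivAt (fun z => G (z, τ)) (H (z, τ)) z := fun z τ =>
    HasFDerivAt.comp z (g := G) (f := fun z => (z, τ))
      (hGc.differentiable (by norm_num) _).hasFDerivAt (hasFDerivAt_prodMk_left z τ)
  have hG0 : ∀ z, G (z, τ0) = 0 := fun z =>
    (hGd z τ0).unique ((hasFDerivAt_const (0:ℝ) z).congr_of_eventuallyEq
      (Eventually.of_forall fun z => h0 z))
  have hH0 : ∀ z, H (z, τ0) = 0 := fun z =>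
    (hHd z τ0).unique ((hasFDerivAt_const (0 : Z →L[ℝ] ℝ) z).congr_of_eventuallyEq
      (Eventually.of_forall fun z => hG0 z))
  have hGK : ∀ z τ, z ∉ K → G (z, τ) = 0 := fun z τ hz =>
    (hGd z τ).unique ((hasFDerivAt_const (0:ℝ) z).congr_of_eventuallyEq
      (by filter_upwards [hK.isClosed.isOpen_compl.mem_nhds hz] with z hz using hUK z τ hz))
  have hHK : ∀ z τ, z ∉ K → H (z, τ) = 0 := fun z τ hz =>
    (hHd z τ).unique ((hasFDerivAt_const (0 : Z →L[ℝ] ℝ) z).congr_of_eventuallyEq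
      (by filter_upwards [hK.isClosed.isOpen_compl.mem_nhds hz] with z hz using hGK z τ hz))
  have hsm : ∀ᶠ τ in 𝓝 τ0, ∀ z ∈ K, ‖G (z, τ)‖ < ε ∧ ‖H (z, τ)‖ < ε := by
    refine hK.eventually_forall_of_forall_eventually fun z _ => ?_
    have c1 : Continuous fun p : T × Z => ‖G (p.2, p.1)‖ :=
      (hGc.continuous.comp continuous_swap).norm
    have c2 : Continuous fun p : T × Z => ‖H (p.2, p.1)‖ := by
      have h : Continuous fun p : T × Z => H (p.2, p.1) := hHc.comp continuous_swap
      exact (continuous_norm (E := Z →L[ℝ] Z →L[ℝ] ℝ)).comp h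
    exact (c1.continuousAt.eventually_lt_const (by simp only [hG0, norm_zero]; exact hε)).and
      (c2.continuousAt.eventually_lt_const (by
        simp only [hH0]; exact (norm_zero (E := Z →L[ℝ] Z →L[ℝ] ℝ)).trans_lt hε))
  filter_upwards [hsm] with τ hτ
  have hfd : ∀ z, fderiv ℝ (fun z => U (z, τ)) z = G (z, τ) := fun z => (hGd z τ).fderiv
  simp only [hfd]
  refine ⟨fun z => ?_, fun z z' => ?_⟩
  · by_cases hz : z ∈ K
    · exact (hτ z hz).1.le
    · rw [hGK z τ hz, norm_zero]; exact hε.le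
  · refine convex_univ.norm_image_sub_le_of_norm_hasFDerivWithin_le (f := fun z => G (z, τ))
      (f' := fun z => H (z, τ)) (fun z _ => (hHd z τ).hasFDerivWithinAt) (fun z _ => ?_)
      (mem_univ _) (mem_univ _)
    by_cases hz : z ∈ K
    · exact (hτ z hz).2.le
    · rw [hHK z τ hz, norm_zero]; exact hε.le

end Small

section StepGen
open Filter Topology
variable {E : Type*} [NormedAddCommGroup E] [InnerProductSpace ℝ E] [FiniteDimensional ℝ E]

/-- The mixed generating function of the passage from time `a` to time `t` along the moving front
`X` with conormals `Q`, where `π` recovers the parameter; the argument is `((x, q), (a, t))`. -/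
def stepGen (X Q : E × ℝ → E) (π : (E × E) × (ℝ × ℝ) → E) (y : (E × E) × (ℝ × ℝ)) : ℝ :=
  ⟪X (π y, y.2.2) - X (π y, y.2.1), y.1.2⟫ +
    ⟪Q (π y, y.2.1) - Q (π y, y.2.2), y.1.1 - X (π y, y.2.1)⟫

theorem stepGen_contDiff {X Q : E × ℝ → E} {π : (E × E) × (ℝ × ℝ) → E} (hX : ContDiff ℝ 2 X)
    (hQ : ContDiff ℝ 2 Q) (hπ : ContDiff ℝ 2 π) : ContDiff ℝ 2 (stepGen X Q π) := by
  have ha : ContDiff ℝ 2 fun y : (E × E) × (ℝ × ℝ) => (π y, y.2.1) :=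
    hπ.prodMk (contDiff_fst.comp contDiff_snd)
  have ht : ContDiff ℝ 2 fun y : (E × E) × (ℝ × ℝ) => (π y, y.2.2) :=
    hπ.prodMk (contDiff_snd.comp contDiff_snd)
  exact (((hX.comp ht).sub (hX.comp ha)).inner ℝ (contDiff_snd.comp contDiff_fst)).add
    (((hQ.comp ha).sub (hQ.comp ht)).inner ℝ ((contDiff_fst.comp contDiff_fst).sub (hX.comp ha)))

theorem stepGen_self (X Q : E × ℝ → E) (π : (E × E) × (ℝ × ℝ) → E) (z : E × E) (a : ℝ) :
    stepGen X Q π (z, (a, a)) = 0 := by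
  simp [stepGen]

theorem stepGen_apply {X Q : E × ℝ → E} {π : (E × E) × (ℝ × ℝ) → E} {s : E} {a t : ℝ}
    (hs : π ((X (s, a), Q (s, t)), (a, t)) = s) :
    stepGen X Q π ((X (s, a), Q (s, t)), (a, t)) = ⟪X (s, t) - X (s, a), Q (s, t)⟫ := by
  simp [stepGen, hs]

theorem stepGen_hasFDerivAt {X Q : E × ℝ → E} {π : (E × E) × (ℝ × ℝ) → E} (hX : ContDiff ℝ 2 X)
    (hQ : ContDiff ℝ 2 Q) (hπ : ContDiff ℝ 2 π) {s : E} {a t : ℝ}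
    (hs : π ((X (s, a), Q (s, t)), (a, t)) = s)
    (ha : ∀ w, ⟪fderiv ℝ (fun v => X (v, a)) s w, Q (s, a)⟫ = 0)
    (ht : ∀ w, ⟪fderiv ℝ (fun v => X (v, t)) s w, Q (s, t)⟫ = 0) (v : E × E) :
    fderiv ℝ (fun z => stepGen X Q π (z, (a, t))) (X (s, a), Q (s, t)) v =
      ⟪Q (s, a) - Q (s, t), v.1⟫ + ⟪X (s, t) - X (s, a), v.2⟫ := by
  set z0 : E × E := (X (s, a), Q (s, t)) with hz0
  have hp : HasFDerivAt (fun z : E × E => π (z, (a, t)))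
      (fderiv ℝ (fun z : E × E => π (z, (a, t))) z0) z0 :=
    ((hπ.comp (contDiff_id.prodMk contDiff_const)).differentiable (by norm_num) z0).hasFDerivAt
  set σ := fderiv ℝ (fun z : E × E => π (z, (a, t))) z0 with hσ
  have hc : ∀ {Y : E × ℝ → E}, ContDiff ℝ 2 Y → ∀ b : ℝ,
      HasFDerivAt (fun z : E × E => Y (π (z, (a, t)), b)) ((fderiv ℝ (fun v => Y (v, b)) s).comp σ)
        z0 := fun {Y} hY b => by
    refine HasFDerivAt.comp z0 (g := fun v => Y (v, b)) (f := fun z : E × E => π (z, (a, t))) ?_ hp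
    rw [hs]
    exact ((hY.comp (contDiff_id.prodMk contDiff_const)).differentiable (by norm_num) s).hasFDerivAt
  have h := (((hc hX t).sub (hc hX a)).inner ℝ (hasFDerivAt_snd (𝕜 := ℝ) (p := z0))).add
    (((hc hQ a).sub (hc hQ t)).inner ℝ ((hasFDerivAt_fst (𝕜 := ℝ) (p := z0)).sub (hc hX a)))
  have h' : HasFDerivAt (fun z => stepGen X Q π (z, (a, t))) _ z0 := h
  rw [h'.fderiv]
  have e1 := ha (σ v)
  have e2 := ht (σ v)
  have e3 : ⟪Q (s, a), fderiv ℝ (fun v => X (v, a)) s (σ v)⟫ = 0 := by rw [real_inner_comm, e1]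
  have e4 := real_inner_comm (fderiv ℝ (fun v => X (v, a)) s (σ v)) (Q (s, t))
  simp only [hz0] at hs ⊢
  simp [hs, inner_sub_left, inner_sub_right, e2, e3, e4]
  ring

/-- Cutting off the generating function near the front. -/
theorem exists_step_family {X Q : E × ℝ → E} {π : (E × E) × (ℝ × ℝ) → E} (hX : ContDiff ℝ 2 X)
    (hQ : ContDiff ℝ 2 Q) (hπ : ContDiff ℝ 2 π) {S : Set E} (hS : IsCompact S) {a0 : ℝ}
    (hπs : ∀ᶠ τ : ℝ × ℝ in 𝓝 (a0, a0), ∀ s ∈ S, π ((X (s, τ.1), Q (s, τ.2)), τ) = s) :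
    ∃ U : (E × E) × (ℝ × ℝ) → ℝ, ContDiff ℝ 2 U ∧ (∀ z a, U (z, (a, a)) = 0) ∧
      (∃ L : Set (E × E), IsCompact L ∧ ∀ z τ, z ∉ L → U (z, τ) = 0) ∧
      (∀ᶠ τ : ℝ × ℝ in 𝓝 (a0, a0), ∀ s ∈ S,
        (∀ w, ⟪fderiv ℝ (fun v => X (v, τ.1)) s w, Q (s, τ.1)⟫ = 0) →
        (∀ w, ⟪fderiv ℝ (fun v => X (v, τ.2)) s w, Q (s, τ.2)⟫ = 0) →
        U ((X (s, τ.1), Q (s, τ.2)), τ) = ⟪X (s, τ.2) - X (s, τ.1), Q (s, τ.2)⟫ ∧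
        gradX (fun z => U (z, τ)) (X (s, τ.1), Q (s, τ.2)) = Q (s, τ.1) - Q (s, τ.2) ∧
        gradP (fun z => U (z, τ)) (X (s, τ.1), Q (s, τ.2)) = X (s, τ.2) - X (s, τ.1)) ∧
      ((∀ s ∈ S, 0 < ⟪deriv (fun t => X (s, t)) a0, Q (s, a0)⟫) →
        ∃ ρ > 0, ∀ a t, |a - a0| < ρ → |t - a0| < ρ → a ≤ t → ∀ z, 0 ≤ U (z, (a, t))) := by
  set B := stepGen X Q π with hB
  have hBc : ContDiff ℝ 2 B := stepGen_contDiff hX hQ hπ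
  set D : (E × E) × (ℝ × ℝ) → ℝ := fun y => fderiv ℝ B y (0, (0, 1)) with hD
  have hDc : Continuous D := (hBc.continuous_fderiv (by norm_num)).clm_apply continuous_const
  have hDd : ∀ z a t, HasDerivAt (fun t => B (z, (a, t))) (D (z, (a, t))) t := fun z a t => by
    have h1 : HasDerivAt (fun t : ℝ => (z, (a, t))) ((0 : E × E), ((0:ℝ), (1:ℝ))) t :=
      (hasDerivAt_const t z).prodMk ((hasDerivAt_const t a).prodMk (hasDerivAt_id t))
    exact (hBc.differentiable (by norm_num) _).hasFDerivAt.comp_hasDerivAt t h1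
  set k : E × (ℝ × ℝ) → E × E := fun p => (X (p.1, p.2.1), Q (p.1, p.2.2)) with hk
  have hkc : Continuous k := by
    have := hX.continuous
    have := hQ.continuous
    fun_prop
  set K0 : Set (E × E) := (fun s => k (s, (a0, a0))) '' S with hK0
  have hK0c : IsCompact K0 := hS.image (by fun_prop)
  obtain ⟨O, hO, hKO, hOpos⟩ : ∃ O : Set (E × E), IsOpen O ∧ K0 ⊆ O ∧
      ((∀ s ∈ S, 0 < ⟪deriv (fun t => X (s, t)) a0, Q (s, a0)⟫) →
        ∀ z ∈ O, 0 < D (z, (a0, a0))) := by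
    by_cases hpos : ∀ s ∈ S, 0 < ⟪deriv (fun t => X (s, t)) a0, Q (s, a0)⟫
    · refine ⟨{z | 0 < D (z, (a0, a0))}, isOpen_lt continuous_const (by fun_prop), ?_,
        fun _ z hz => hz⟩
      rintro _ ⟨s, hs, rfl⟩
      have hsπ := hπs.self_of_nhds s hs
      have hz : π ((X (s, a0), Q (s, a0)), (a0, a0)) = s := hsπ
      have hx : ∀ {Y : E × ℝ → E}, ContDiff ℝ 2 Y →
          ∃ d, HasDerivAt (fun t => Y (π ((X (s, a0), Q (s, a0)), (a0, t)), t) -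
            Y (π ((X (s, a0), Q (s, a0)), (a0, t)), a0)) d a0 ∧ d = deriv (fun t => Y (s, t)) a0 := by
        intro Y hY
        set p : ℝ → E := fun t => π ((X (s, a0), Q (s, a0)), (a0, t)) with hp
        have hpd : HasDerivAt p (deriv p a0) a0 :=
          ((hπ.comp (contDiff_const.prodMk (contDiff_const.prodMk contDiff_id))).differentiable
            (by norm_num) a0).hasDerivAt
        have hp0 : p a0 = s := hz
        have hYd : HasFDerivAt Y (fderiv ℝ Y (s, a0)) (s, a0) :=
          (hY.differentiable (by norm_num) _).hasFDerivAt
        have h1 : HasDerivAt (fun t => Y (p t, t)) (fderiv ℝ Y (s, a0) (deriv p a0, 1)) a0 := by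
          refine HasFDerivAt.comp_hasDerivAt (f := fun t => (p t, t)) a0 ?_
            (hpd.prodMk (hasDerivAt_id a0))
          simpa only [hp0] using hYd
        have h2 : HasDerivAt (fun t => Y (p t, a0)) (fderiv ℝ Y (s, a0) (deriv p a0, 0)) a0 := by
          refine HasFDerivAt.comp_hasDerivAt (f := fun t => (p t, a0)) a0 ?_
            (hpd.prodMk (hasDerivAt_const a0 a0))
          simpa only [hp0] using hYd
        have h3 : HasDerivAt (fun t => Y (s, t)) (fderiv ℝ Y (s, a0) (0, 1)) a0 :=
          HasFDerivAt.comp_hasDerivAt (f := fun t => (s, t)) a0 hYd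
            ((hasDerivAt_const a0 s).prodMk (hasDerivAt_id a0))
        refine ⟨_, h1.sub h2, ?_⟩
        rw [h3.deriv, ← map_sub]
        simp
      obtain ⟨d, hd, hd'⟩ := hx hX
      obtain ⟨e, he, -⟩ := hx hQ
      have hw : DifferentiableAt ℝ
          (fun t => X (s, a0) - X (π ((X (s, a0), Q (s, a0)), (a0, t)), a0)) a0 :=
        (contDiff_const.sub (hX.comp ((hπ.comp (contDiff_const.prodMk
          (contDiff_const.prodMk contDiff_id))).prodMk contDiff_const))).differentiable
          (by norm_num) a0
      have h := (hd.inner ℝ (hasDerivAt_const a0 (Q (s, a0)))).add (he.neg.inner ℝ hw.hasDerivAt)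
      have h' : HasDerivAt (fun t => B ((X (s, a0), Q (s, a0)), (a0, t)))
          ⟪deriv (fun t => X (s, t)) a0, Q (s, a0)⟫ a0 := by
        refine (h.congr_deriv ?_).congr_of_eventuallyEq (Eventually.of_forall fun t => ?_)
        · simp [hz, hd']
        · simp [hB, stepGen]
      have := (hDd (X (s, a0), Q (s, a0)) a0 a0).unique h'
      simp only [hk]
      refine lt_of_lt_of_eq ?_ this.symm
      exact hpos s hs
    · exact ⟨univ, isOpen_univ, subset_univ _, fun h => (hpos h).elim⟩
  obtain ⟨L, hL, hKL, hLO⟩ := exists_compact_between hK0c hO hKO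
  obtain ⟨χ, hχ1, hχ0, hχ⟩ := exists_contMDiffMap_one_nhds_of_subset_interior (n := 2)
    (modelWithCornersSelf ℝ (E × E)) hK0c.isClosed hKL
  have hχc : ContDiff ℝ 2 χ := χ.contMDiff.contDiff
  refine ⟨fun y => χ y.1 * B y, (hχc.comp contDiff_fst).mul hBc, fun z a => ?_, ⟨L, hL, ?_⟩, ?_, ?_⟩
  · simp only [hB, stepGen_self, mul_zero]
  · intro z τ hz
    simp only [hχ0 z hz, zero_mul]
  · have hnear : ∀ᶠ τ : ℝ × ℝ in 𝓝 (a0, a0), ∀ s ∈ S, ∀ᶠ z in 𝓝 (k (s, τ)), χ z = 1 := by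
      refine hS.eventually_forall_of_forall_eventually fun s hs => ?_
      have h1 : ∀ᶠ z in 𝓝 (k (s, (a0, a0))), ∀ᶠ z' in 𝓝 z, χ z' = 1 := by
        rw [eventually_eventually_nhds]
        exact (eventually_nhdsSet_iff_forall.1 hχ1) _ ⟨s, hs, rfl⟩
      have hc : Continuous fun p : (ℝ × ℝ) × E => k (p.2, p.1) := by fun_prop
      exact (hc.continuousAt (x := ((a0, a0), s))).eventually h1
    filter_upwards [hπs, hnear] with τ hτ hτ' s hs ha ht
    obtain ⟨a, t⟩ := τ
    simp only at ha ht
    have hs' := hτ s hs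
    have h1 := hτ' s hs
    simp only [hk] at hs' h1
    have hev : (fun z => χ z * B (z, (a, t))) =ᶠ[𝓝 (X (s, a), Q (s, t))]
        fun z => B (z, (a, t)) := by
      filter_upwards [h1] with z hz
      rw [hz, one_mul]
    have hfd := hev.fderiv_eq (𝕜 := ℝ)
    refine ⟨?_, ext_inner_right ℝ fun v => ?_, ext_inner_right ℝ fun v => ?_⟩
    · simp only [h1.self_of_nhds, one_mul]
      exact stepGen_apply hs'
    · rw [inner_gradX]
      simp only
      rw [hfd, stepGen_hasFDerivAt hX hQ hπ hs' ha ht]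
      simp
    · rw [inner_gradP]
      simp only
      rw [hfd, stepGen_hasFDerivAt hX hQ hπ hs' ha ht]
      simp
  · intro hpos
    have h1 : ∀ᶠ τ : ℝ × ℝ in 𝓝 (a0, a0), ∀ z ∈ L, 0 < D (z, τ) := by
      refine hL.eventually_forall_of_forall_eventually fun z hz => ?_
      have hc : Continuous fun p : (ℝ × ℝ) × (E × E) => D (p.2, p.1) := by fun_prop
      exact hc.continuousAt.eventually_const_lt (hOpos hpos z (hLO hz))
    obtain ⟨ρ, hρ, hb⟩ := Metric.eventually_nhds_iff.1 h1
    refine ⟨ρ, hρ, fun a t ha ht hat z => ?_⟩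
    by_cases hz : z ∈ L
    · refine mul_nonneg (hχ z).1 ?_
      have hmono : MonotoneOn (fun t => B (z, (a, t))) (Icc a t) := by
        refine monotoneOn_of_deriv_nonneg (convex_Icc a t)
          (fun t' _ => (hDd z a t').continuousAt.continuousWithinAt)
          (fun t' _ => (hDd z a t').differentiableAt.differentiableWithinAt) fun t' ht' => ?_
        rw [(hDd z a t').deriv]
        rw [interior_Icc] at ht'
        have ha' := abs_lt.1 ha
        have htt := abs_lt.1 ht
        refine (hb (y := (a, t')) ?_ z hz).le
        rw [Prod.dist_eq, max_lt_iff, Real.dist_eq, Real.dist_eq]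
        exact ⟨ha, abs_lt.2 ⟨by linarith [ht'.1], by linarith [ht'.2]⟩⟩
      have := hmono (left_mem_Icc.2 hat) (right_mem_Icc.2 hat) hat
      simpa only [hB, stepGen_self] using this
    · simp only [hχ0 z hz, zero_mul, le_refl]

end StepGen

section LocalStep
open Filter Topology

theorem isCompact_sph (m : ℕ) : IsCompact (sph m) := isCompact_sphere _ _

theorem norm_of_mem_sph {m : ℕ} {s : EuclideanSpace ℝ (Fin m)} (hs : s ∈ sph m) : ‖s‖ = 1 := by
  simpa [sph] using hs

/-- Derivatives of the radially extended front are orthogonal to the conormal. -/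
theorem IsLegIsotopyST.inner_fderiv_radial {m : ℕ}
    {F : EuclideanSpace ℝ (Fin m) × ℝ → STSp m} (hF : IsLegIsotopyST m F) {t : ℝ}
    (ht : t ∈ Icc (0:ℝ) 1) {s : EuclideanSpace ℝ (Fin m)} (hs : s ∈ sph m)
    (w : EuclideanSpace ℝ (Fin m)) :
    ⟪fderiv ℝ (fun v => (F (radProj v, t)).1) s w, (F (radProj s, t)).2⟫ = 0 := by
  have hs1 := norm_of_mem_sph hs
  have hr : radProj s = s := radProj_of_mem hs1
  have h1 : HasFDerivAt (fun v => F (v, t)) (fderiv ℝ (fun v => F (v, t)) s) s :=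
    ((hF.smooth.comp (contDiff_id.prodMk contDiff_const)).differentiable (by simp) s).hasFDerivAt
  have h2 : HasFDerivAt (radProj : EuclideanSpace ℝ (Fin m) → _) (fderiv ℝ radProj s) s :=
    (radProj_contDiff.differentiable (by simp) s).hasFDerivAt
  have h3 : HasFDerivAt (fun v => F (radProj v, t))
      ((fderiv ℝ (fun v => F (v, t)) s).comp (fderiv ℝ radProj s)) s := by
    refine HasFDerivAt.comp s (g := fun v => F (v, t)) (f := radProj) ?_ h2
    rw [hr]
    exact h1
  rw [h3.fst.fderiv, hr]
  exact hF.leg t ht s hs _ (inner_fderiv_radProj hs1 w)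

/-- Near a given time, the slices of a Legendrian isotopy are related by admissible steps. -/
theorem IsLegIsotopyST.exists_local_step {m : ℕ} {F : EuclideanSpace ℝ (Fin m) × ℝ → STSp m}
    (hF : IsLegIsotopyST m F) {a0 : ℝ} (ha0 : a0 ∈ Icc (0:ℝ) 1) :
    ∃ ρ > 0, ∀ N : ℕ, ∃ W : ℝ → ℝ → STSp m → ℝ,
      (∀ a ∈ Icc (0:ℝ) 1, ∀ t ∈ Icc (0:ℝ) 1, |a - a0| < ρ → |t - a0| < ρ →
        IsAdmStep (W a t) ∧ StepTracks (2 ^ N) (W a t) (stSlice m F a) (stSlice m F t)) ∧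
      (∀ a, W a a = 0) ∧
      (∀ a t0 ε, 0 < ε → ∀ᶠ t in 𝓝 t0, ∀ z, |W a t z - W a t0 z| ≤ ε) ∧
      ((∀ s ∈ sph m, 0 < ⟪deriv (fun t => (F (s, t)).1) a0, (F (s, a0)).2⟫) →
        ∀ a t, |a - a0| < ρ → |t - a0| < ρ → a ≤ t → ∀ z, 0 ≤ W a t z) := by
  have hF2 : ContDiff ℝ 2 F := hF.smooth.of_le (by norm_cast)
  set k : EuclideanSpace ℝ (Fin m) × (ℝ × ℝ) → STSp m :=
    fun p => ((F (p.1, p.2.1)).1, (F (p.1, p.2.2)).2) with hk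
  have hkc : ContDiff ℝ 2 k :=
    (contDiff_fst.comp (hF2.comp (contDiff_fst.prodMk (contDiff_fst.comp contDiff_snd)))).prodMk
      (contDiff_snd.comp (hF2.comp (contDiff_fst.prodMk (contDiff_snd.comp contDiff_snd))))
  obtain ⟨π, hπ, hπs⟩ := exists_param_left_inverse (isCompact_sph m) hkc
    (h := fun v => ‖v‖ ^ 2) (contDiff_norm_sq ℝ) (fun s hs => by simp [norm_of_mem_sph hs])
    (τ0 := (a0, a0)) (hF.inj a0 ha0) (fun s hs w hw1 hw2 => by
      by_contra hw
      have e1 : fderiv ℝ (fun v : EuclideanSpace ℝ (Fin m) => ‖v‖ ^ 2) s w = 2 * ⟪s, w⟫ := by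
        rw [(hasStrictFDerivAt_norm_sq s).hasFDerivAt.fderiv]
        simp
      refine hF.imm a0 ha0 s hs w ?_ hw ?_
      · rw [real_inner_comm]
        linarith
      · rw [← hw1]
        have : HasFDerivAt (fun v => F (v, a0))
            ((fderiv ℝ k (s, (a0, a0))).comp (.inl ℝ _ (ℝ × ℝ))) s :=
          HasFDerivAt.comp s (g := k) (f := fun v => (v, (a0, a0)))
            (hkc.differentiable (by norm_num) _).hasFDerivAt (hasFDerivAt_prodMk_left s _)
        rw [this.fderiv]
        rfl)
  set X : EuclideanSpace ℝ (Fin m) × ℝ → EuclideanSpace ℝ (Fin m) :=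
    fun p => (F (radProj p.1, p.2)).1 with hX
  set Q : EuclideanSpace ℝ (Fin m) × ℝ → EuclideanSpace ℝ (Fin m) :=
    fun p => (F (radProj p.1, p.2)).2 with hQ
  have hFr : ContDiff ℝ 2 fun p : EuclideanSpace ℝ (Fin m) × ℝ => F (radProj p.1, p.2) :=
    hF2.comp (((radProj_contDiff.of_le (by norm_cast)).comp contDiff_fst).prodMk contDiff_snd)
  have hXe : ∀ s ∈ sph m, ∀ t, X (s, t) = (F (s, t)).1 := fun s hs t => by
    simp only [hX, radProj_of_mem (norm_of_mem_sph hs)]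
  have hQe : ∀ s ∈ sph m, ∀ t, Q (s, t) = (F (s, t)).2 := fun s hs t => by
    simp only [hQ, radProj_of_mem (norm_of_mem_sph hs)]
  obtain ⟨U, hU, hU0, ⟨L, hL, hUL⟩, hUs, hUpos⟩ := exists_step_family (X := X) (Q := Q) (a0 := a0)
    (contDiff_fst.comp hFr) (contDiff_snd.comp hFr) hπ
    (isCompact_sph m) (by
      filter_upwards [hπs] with τ hτ s hs
      rw [hXe s hs, hQe s hs]
      exact hτ s hs)
  obtain ⟨R, hR⟩ := hL.isBounded.subset_closedBall 0
  have hUR : ∀ τ z, R < ‖z‖ → U (z, τ) = 0 := fun τ z hz =>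
    hUL z τ fun h => hz.not_ge (by simpa using hR h)
  obtain ⟨ρ, hρ, hb⟩ := Metric.eventually_nhds_iff.1 (hUs.and
    (eventually_fderiv_small hU hL hUL (fun z => hU0 z a0) (show (0:ℝ) < 1 / 8 by norm_num)))
  obtain ⟨ρ', hρ', hpos⟩ : ∃ ρ' > 0,
      ((∀ s ∈ sph m, 0 < ⟪deriv (fun t => (F (s, t)).1) a0, (F (s, a0)).2⟫) →
        ∀ a t, |a - a0| < ρ' → |t - a0| < ρ' → a ≤ t → ∀ z, 0 ≤ U (z, (a, t))) := by
    by_cases h : ∀ s ∈ sph m, 0 < ⟪deriv (fun t => (F (s, t)).1) a0, (F (s, a0)).2⟫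
    · obtain ⟨ρ', h1, h2⟩ := hUpos fun s hs => by
        rw [hQe s hs]
        simp only [hXe s hs]
        exact h s hs
      exact ⟨ρ', h1, fun _ => h2⟩
    · exact ⟨1, one_pos, fun h' => (h h').elim⟩
  refine ⟨min ρ ρ', lt_min hρ hρ', fun N => ⟨fun a t => coneLift N fun z => U (z, (a, t)),
    ?_, ?_, ?_, ?_⟩⟩
  · intro a ha t ht haa hta
    obtain ⟨h1, h2, h3⟩ := hb (y := (a, t)) (by
      rw [Prod.dist_eq, max_lt_iff, Real.dist_eq, Real.dist_eq]
      exact ⟨haa.trans_le (min_le_left _ _), hta.trans_le (min_le_left _ _)⟩)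
    have hUc : ContDiff ℝ 2 fun z => U (z, (a, t)) := hU.comp (contDiff_id.prodMk contDiff_const)
    have h4 : ∀ z, ‖gradX (fun z => U (z, (a, t))) z‖ ≤ 1 / 8 := fun z =>
      (norm_gradX_le _ z).trans (h2 z)
    refine ⟨coneLift_isAdmStep N hUc h4 (hUR _), coneLift_stepTracks N hUc h4 (fun x θ θ' => ?_) ?_⟩
    · refine (norm_gradX_sub_le _ _ _).trans ((h3 _ _).trans_eq ?_)
      simp [Prod.norm_def]
    · rintro x q ⟨s, hs, hsx⟩
      obtain ⟨u1, u2, u3⟩ := h1 s hs (hF.inner_fderiv_radial ha hs) (hF.inner_fderiv_radial ht hs)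
      simp only [hXe s hs, hQe s hs] at u1 u2 u3
      obtain ⟨rfl, rfl⟩ := Prod.ext_iff.1 hsx
      exact ⟨(F (s, t)).1, (F (s, t)).2, ⟨s, hs, rfl⟩, norm_of_mem_sph (hF.mem_sphere s hs t ht),
        u1, u2, u3⟩
  · intro a
    funext z
    simp [coneLift, hU0]
  · intro a t0 ε hε
    have hc : (0:ℝ) < 2 ^ (N + 2) := by positivity
    have h1 : ∀ᶠ t in 𝓝 t0, ∀ z ∈ L, |U (z, (a, t)) - U (z, (a, t0))| < ε / 2 ^ (N + 2) := by
      refine hL.eventually_forall_of_forall_eventually fun z hz => ?_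
      have hUc := hU.continuous
      have h2 : Continuous fun p : ℝ × STSp m => |U (p.2, (a, p.1)) - U (p.2, (a, t0))| := by
        fun_prop
      exact h2.continuousAt.eventually_lt_const (by simp only [sub_self, abs_zero]; positivity)
    filter_upwards [h1] with t ht z
    rw [coneLift, coneLift, ← mul_sub, abs_mul, abs_of_nonneg (coneRad_nonneg N _)]
    by_cases hz : (z.1, coneDir N z.2) ∈ L
    · calc _ ≤ 2 ^ (N + 2) * (ε / 2 ^ (N + 2)) := by
            gcongr
            · exact coneRad_le_pow N _
            · exact (ht _ hz).le
        _ = ε := by field_simp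
    · rw [hUL _ _ hz, hUL _ _ hz, sub_self, abs_zero, mul_zero]
      exact hε.le
  · intro h a t ha ht hat z
    exact mul_nonneg (coneRad_nonneg N _) (hpos h a t (ha.trans_le (min_le_right _ _))
      (ht.trans_le (min_le_right _ _)) hat _)

end LocalStep

section Moves
open Filter Topology

section Family
variable {E : Type*} [NormedAddCommGroup E] [InnerProductSpace ℝ E] [FiniteDimensional ℝ E]

/-- The step families `W true`, `W false` of length `k` are admissible and generate `A`, `B`. -/
structure IsGenFamily (x0 : E) (N k : ℕ) (W : Bool → ℕ → E × E → ℝ) (A B : Set (E × E)) : Prop where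
  adm : ∀ b i, IsAdmStep (W b i)
  eq_zero : ∀ b i, k ≤ i → W b i = 0
  left : Generates x0 (2 ^ N) k (W true) A
  right : Generates x0 (2 ^ N) k (W false) B

/-- The pair `(A, B)` is generated by families with nonnegative minimax value. -/
def LinkNonneg (x0 : E) (A B : Set (E × E)) : Prop :=
  ∃ k, ∀ N ≥ k, ∃ W, IsGenFamily x0 N k W A B ∧ 0 ≤ famValue x0 N W

theorem IsGenFamily.famValue_spec [Nontrivial E] {x0 : E} {N k : ℕ}
    {W : Bool → ℕ → E × E → ℝ} {A B : Set (E × E)} (h : IsGenFamily x0 N k W A B) (hkN : k ≤ N) :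
    ∃ p XL XR, (XL, p) ∈ A ∧ (XR, p) ∈ B ∧ XL = XR + famValue x0 N W • p := by
  have hM : (0:ℝ) < 2 ^ N := by positivity
  exact _root_.famValue_spec x0 N h.adm (A := fun b => if b then A else B) fun b => by
    cases b
    · simpa using h.right.extend hM hkN (h.eq_zero false)
    · simpa using h.left.extend hM hkN (h.eq_zero true)

/-- Replace the `k`-th steps of a pair of families. -/
def addStep (W : Bool → ℕ → E × E → ℝ) (k : ℕ) (V : Bool → E × E → ℝ) : Bool → ℕ → E × E → ℝ :=
  fun b => Function.update (W b) k (V b)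

theorem IsGenFamily.addStep {x0 : E} {N k : ℕ} {W : Bool → ℕ → E × E → ℝ} {A B A' B' : Set (E × E)}
    (h : IsGenFamily x0 N k W A B) {V : Bool → E × E → ℝ} (hV : ∀ b, IsAdmStep (V b))
    (hA : StepTracks (2 ^ N) (V true) A A') (hB : StepTracks (2 ^ N) (V false) B B') :
    IsGenFamily x0 N (k + 1) (addStep W k V) A' B' := by
  have hM : (0:ℝ) < 2 ^ N := by positivity
  have hne : ∀ b i, i ≠ k → _root_.addStep W k V b i = W b i := fun b i hi => by
    simp [_root_.addStep, hi]
  have heq : ∀ b, _root_.addStep W k V b k = V b := fun b => by simp [_root_.addStep]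
  refine ⟨fun b i => ?_, fun b i hi => ?_, ?_, ?_⟩
  · by_cases hi : i = k
    · subst hi; rw [heq]; exact hV b
    · rw [hne b i hi]; exact h.adm b i
  · rw [hne b i (by omega)]; exact h.eq_zero b i (by omega)
  · exact h.left.succ hM (fun i hi => hne true i hi.ne) (by rw [heq]; exact hA)
  · exact h.right.succ hM (fun i hi => hne false i hi.ne) (by rw [heq]; exact hB)

theorem addStep_zero {W : Bool → ℕ → E × E → ℝ} {k : ℕ} (hW : ∀ b i, k ≤ i → W b i = 0)
    {V : Bool → E × E → ℝ} (hV : ∀ b, V b = 0) : addStep W k V = W := by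
  funext b
  rw [addStep, hV b, ← hW b k le_rfl, Function.update_eq_self]

theorem abs_famValue_addStep_sub_le [Nontrivial E] {x0 : E} {N k : ℕ} {W : Bool → ℕ → E × E → ℝ}
    (hW : ∀ b i, IsAdmStep (W b i)) {V V' : Bool → E × E → ℝ} (hV : ∀ b, IsAdmStep (V b))
    (hV' : ∀ b, IsAdmStep (V' b)) {δ : ℝ} (hδ : ∀ b z, |V b z - V' b z| ≤ δ) :
    |famValue x0 N (addStep W k V) - famValue x0 N (addStep W k V')| ≤ 2 * N * δ := by
  have hadm : ∀ {V : Bool → E × E → ℝ}, (∀ b, IsAdmStep (V b)) →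
      ∀ b i, IsAdmStep (addStep W k V b i) := fun hV b i => by
    by_cases hi : i = k
    · subst hi; simpa [addStep] using hV b
    · simpa [addStep, hi] using hW b i
  have key : ∀ {V V' : Bool → E × E → ℝ}, (∀ b z, |V b z - V' b z| ≤ δ) →
      ∀ b i z, sideSign b * addStep W k V b i z ≤ sideSign b * addStep W k V' b i z + δ := by
    intro V V' hδ b i z
    have h0 : 0 ≤ δ := (abs_nonneg _).trans (hδ b z)
    by_cases hi : i = k
    · subst hi
      have h1 := abs_le.1 (hδ b z)
      cases b <;> simp only [addStep, Function.update_self, sideSign] <;> norm_num <;> linarith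
    · simpa [addStep, hi] using h0
  rw [abs_le]
  have h1 := famValue_le_add x0 N (hadm hV') (hadm hV) (key hδ)
  have h2 := famValue_le_add x0 N (hadm hV) (hadm hV')
    (key fun b z => by rw [abs_sub_comm]; exact hδ b z)
  constructor <;> linarith

theorem famValue_le_addStep [Nontrivial E] {x0 : E} {N k : ℕ} {W : Bool → ℕ → E × E → ℝ}
    (hW : ∀ b i, IsAdmStep (W b i)) (hk : ∀ b, W b k = 0) {V : Bool → E × E → ℝ}
    (hV : ∀ b, IsAdmStep (V b)) (h : ∀ b z, 0 ≤ sideSign b * V b z) :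
    famValue x0 N W ≤ famValue x0 N (addStep W k V) := by
  have hadm : ∀ b i, IsAdmStep (addStep W k V b i) := fun b i => by
    by_cases hi : i = k
    · subst hi; simpa [addStep] using hV b
    · simpa [addStep, hi] using hW b i
  have := famValue_le_add x0 N hadm hW (δ := 0) fun b i z => by
    by_cases hi : i = k
    · subst hi; simpa [addStep, hk] using h b z
    · simp [addStep, hi]
  linarith

end Family

theorem Icc_induction {p : ℝ → Prop}
    (h : ∀ c ∈ Icc (0:ℝ) 1, ∃ ρ > 0, ∀ a ∈ Icc (0:ℝ) 1, ∀ b ∈ Icc (0:ℝ) 1,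
      |a - c| < ρ → |b - c| < ρ → a ≤ b → p a → p b) (h0 : p 0) : p 1 := by
  set S : Set ℝ := {t | t ∈ Icc (0:ℝ) 1 ∧ p t} with hS
  have hS0 : (0:ℝ) ∈ S := ⟨⟨le_rfl, zero_le_one⟩, h0⟩
  have hSb : BddAbove S := ⟨1, fun t ht => ht.1.2⟩
  have hc0 : 0 ≤ sSup S := le_csSup hSb hS0
  have hc1 : sSup S ≤ 1 := csSup_le ⟨0, hS0⟩ fun t ht => ht.1.2
  obtain ⟨ρ, hρ, hst⟩ := h (sSup S) ⟨hc0, hc1⟩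
  obtain ⟨a, ha, hac⟩ := exists_lt_of_lt_csSup ⟨0, hS0⟩ (show sSup S - ρ < sSup S by linarith)
  have hac' : a ≤ sSup S := le_csSup hSb ha
  set b := min 1 (sSup S + ρ / 2) with hb
  have hb1 : sSup S ≤ b := le_min hc1 (by linarith)
  have hb2 : b ≤ sSup S + ρ / 2 := min_le_right _ _
  have hbI : b ∈ Icc (0:ℝ) 1 := ⟨hc0.trans hb1, min_le_left _ _⟩
  have hpb : p b := hst a ha.1 b hbI (abs_lt.2 ⟨by linarith, by linarith⟩)
    (abs_lt.2 ⟨by linarith, by linarith⟩) (hac'.trans hb1) ha.2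
  have hbS : b ≤ sSup S := le_csSup hSb ⟨hbI, hpb⟩
  rcases min_choice 1 (sSup S + ρ / 2) with h1 | h1
  · rwa [hb, h1] at hpb
  · rw [hb, h1] at hbS; linarith

variable {m : ℕ}

/-- Nonnegativity of the minimax value persists along an isotopy of disjoint pairs. -/
theorem LinkNonneg.of_disjoint_isotopy [Nontrivial (EuclideanSpace ℝ (Fin m))]
    {x0 : EuclideanSpace ℝ (Fin m)} {L R : EuclideanSpace ℝ (Fin m) × ℝ → STSp m}
    (hL : IsLegIsotopyST m L) (hR : IsLegIsotopyST m R)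
    (hd : ∀ t ∈ Icc (0:ℝ) 1, stSlice m L t ∩ stSlice m R t = ∅)
    (h0 : LinkNonneg x0 (stSlice m L 0) (stSlice m R 0)) :
    LinkNonneg x0 (stSlice m L 1) (stSlice m R 1) := by
  refine Icc_induction (p := fun t => LinkNonneg x0 (stSlice m L t) (stSlice m R t))
    (fun c hc => ?_) h0
  obtain ⟨ρ1, hρ1, hS1⟩ := hL.exists_local_step hc
  obtain ⟨ρ2, hρ2, hS2⟩ := hR.exists_local_step hc
  refine ⟨min ρ1 ρ2, lt_min hρ1 hρ2, fun a ha b hb hac hbc hab hp => ?_⟩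
  obtain ⟨k, hk⟩ := hp
  refine ⟨k + 1, fun N hN => ?_⟩
  obtain ⟨W, hW, hWv⟩ := hk N (by omega)
  obtain ⟨V1, hV1, hV1a, hV1c, -⟩ := hS1 N
  obtain ⟨V2, hV2, hV2a, hV2c, -⟩ := hS2 N
  have hnear : ∀ t ∈ Icc a b, t ∈ Icc (0:ℝ) 1 ∧ |t - c| < min ρ1 ρ2 := fun t ht => by
    have h1 := abs_lt.1 hac
    have h2 := abs_lt.1 hbc
    exact ⟨⟨ha.1.trans ht.1, ht.2.trans hb.2⟩,
      abs_lt.2 ⟨by linarith [ht.1], by linarith [ht.2]⟩⟩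
  set V : ℝ → Bool → STSp m → ℝ := fun t i => if i then V1 a t else V2 a t with hV
  have hVadm : ∀ t ∈ Icc a b, ∀ i, IsAdmStep (V t i) := fun t ht i => by
    obtain ⟨htI, htc⟩ := hnear t ht
    cases i
    · simpa [hV] using (hV2 a ha t htI (hac.trans_le (min_le_right _ _))
        (htc.trans_le (min_le_right _ _))).1
    · simpa [hV] using (hV1 a ha t htI (hac.trans_le (min_le_left _ _))
        (htc.trans_le (min_le_left _ _))).1
  have hfam : ∀ t ∈ Icc a b, IsGenFamily x0 N (k + 1) (addStep W k (V t))
      (stSlice m L t) (stSlice m R t) := fun t ht => by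
    obtain ⟨htI, htc⟩ := hnear t ht
    refine hW.addStep (hVadm t ht) ?_ ?_
    · simpa [hV] using (hV1 a ha t htI (hac.trans_le (min_le_left _ _))
        (htc.trans_le (min_le_left _ _))).2
    · simpa [hV] using (hV2 a ha t htI (hac.trans_le (min_le_right _ _))
        (htc.trans_le (min_le_right _ _))).2
  set f : ℝ → ℝ := fun t => famValue x0 N (addStep W k (V t)) with hf
  have hf0 : ∀ t ∈ Icc a b, f t ≠ 0 := fun t ht hft => by
    obtain ⟨p, XL, XR, h1, h2, h3⟩ := (hfam t ht).famValue_spec (by omega)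
    rw [show famValue x0 N (addStep W k (V t)) = 0 from hft, zero_smul, add_zero] at h3
    subst h3
    have : (XL, p) ∈ stSlice m L t ∩ stSlice m R t := ⟨h1, h2⟩
    rw [hd t (hnear t ht).1] at this
    exact this
  have hfa : 0 ≤ f a := by
    have : addStep W k (V a) = W := addStep_zero hW.eq_zero fun i => by
      cases i
      · simpa [hV] using hV2a a
      · simpa [hV] using hV1a a
    simp only [hf, this]
    exact hWv
  have hfc : ContinuousOn f (Icc a b) := by
    intro t0 ht0
    rw [ContinuousWithinAt, Metric.tendsto_nhds]
    intro ε hε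
    have hδ : 0 < ε / (2 * N + 1) := by positivity
    filter_upwards [self_mem_nhdsWithin, nhdsWithin_le_nhds (hV1c a t0 _ hδ),
      nhdsWithin_le_nhds (hV2c a t0 _ hδ)] with t ht h1 h2
    rw [Real.dist_eq]
    refine (abs_famValue_addStep_sub_le hW.adm (hVadm t ht) (hVadm t0 ht0)
      (δ := ε / (2 * N + 1)) fun i z => ?_).trans_lt ?_
    · cases i
      · simpa [hV] using h2 z
      · simpa [hV] using h1 z
    · rw [mul_div_assoc', div_lt_iff₀ (by positivity)]
      nlinarith
  refine ⟨_, hfam b (right_mem_Icc.2 hab), ?_⟩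
  by_contra hneg
  push Not at hneg
  obtain ⟨t, ht, hft⟩ := intermediate_value_Icc' hab hfc ⟨hneg.le, hfa⟩
  exact hf0 t ht hft

/-- Nonnegativity of the minimax value persists when the first component moves positively. -/
theorem LinkNonneg.of_pos_isotopy [Nontrivial (EuclideanSpace ℝ (Fin m))]
    {x0 : EuclideanSpace ℝ (Fin m)} {L : EuclideanSpace ℝ (Fin m) × ℝ → STSp m}
    (hL : IsLegIsotopyST m L) (hpos : ∀ t ∈ Icc (0:ℝ) 1, ∀ s ∈ sph m,
      0 < ⟪deriv (fun t' => (L (s, t')).1) t, (L (s, t)).2⟫) {B : Set (STSp m)}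
    (h0 : LinkNonneg x0 (stSlice m L 0) B) : LinkNonneg x0 (stSlice m L 1) B := by
  refine Icc_induction (p := fun t => LinkNonneg x0 (stSlice m L t) B) (fun c hc => ?_) h0
  obtain ⟨ρ, hρ, hS⟩ := hL.exists_local_step hc
  refine ⟨ρ, hρ, fun a ha b hb hac hbc hab hp => ?_⟩
  obtain ⟨k, hk⟩ := hp
  refine ⟨k + 1, fun N hN => ?_⟩
  obtain ⟨W, hW, hWv⟩ := hk N (by omega)
  obtain ⟨V, hV, -, -, hVpos⟩ := hS N
  have hV' := hV a ha b hb hac hbc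
  have hadm : ∀ i : Bool, IsAdmStep (if i then V a b else 0 : STSp m → ℝ) := fun i => by
    cases i
    · simpa using IsAdmStep.zero
    · simpa using hV'.1
  refine ⟨addStep W k fun i => if i then V a b else 0, hW.addStep hadm ?_ ?_, hWv.trans ?_⟩
  · simpa using hV'.2
  · simpa using StepTracks.zero _ _
  · refine famValue_le_addStep hW.adm (fun i => hW.eq_zero i k le_rfl) hadm fun i z => ?_
    cases i
    · simp
    · simpa [sideSign] using hVpos (hpos c hc) a b hac hbc hab z

theorem linkNonneg_fib [Nontrivial (EuclideanSpace ℝ (Fin m))] (x0 : EuclideanSpace ℝ (Fin m)) :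
    LinkNonneg x0 (fib m x0) (fib m x0) := by
  refine ⟨0, fun N _ => ⟨fun _ _ => 0, ?_⟩⟩
  have h : IsGenFamily x0 N 0 (fun _ _ => 0) (fib m x0) (fib m x0) :=
    ⟨fun _ _ => IsAdmStep.zero, fun _ _ _ => rfl, Generates.zero x0 (by positivity) _,
      Generates.zero x0 (by positivity) _⟩
  refine ⟨h, ?_⟩
  obtain ⟨p, XL, XR, h1, h2, h3⟩ := h.famValue_spec (Nat.zero_le N)
  have e1 : XL = x0 := h1.1
  have e2 : XR = x0 := h2.1
  rw [e1, e2, left_eq_add, smul_eq_zero] at h3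
  rcases h3 with h3 | h3
  · exact h3.ge
  · have := norm_of_mem_sph h1.2
    simp [h3] at this

theorem not_linkNonneg_of_neg [Nontrivial (EuclideanSpace ℝ (Fin m))]
    {x0 : EuclideanSpace ℝ (Fin m)} {ε : ℝ} (hε : 0 < ε) {A : Set (STSp m)}
    (hA : ∀ z ∈ A, z.2 ∈ sph m ∧ z.1 = x0 - ε • z.2) : ¬ LinkNonneg x0 A (fib m x0) := by
  rintro ⟨k, hk⟩
  obtain ⟨W, hW, hWv⟩ := hk k le_rfl
  obtain ⟨p, XL, XR, h1, h2, h3⟩ := hW.famValue_spec le_rfl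
  have e2 : XR = x0 := h2.1
  obtain ⟨hp, e1⟩ := hA _ h1
  simp only at hp e1
  have h4 : (famValue x0 k W + ε) • p = 0 := by
    rw [e1, e2] at h3
    have : famValue x0 k W • p = x0 - ε • p - x0 := by rw [h3]; abel
    rw [add_smul, this]
    abel
  rcases smul_eq_zero.1 h4 with h5 | h5
  · linarith
  · have := norm_of_mem_sph hp
    simp [h5] at this

end Moves

section Flow
open Filter Topology

theorem fderiv_radProj_of_inner_eq_zero {E : Type*} [NormedAddCommGroup E] [InnerProductSpace ℝ E]
    [FiniteDimensional ℝ E] {s w : E} (hs : ‖s‖ = 1) (hw : ⟪w, s⟫ = 0) : fderiv ℝ radProj s w = w := by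
  have hd : HasFDerivAt (radProj : E → E) (fderiv ℝ radProj s) s :=
    (radProj_contDiff.differentiable (by simp) s).hasFDerivAt
  have h1 := (hasFDerivAt_norm_of_ne (norm_pos_iff.1 (hs ▸ one_pos))).smul hd
  have h2 : (fun v : E => ‖v‖ • radProj v) =ᶠ[𝓝 s] id := by
    have : ∀ᶠ v : E in 𝓝 s, 1 / 2 < ‖v‖ :=
      continuous_norm.continuousAt.eventually_const_lt (by simp only [hs]; norm_num)
    filter_upwards [this] with v hv
    rw [radProj_eq hv.le, smul_smul, mul_inv_cancel₀ (by linarith), one_smul, id]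
  have h3 := (hasFDerivAt_id s).unique (h1.congr_of_eventuallyEq h2.symm)
  have h4 := congrArg (fun L : E →L[ℝ] E => L w) h3
  have h5 : ⟪s, w⟫ = 0 := by rw [real_inner_comm, hw]
  simpa [hs, h5] using h4.symm

variable {m : ℕ} {F : EuclideanSpace ℝ (Fin m) × ℝ → STSp m}

theorem IsLegIsotopyST.inner_fderiv_conormal (hF : IsLegIsotopyST m F) {t : ℝ}
    (ht : t ∈ Icc (0:ℝ) 1) {s v : EuclideanSpace ℝ (Fin m)} (hs : s ∈ sph m) (hv : ⟪v, s⟫ = 0) :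
    ⟪(fderiv ℝ (fun s' => F (s', t)) s v).2, (F (s, t)).2⟫ = 0 := by
  have hs1 := norm_of_mem_sph hs
  have hr : radProj s = s := radProj_of_mem hs1
  have h1 : HasFDerivAt (fun v => F (v, t)) (fderiv ℝ (fun v => F (v, t)) s) s :=
    ((hF.smooth.comp (contDiff_id.prodMk contDiff_const)).differentiable (by simp) s).hasFDerivAt
  have h2 : HasFDerivAt (radProj : EuclideanSpace ℝ (Fin m) → _) (fderiv ℝ radProj s) s :=
    (radProj_contDiff.differentiable (by simp) s).hasFDerivAt
  have h3 : HasFDerivAt (fun v => F (radProj v, t))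
      ((fderiv ℝ (fun v => F (v, t)) s).comp (fderiv ℝ radProj s)) s := by
    refine HasFDerivAt.comp s (g := fun v => F (v, t)) (f := radProj) ?_ h2
    rw [hr]
    exact h1
  have h4 := h3.snd.inner ℝ h3.snd
  have h5 : (fun v => ⟪(F (radProj v, t)).2, (F (radProj v, t)).2⟫) =ᶠ[𝓝 s] fun _ => (1:ℝ) := by
    have : ∀ᶠ v : EuclideanSpace ℝ (Fin m) in 𝓝 s, 1 / 2 < ‖v‖ :=
      continuous_norm.continuousAt.eventually_const_lt (by simp only [hs1]; norm_num)
    filter_upwards [this] with v hv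
    have hm : radProj v ∈ sph m := by simpa [sph] using norm_radProj hv.le
    rw [real_inner_self_eq_norm_sq, norm_of_mem_sph (hF.mem_sphere _ hm t ht), one_pow]
  have h6 := (h4.congr_of_eventuallyEq h5.symm).unique (hasFDerivAt_const (1:ℝ) s)
  have h7 := congrArg (fun L : EuclideanSpace ℝ (Fin m) →L[ℝ] ℝ => L v) h6
  have h8 := real_inner_comm (fderiv ℝ (fun s' => F (s', t)) s v).2 (F (s, t)).2
  simp [hr, fderiv_radProj_of_inner_eq_zero hs1 hv] at h7
  linarith

theorem IsLegIsotopyST.inner_deriv_conormal (hF : IsLegIsotopyST m F) {t : ℝ}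
    (ht : t ∈ Icc (0:ℝ) 1) {s : EuclideanSpace ℝ (Fin m)} (hs : s ∈ sph m) :
    ⟪deriv (fun t' => (F (s, t')).2) t, (F (s, t)).2⟫ = 0 := by
  have h1 : HasDerivAt (fun t' => (F (s, t')).2) (deriv (fun t' => (F (s, t')).2) t) t :=
    ((contDiff_snd.comp (hF.smooth.comp (contDiff_const.prodMk contDiff_id))).differentiable
      (by simp) t).hasDerivAt
  have h2 := (h1.inner ℝ h1).hasDerivWithinAt (s := Icc (0:ℝ) 1)
  have h3 : HasDerivWithinAt (fun t' => ⟪(F (s, t')).2, (F (s, t')).2⟫) (0:ℝ) (Icc 0 1) t := by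
    refine (hasDerivWithinAt_const t (Icc (0:ℝ) 1) (1:ℝ)).congr (fun t' ht' => ?_) ?_
    · rw [real_inner_self_eq_norm_sq, norm_of_mem_sph (hF.mem_sphere s hs t' ht'), one_pow]
    · rw [real_inner_self_eq_norm_sq, norm_of_mem_sph (hF.mem_sphere s hs t ht), one_pow]
  have h4 := (uniqueDiffOn_Icc zero_lt_one t ht).eq_deriv _ h2 h3
  have h5 := real_inner_comm (deriv (fun t' => (F (s, t')).2) t) (F (s, t)).2
  linarith

/-- The normalised geodesic flow for time `r`. -/
def wave {m : ℕ} (r : ℝ) (A : Set (STSp m)) : Set (STSp m) := (fun z => (z.1 + r • z.2, z.2)) '' A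

theorem wave_zero (A : Set (STSp m)) : wave 0 A = A := by simp [wave]

/-- The isotopy `F` run along `t ↦ c + d t` and pushed by the geodesic flow for time `α + β t`. -/
def flowIsotopy {m : ℕ} (F : EuclideanSpace ℝ (Fin m) × ℝ → STSp m) (α β c d : ℝ)
    (p : EuclideanSpace ℝ (Fin m) × ℝ) : STSp m :=
  ((F (p.1, c + d * p.2)).1 + (α + β * p.2) • (F (p.1, c + d * p.2)).2, (F (p.1, c + d * p.2)).2)

theorem stSlice_flowIsotopy (α β c d t : ℝ) :
    stSlice m (flowIsotopy F α β c d) t = wave (α + β * t) (stSlice m F (c + d * t)) := by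
  simp only [stSlice, wave, flowIsotopy, image_image]

theorem IsLegIsotopyST.flowIsotopy (hF : IsLegIsotopyST m F) (α β : ℝ) {c d : ℝ}
    (hcd : ∀ t ∈ Icc (0:ℝ) 1, c + d * t ∈ Icc (0:ℝ) 1) :
    IsLegIsotopyST m (flowIsotopy F α β c d) := by
  have hFt : ContDiff ℝ (⊤ : ℕ∞) fun p : EuclideanSpace ℝ (Fin m) × ℝ => F (p.1, c + d * p.2) :=
    hF.smooth.comp (contDiff_fst.prodMk (contDiff_const.add (contDiff_const.mul contDiff_snd)))
  have hfd : ∀ s t v, fderiv ℝ (fun s' => _root_.flowIsotopy F α β c d (s', t)) s v =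
      ((fderiv ℝ (fun s' => F (s', c + d * t)) s v).1 +
        (α + β * t) • (fderiv ℝ (fun s' => F (s', c + d * t)) s v).2,
        (fderiv ℝ (fun s' => F (s', c + d * t)) s v).2) := by
    intro s t v
    have h1 : HasFDerivAt (fun s' => F (s', c + d * t))
        (fderiv ℝ (fun s' => F (s', c + d * t)) s) s :=
      ((hF.smooth.comp (contDiff_id.prodMk contDiff_const)).differentiable (by simp) s).hasFDerivAt
    have h2 := (h1.fst.add (h1.snd.const_smul (α + β * t))).prodMk h1.snd
    have h3 : HasFDerivAt (fun s' => _root_.flowIsotopy F α β c d (s', t)) _ s := h2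
    rw [h3.fderiv]
    rfl
  refine ⟨?_, fun s hs t ht => hF.mem_sphere s hs _ (hcd t ht), fun t ht s hs s' hs' h => ?_,
    fun t ht s hs v hv hv0 h => ?_, fun t ht s hs v hv => ?_⟩
  · exact ((contDiff_fst.comp hFt).add ((contDiff_const.add (contDiff_const.mul
      contDiff_snd)).smul (contDiff_snd.comp hFt))).prodMk (contDiff_snd.comp hFt)
  · obtain ⟨h1, h2⟩ := Prod.ext_iff.1 h
    simp only [_root_.flowIsotopy] at h1 h2
    rw [h2, add_left_inj] at h1
    exact hF.inj _ (hcd t ht) hs hs' (Prod.ext h1 h2)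
  · rw [hfd] at h
    obtain ⟨h1, h2⟩ := Prod.ext_iff.1 h
    simp only [Prod.fst_zero, Prod.snd_zero] at h1 h2
    rw [h2, smul_zero, add_zero] at h1
    exact hF.imm _ (hcd t ht) s hs v hv hv0 (Prod.ext h1 h2)
  · rw [hfd]
    simp only [_root_.flowIsotopy]
    rw [inner_add_left, inner_smul_left, hF.leg _ (hcd t ht) s hs v hv,
      hF.inner_fderiv_conormal (hcd t ht) hs hv, mul_zero, add_zero]

theorem IsLegIsotopyST.inner_deriv_flowIsotopy (hF : IsLegIsotopyST m F) (α β c d : ℝ) {t : ℝ}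
    (ht : c + d * t ∈ Icc (0:ℝ) 1) {s : EuclideanSpace ℝ (Fin m)} (hs : s ∈ sph m) :
    ⟪deriv (fun t' => (_root_.flowIsotopy F α β c d (s, t')).1) t,
      (_root_.flowIsotopy F α β c d (s, t)).2⟫ =
      d * ⟪deriv (fun t' => (F (s, t')).1) (c + d * t), (F (s, c + d * t)).2⟫ + β := by
  have h0 : HasDerivAt (fun t' : ℝ => c + d * t') d t := by
    simpa using ((hasDerivAt_id t).const_mul d).const_add c
  have h1 : HasDerivAt (fun t' => (F (s, t')).1) (deriv (fun t' => (F (s, t')).1) (c + d * t))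
      (c + d * t) :=
    ((contDiff_fst.comp (hF.smooth.comp (contDiff_const.prodMk contDiff_id))).differentiable
      (by simp) _).hasDerivAt
  have h2 : HasDerivAt (fun t' => (F (s, t')).2) (deriv (fun t' => (F (s, t')).2) (c + d * t))
      (c + d * t) :=
    ((contDiff_snd.comp (hF.smooth.comp (contDiff_const.prodMk contDiff_id))).differentiable
      (by simp) _).hasDerivAt
  have h3 : HasDerivAt (fun t' : ℝ => α + β * t') β t := by
    simpa using ((hasDerivAt_id t).const_mul β).const_add α
  have h4 := (h1.scomp t h0).add (h3.smul (h2.scomp t h0))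
  have h5 : HasDerivAt (fun t' => (_root_.flowIsotopy F α β c d (s, t')).1) _ t := h4
  rw [h5.deriv]
  simp only [_root_.flowIsotopy, Function.comp_apply]
  rw [inner_add_left, inner_add_left, inner_smul_left, inner_smul_left, inner_smul_left,
    inner_smul_left, hF.inner_deriv_conormal ht hs, real_inner_self_eq_norm_sq,
    norm_of_mem_sph (hF.mem_sphere s hs _ ht)]
  simp

/-- The constant isotopy at a fibre. -/
def fibIsotopy {m : ℕ} (x0 : EuclideanSpace ℝ (Fin m)) (p : EuclideanSpace ℝ (Fin m) × ℝ) :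
    STSp m := (x0, p.1)

theorem isLegIsotopyST_fibIsotopy (x0 : EuclideanSpace ℝ (Fin m)) :
    IsLegIsotopyST m (fibIsotopy x0) := by
  have hfd : ∀ (s v : EuclideanSpace ℝ (Fin m)) (t : ℝ),
      fderiv ℝ (fun s' => fibIsotopy x0 (s', t)) s v = (0, v) := by
    intro s v t
    have h : HasFDerivAt (fun s' => fibIsotopy x0 (s', t)) _ s :=
      (hasFDerivAt_const (𝕜 := ℝ) x0 s).prodMk (hasFDerivAt_id (𝕜 := ℝ) s)
    rw [h.fderiv]
    rfl
  refine ⟨contDiff_const.prodMk contDiff_fst, fun s hs _ _ => hs,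
    fun t _ s _ s' _ h => (Prod.ext_iff.1 h).2, fun t _ s _ v _ hv h => ?_, fun t _ s _ v _ => ?_⟩
  · rw [hfd] at h
    exact hv (Prod.ext_iff.1 h).2
  · rw [hfd]
    exact inner_zero_left _

theorem stSlice_fibIsotopy (x0 : EuclideanSpace ℝ (Fin m)) (t : ℝ) :
    stSlice m (fibIsotopy x0) t = fib m x0 := by
  ext ⟨x, q⟩
  simp only [stSlice, fibIsotopy, mem_image, Prod.mk.injEq, fib, mem_prod, mem_singleton_iff]
  constructor
  · rintro ⟨s, hs, rfl, rfl⟩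
    exact ⟨rfl, hs⟩
  · rintro ⟨rfl, hq⟩
    exact ⟨q, hq, rfl, rfl⟩

theorem isCompact_stSlice (hF : IsLegIsotopyST m F) (t : ℝ) : IsCompact (stSlice m F t) :=
  (isCompact_sph m).image (hF.smooth.continuous.comp (by fun_prop))

theorem eventually_wave_inter_eq_empty {A B : Set (STSp m)} (hA : IsCompact A) (hB : IsCompact B)
    (h : A ∩ B = ∅) : ∀ᶠ r : ℝ in 𝓝 0, wave r A ∩ B = ∅ := by
  have h1 : ∀ᶠ r : ℝ in 𝓝 0, ∀ z ∈ A, ((z.1 + r • z.2, z.2) : STSp m) ∈ Bᶜ := by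
    refine hA.eventually_forall_of_forall_eventually fun z hz => ?_
    have hc : Continuous fun p : ℝ × STSp m => ((p.2.1 + p.1 • p.2.2, p.2.2) : STSp m) := by
      fun_prop
    refine hc.continuousAt.eventually (hB.isClosed.isOpen_compl.mem_nhds ?_)
    simp only [zero_smul, add_zero]
    exact fun hzB => (h ▸ ⟨hz, hzB⟩ : z ∈ (∅ : Set (STSp m)))
  filter_upwards [h1] with r hr
  rw [eq_empty_iff_forall_notMem]
  rintro _ ⟨⟨z, hz, rfl⟩, hzB⟩
  exact hr z hz hzB

/-- A compact Legendrian isotopy has no short geodesic chords. -/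
theorem IsLegIsotopyST.eventually_no_chords (hF : IsLegIsotopyST m F) :
    ∀ᶠ r : ℝ in 𝓝 0, ∀ t ∈ Icc (0:ℝ) 1, r ≠ 0 →
      wave r (stSlice m F t) ∩ stSlice m F t = ∅ := by
  refine isCompact_Icc.eventually_forall_of_forall_eventually fun t0 ht0 => ?_
  have hF2 : ContDiff ℝ 2 F := hF.smooth.of_le (by norm_cast)
  obtain ⟨π, hπ, hπs⟩ := exists_param_left_inverse (isCompact_sph m) hF2
    (h := fun v => ‖v‖ ^ 2) (contDiff_norm_sq ℝ) (fun s hs => by simp [norm_of_mem_sph hs])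
    (τ0 := t0) (hF.inj t0 ht0) (fun s hs w hw1 hw2 => by
      by_contra hw
      have e1 : fderiv ℝ (fun v : EuclideanSpace ℝ (Fin m) => ‖v‖ ^ 2) s w = 2 * ⟪s, w⟫ := by
        rw [(hasStrictFDerivAt_norm_sq s).hasFDerivAt.fderiv]
        simp
      refine hF.imm t0 ht0 s hs w ?_ hw ?_
      · rw [real_inner_comm]
        linarith
      · rw [← hw1]
        have : HasFDerivAt (fun v => F (v, t0)) ((fderiv ℝ F (s, t0)).comp (.inl ℝ _ ℝ)) s :=
          HasFDerivAt.comp s (g := F) (f := fun v => (v, t0))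
            (hF2.differentiable (by norm_num) _).hasFDerivAt (hasFDerivAt_prodMk_left s _)
        rw [this.fderiv]
        rfl)
  set X : EuclideanSpace ℝ (Fin m) × ℝ → EuclideanSpace ℝ (Fin m) :=
    fun p => (F (radProj p.1, p.2)).1 with hX
  have hXc : ContDiff ℝ 2 X := contDiff_fst.comp
    (hF2.comp (((radProj_contDiff.of_le (by norm_cast)).comp contDiff_fst).prodMk contDiff_snd))
  set Ψ : STSp m × ℝ → ℝ := fun y => ⟪y.1.1 - X (π y, y.2), y.1.2⟫ with hΨ
  have hΨc : ContDiff ℝ 2 Ψ :=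
    ((contDiff_fst.comp contDiff_fst).sub (hXc.comp (hπ.prodMk contDiff_snd))).inner ℝ
      (contDiff_snd.comp contDiff_fst)
  set D : (ℝ × ℝ) × EuclideanSpace ℝ (Fin m) → ℝ := fun p =>
    fderiv ℝ Ψ (((F (p.2, p.1.2)).1 + p.1.1 • (F (p.2, p.1.2)).2, (F (p.2, p.1.2)).2), p.1.2)
      (((F (p.2, p.1.2)).2, 0), 0) with hD
  have hDc : Continuous D := by
    have h1 := hF2.continuous
    have h2 : Continuous (fderiv ℝ Ψ) := hΨc.continuous_fderiv (by norm_num)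
    exact (h2.comp (by fun_prop)).clm_apply (by fun_prop)
  have hDd : ∀ s t r, HasDerivAt (fun r : ℝ =>
      Ψ (((F (s, t)).1 + r • (F (s, t)).2, (F (s, t)).2), t)) (D ((r, t), s)) r := by
    intro s t r
    have h1 : HasDerivAt (fun r : ℝ => (((F (s, t)).1 + r • (F (s, t)).2, (F (s, t)).2), t))
        (((F (s, t)).2, 0), 0) r := by
      have h2 : HasDerivAt (fun r : ℝ => (F (s, t)).1 + r • (F (s, t)).2) (F (s, t)).2 r := by
        simpa using ((hasDerivAt_id r).smul_const (F (s, t)).2).const_add (F (s, t)).1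
      exact (h2.prodMk (hasDerivAt_const r _)).prodMk (hasDerivAt_const r t)
    exact (hΨc.differentiable (by norm_num) _).hasFDerivAt.comp_hasDerivAt r h1
  have hD1 : ∀ s ∈ sph m, 0 < D ((0, t0), s) := by
    intro s hs
    set q := (F (s, t0)).2 with hq
    have hpc : ContDiff ℝ 2 fun r : ℝ => π (((F (s, t0)).1 + r • q, q), t0) :=
      hπ.comp (((contDiff_const.add (contDiff_id.smul contDiff_const)).prodMk
        contDiff_const).prodMk contDiff_const)
    have hp : HasDerivAt (fun r : ℝ => π (((F (s, t0)).1 + r • q, q), t0))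
        (deriv (fun r : ℝ => π (((F (s, t0)).1 + r • q, q), t0)) 0) 0 :=
      (hpc.differentiable (by norm_num) 0).hasDerivAt
    have hp0 : π (((F (s, t0)).1 + (0:ℝ) • q, q), t0) = s := by
      rw [zero_smul, add_zero]
      exact hπs.self_of_nhds s hs
    have hx : HasFDerivAt (fun v => X (v, t0)) (fderiv ℝ (fun v => X (v, t0)) s) s :=
      ((hXc.comp (contDiff_id.prodMk contDiff_const)).differentiable (by norm_num) s).hasFDerivAt
    have hxp : HasDerivAt (fun r : ℝ => X (π (((F (s, t0)).1 + r • q, q), t0), t0))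
        (fderiv ℝ (fun v => X (v, t0)) s
          (deriv (fun r : ℝ => π (((F (s, t0)).1 + r • q, q), t0)) 0)) 0 := by
      refine HasFDerivAt.comp_hasDerivAt (l := fun v => X (v, t0))
        (f := fun r : ℝ => π (((F (s, t0)).1 + r • q, q), t0)) 0 ?_ hp
      rw [hp0]
      exact hx
    have h2 : HasDerivAt (fun r : ℝ => (F (s, t0)).1 + r • q) q 0 := by
      simpa using ((hasDerivAt_id (0:ℝ)).smul_const q).const_add (F (s, t0)).1
    have h3 := (h2.sub hxp).inner ℝ (hasDerivAt_const (0:ℝ) q)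
    have h4 := (hDd s t0 0).unique h3
    rw [h4]
    have h5 := hF.inner_fderiv_radial ht0 hs
      (deriv (fun r : ℝ => π (((F (s, t0)).1 + r • q, q), t0)) 0)
    rw [radProj_of_mem (norm_of_mem_sph hs)] at h5
    have h6 : ‖q‖ = 1 := norm_of_mem_sph (hF.mem_sphere s hs t0 ht0)
    rw [inner_zero_right, inner_sub_left, zero_add, real_inner_self_eq_norm_sq, h6]
    simp only [hX]
    rw [h5]
    norm_num
  have hev : ∀ᶠ p : ℝ × ℝ in 𝓝 (0, t0), ∀ s ∈ sph m, 0 < D (p, s) :=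
    (isCompact_sph m).eventually_forall_of_forall_eventually fun s hs =>
      (hDc.continuousAt (x := ((0, t0), s))).eventually_const_lt (hD1 s hs)
  obtain ⟨ρ, hρ, hb⟩ := Metric.eventually_nhds_iff.1 hev
  have hnear : ∀ᶠ p : ℝ × ℝ in 𝓝 (0, t0), dist p (0, t0) < ρ := Metric.ball_mem_nhds _ hρ
  filter_upwards [hnear, (continuous_snd.tendsto ((0:ℝ), t0)).eventually hπs] with p hp hps hp0
  obtain ⟨r, t⟩ := p
  simp only at hps hp0 ⊢
  rw [eq_empty_iff_forall_notMem]
  rintro _ ⟨⟨_, ⟨s, hs, rfl⟩, rfl⟩, ⟨s', hs', hss⟩⟩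
  simp only at hss
  have hΨ0 : ∀ s ∈ sph m, Ψ (F (s, t), t) = 0 := by
    intro s hs
    simp only [hΨ, hX]
    rw [hps s hs, radProj_of_mem (norm_of_mem_sph hs), sub_self, inner_zero_left]
  have e0 : Ψ (((F (s, t)).1 + (0:ℝ) • (F (s, t)).2, (F (s, t)).2), t) = 0 := by
    rw [zero_smul, add_zero]
    exact hΨ0 s hs
  have e1 : Ψ (((F (s, t)).1 + r • (F (s, t)).2, (F (s, t)).2), t) = 0 := by
    rw [← hss]
    exact hΨ0 s' hs'
  have hmono : StrictMonoOn (fun r : ℝ => Ψ (((F (s, t)).1 + r • (F (s, t)).2, (F (s, t)).2), t))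
      (uIcc 0 r) := by
    refine strictMonoOn_of_deriv_pos (convex_uIcc 0 r)
      (fun r' _ => (hDd s t r').continuousAt.continuousWithinAt) fun r' hr' => ?_
    rw [(hDd s t r').deriv]
    refine hb (y := (r', t)) ?_ s hs
    rw [Prod.dist_eq, max_lt_iff] at hp ⊢
    refine ⟨lt_of_le_of_lt ?_ hp.1, hp.2⟩
    simp only [Real.dist_eq]
    exact abs_sub_left_of_mem_uIcc (interior_subset hr')
  exact hp0 (hmono.injOn right_mem_uIcc left_mem_uIcc (e1.trans e0.symm))

end Flow

section Main

variable {m : ℕ} {x0 : EuclideanSpace ℝ (Fin m)} {F R : EuclideanSpace ℝ (Fin m) × ℝ → STSp m}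

theorem add_sub_mul_mem_Icc {a b : ℝ} (ha : a ∈ Icc (0:ℝ) 1) (hb : b ∈ Icc (0:ℝ) 1) :
    ∀ t ∈ Icc (0:ℝ) 1, a + (b - a) * t ∈ Icc (0:ℝ) 1 := by
  intro t ht
  have h := (convex_Icc (0:ℝ) 1).add_smul_sub_mem ha hb ht
  rwa [smul_eq_mul, mul_comm] at h

theorem LinkNonneg.flow_of_disjoint [Nontrivial (EuclideanSpace ℝ (Fin m))]
    (hF : IsLegIsotopyST m F) (hR : IsLegIsotopyST m R) {α α' c c' e e' : ℝ}
    (hc : c ∈ Icc (0:ℝ) 1) (hc' : c' ∈ Icc (0:ℝ) 1) (he : e ∈ Icc (0:ℝ) 1)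
    (he' : e' ∈ Icc (0:ℝ) 1)
    (hd : ∀ t ∈ Icc (0:ℝ) 1, wave (α + (α' - α) * t) (stSlice m F (c + (c' - c) * t)) ∩
      stSlice m R (e + (e' - e) * t) = ∅)
    (h0 : LinkNonneg x0 (wave α (stSlice m F c)) (stSlice m R e)) :
    LinkNonneg x0 (wave α' (stSlice m F c')) (stSlice m R e') := by
  have h := LinkNonneg.of_disjoint_isotopy (x0 := x0)
    (hF.flowIsotopy α (α' - α) (add_sub_mul_mem_Icc hc hc')) (hR.flowIsotopy 0 0 (add_sub_mul_mem_Icc he he'))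
    (fun t ht => by
      rw [stSlice_flowIsotopy, stSlice_flowIsotopy, zero_mul, add_zero, wave_zero]
      exact hd t ht)
    (by simpa [stSlice_flowIsotopy, wave_zero] using h0)
  simpa [stSlice_flowIsotopy, wave_zero] using h

theorem LinkNonneg.flow_of_nonneg [Nontrivial (EuclideanSpace ℝ (Fin m))]
    (hF : IsLegIsotopyST m F) (hnn : NonnegST m F) {α α' : ℝ} (hα : α < α') {B : Set (STSp m)}
    (h0 : LinkNonneg x0 (wave α (stSlice m F 0)) B) :
    LinkNonneg x0 (wave α' (stSlice m F 1)) B := by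
  have hseg : ∀ t ∈ Icc (0:ℝ) 1, 0 + 1 * t ∈ Icc (0:ℝ) 1 := fun t ht => by simpa using ht
  have h := LinkNonneg.of_pos_isotopy (x0 := x0) (hF.flowIsotopy α (α' - α) hseg)
    (fun t ht s hs => by
      rw [hF.inner_deriv_flowIsotopy _ _ _ _ (hseg t ht) hs]
      have := hnn s hs _ (hseg t ht)
      linarith) (B := B)
    (by simpa [stSlice_flowIsotopy] using h0)
  simpa [stSlice_flowIsotopy] using h

theorem nonnegST_fibIsotopy (x0 : EuclideanSpace ℝ (Fin m)) : NonnegST m (fibIsotopy x0) := by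
  intro s _ t _
  simp [fibIsotopy]

end Main

theorem nonneg_isotopy_ordered_links_not_isotopic (m : ℕ) (hm : 2 ≤ m)
    (F : EuclideanSpace ℝ (Fin m) × ℝ → STSp m)
    (hF : IsLegIsotopyST m F) (hnn : NonnegST m F)
    (hdisj : stSlice m F 0 ∩ stSlice m F 1 = ∅)
    (hfib : ∃ (x : EuclideanSpace ℝ (Fin m)) (G : EuclideanSpace ℝ (Fin m) × ℝ → STSp m),
      IsLegIsotopyST m G ∧ stSlice m G 0 = stSlice m F 0 ∧ stSlice m G 1 = fib m x) :
    ¬ LegLinkIsotopic m (stSlice m F 0) (stSlice m F 1) (stSlice m F 1) (stSlice m F 0) := by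
  rintro ⟨A, B, hA, hB, hA0, hB0, hA1, hB1, hAB⟩
  obtain ⟨x0, G, hG, hG0, hG1⟩ := hfib
  have : NeZero m := ⟨by omega⟩
  have : Nontrivial (EuclideanSpace ℝ (Fin m)) := inferInstance
  have i0 : (0:ℝ) ∈ Icc (0:ℝ) 1 := ⟨le_rfl, zero_le_one⟩
  have i1 : (1:ℝ) ∈ Icc (0:ℝ) 1 := ⟨zero_le_one, le_rfl⟩
  obtain ⟨ρ, hρ, hev⟩ := Metric.eventually_nhds_iff.1
    (((hF.eventually_no_chords.and hG.eventually_no_chords).and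
      (eventually_wave_inter_eq_empty (isCompact_stSlice hF 0) (isCompact_stSlice hF 1) hdisj)).and
      (eventually_wave_inter_eq_empty (isCompact_stSlice hF 1) (isCompact_stSlice hF 0)
        ((inter_comm _ _).trans hdisj)))
  set ε := ρ / 3 with hε
  have hε0 : 0 < ε := by positivity
  have hsmall : ∀ {r : ℝ}, |r| ≤ 2 * ε → dist r 0 < ρ := fun {r} hr => by
    rw [Real.dist_eq, sub_zero]
    linarith
  have hpos : dist ε 0 < ρ := hsmall (by rw [abs_of_pos hε0]; linarith)
  have hneg : dist (-ε) 0 < ρ := hsmall (by rw [abs_neg, abs_of_pos hε0]; linarith)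
  have segment_mem : ∀ t ∈ Icc (0:ℝ) 1, dist (2 * ε + (0 - 2 * ε) * t) 0 < ρ := fun t ht =>
    hsmall (by rw [abs_le]; constructor <;> nlinarith [ht.1, ht.2])
  have segment_mem' : ∀ t ∈ Icc (0:ℝ) 1, dist (0 + (-(2 * ε) - 0) * t) 0 < ρ := fun t ht =>
    hsmall (by rw [abs_le]; constructor <;> nlinarith [ht.1, ht.2])
  have h1 : LinkNonneg x0 (wave ε (fib m x0)) (fib m x0) := by
    have h := LinkNonneg.flow_of_nonneg (isLegIsotopyST_fibIsotopy x0) (nonnegST_fibIsotopy x0)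
      (x0 := x0) (B := fib m x0) hε0 (by
        rw [wave_zero, stSlice_fibIsotopy]
        exact linkNonneg_fib x0)
    rwa [stSlice_fibIsotopy] at h
  have h2 : LinkNonneg x0 (wave ε (stSlice m F 0)) (stSlice m F 0) := by
    rw [← hG0]
    refine LinkNonneg.flow_of_disjoint hG hG (α := ε) i1 i0 i1 i0 (fun t ht => ?_) (by rwa [hG1])
    rw [sub_self, zero_mul, add_zero]
    exact (hev hpos).1.1.2 _ (add_sub_mul_mem_Icc i1 i0 t ht) hε0.ne'
  have h3 : LinkNonneg x0 (wave (2 * ε) (stSlice m F 1)) (stSlice m F 0) :=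
    LinkNonneg.flow_of_nonneg hF hnn (by linarith) h2
  have h4 : LinkNonneg x0 (wave 0 (stSlice m F 1)) (stSlice m F 0) := by
    refine LinkNonneg.flow_of_disjoint hF hF i1 i1 i0 i0 (fun t ht => ?_) h3
    simp only [sub_self, zero_mul, add_zero]
    exact (hev (segment_mem t ht)).2
  have h5 : LinkNonneg x0 (wave 0 (stSlice m F 0)) (stSlice m F 1) := by
    rw [wave_zero] at h4 ⊢
    rw [← hB1, ← hA1]
    exact LinkNonneg.of_disjoint_isotopy hB hA (fun t ht => (inter_comm _ _).trans (hAB t ht))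
      (by rwa [hB0, hA0])
  have h6 : LinkNonneg x0 (wave (-(2 * ε)) (stSlice m F 0)) (stSlice m F 1) := by
    refine LinkNonneg.flow_of_disjoint hF hF i0 i0 i1 i1 (fun t ht => ?_) h5
    simp only [sub_self (0:ℝ), sub_self (1:ℝ), zero_mul, add_zero]
    exact (hev (segment_mem' t ht)).1.2
  have h7 : LinkNonneg x0 (wave (-ε) (stSlice m F 1)) (stSlice m F 1) :=
    LinkNonneg.flow_of_nonneg hF hnn (by linarith) h6
  have h8 : LinkNonneg x0 (wave (-ε) (stSlice m F 0)) (stSlice m F 0) := by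
    refine LinkNonneg.flow_of_disjoint hF hF i1 i0 i1 i0 (fun t ht => ?_) h7
    rw [sub_self, zero_mul, add_zero]
    exact (hev hneg).1.1.1 _ (add_sub_mul_mem_Icc i1 i0 t ht) (neg_ne_zero.2 hε0.ne')
  have h9 : LinkNonneg x0 (wave (-ε) (fib m x0)) (fib m x0) := by
    rw [← hG1]
    refine LinkNonneg.flow_of_disjoint hG hG (α := -ε) i0 i1 i0 i1 (fun t ht => ?_) (by rwa [hG0])
    rw [sub_self, zero_mul, add_zero]
    exact (hev hneg).1.1.2 _ (add_sub_mul_mem_Icc i0 i1 t ht) (neg_ne_zero.2 hε0.ne')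
  refine not_linkNonneg_of_neg hε0 ?_ h9
  rintro _ ⟨z, ⟨hz1, hz2⟩, rfl⟩
  refine ⟨hz2, ?_⟩
  rw [mem_singleton_iff] at hz1
  simp only [hz1, neg_smul, sub_eq_add_neg]
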